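/- Let X ⊂ ℙ^r be the Segre embedding of (ℙ^m)^s with m > 1 and r + 1 = (m+1)^s, over an algebraically closed field of characteristic 0. Set a = ⌊(m+1)^s/(ms+1)⌋ and let ε be the unique integer with 0 ≤ ε ≤ m and a ≡ ε (mod m+1). If either ε > 0 or (k+ms)(sm+1) ≤ (m+1)^s − 1, set a' = a − ε; if ε = 0 and (ms+1)a = (m+1)^s, set a' = a − 1. Then for any positive integer k with k + ms − 1 ≤ a', X is not weakly k-defective, and hence it is k-identifiable. -/

import Mathlib

noncomputable section

namespace ContactLoci

variable {K : Type*} [Field K] {ι : Type*} [Fintype ι]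

/-- Projective space over `K` with homogeneous coordinates indexed by `ι`. -/
abbrev PP (K : Type*) [Field K] (ι : Type*) : Type _ :=
  Projectivization K (ι → K)

/-- The affine cone over a set of projective points. -/
def coneOf (S : Set (PP K ι)) : Set (ι → K) :=
  ⋃ x ∈ S, (x.submodule : Set (ι → K))

/-- The linear span, in the underlying vector space, of the cone over `S`. -/
def vspan (S : Set (PP K ι)) : Submodule K (ι → K) :=
  Submodule.span K (coneOf S)

/-- The projective linear span of a set of projective points. -/
def projSpan (S : Set (PP K ι)) : Set (PP K ι) :=
  {x | x.submodule ≤ vspan S}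

/-- The projective dimension of the linear span of `S` (`-1` for `S = ∅`). -/
def projDim (S : Set (PP K ι)) : ℤ :=
  (Module.finrank K (vspan S) : ℤ) - 1

/-- A set of projective points is non-degenerate if its linear span is everything. -/
def Nondegenerate (S : Set (PP K ι)) : Prop :=
  vspan S = ⊤

/-- The common zero locus in projective space of a set of polynomials. -/
def zeroLocus (S : Set (MvPolynomial ι K)) : Set (PP K ι) :=
  {x | ∀ f ∈ S, ∀ v ∈ x.submodule, MvPolynomial.eval v f = 0}

/-- Zariski-closed subsets of projective space: common zero loci of sets of
homogeneous polynomials. -/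
def IsZClosed (X : Set (PP K ι)) : Prop :=
  ∃ S : Set (MvPolynomial ι K), (∀ f ∈ S, ∃ d : ℕ, f.IsHomogeneous d) ∧ X = zeroLocus S

/-- Zariski closure. -/
def zclosure (S : Set (PP K ι)) : Set (PP K ι) :=
  ⋂₀ {Y | IsZClosed Y ∧ S ⊆ Y}

/-- Irreducibility with respect to the Zariski topology. -/
def IsZIrreducible (S : Set (PP K ι)) : Prop :=
  S.Nonempty ∧ ∀ Y Z : Set (PP K ι), IsZClosed Y → IsZClosed Z → S ⊆ Y ∪ Z → S ⊆ Y ∨ S ⊆ Z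

/-- An integral projective variety: a Zariski-closed irreducible subset. -/
def IsIntegralVariety (X : Set (PP K ι)) : Prop :=
  IsZClosed X ∧ IsZIrreducible X

/-- `C` is an irreducible component of `S`: a maximal irreducible subset of `S`. -/
def IsZIrredComponent (S C : Set (PP K ι)) : Prop :=
  IsZIrreducible C ∧ C ⊆ S ∧ ∀ D : Set (PP K ι), IsZIrreducible D → D ⊆ S → C ⊆ D → C = D

/-- The dimension of a set: the Krull dimension of the poset of irreducible
Zariski-closed subsets of its Zariski closure (`⊥` for the empty set). -/
def zdim (S : Set (PP K ι)) : WithBot ℕ∞ :=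
  Order.krullDim ({Y : Set (PP K ι) // IsZClosed Y ∧ IsZIrreducible Y ∧ Y ⊆ zclosure S})

/-- A property holds at a general point of `X`: it holds away from a proper
Zariski-closed subset. -/
def HoldsGenerically (X : Set (PP K ι)) (P : PP K ι → Prop) : Prop :=
  ∃ Y : Set (PP K ι), IsZClosed Y ∧ ¬X ⊆ Y ∧ ∀ x ∈ X \ Y, P x

/-- Zero locus of multihomogeneous polynomials in a self-product of projective space. -/
def multiZeroLocus {m : ℕ} (S : Set (MvPolynomial (Fin m × ι) K)) :
    Set (Fin m → PP K ι) :=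
  {u | ∀ f ∈ S, ∀ v : Fin m → ι → K, (∀ i, v i ∈ (u i).submodule) →
    MvPolynomial.eval (fun p => v p.1 p.2) f = 0}

/-- Zariski-closed subsets of the `m`-fold self-product of projective space. -/
def IsMultiZClosed {m : ℕ} (T : Set (Fin m → PP K ι)) : Prop :=
  ∃ S : Set (MvPolynomial (Fin m × ι) K),
    (∀ f ∈ S, ∀ i : Fin m, ∃ d : ℕ,
      MvPolynomial.IsWeightedHomogeneous (fun p : Fin m × ι => if p.1 = i then 1 else 0) f d) ∧
    T = multiZeroLocus S

/-- A property holds for a general `m`-tuple of points of `X`. -/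
def HoldsForGeneralTuples (X : Set (PP K ι)) (m : ℕ) (P : (Fin m → PP K ι) → Prop) : Prop :=
  ∃ T : Set (Fin m → PP K ι), IsMultiZClosed T ∧
    (∃ u : Fin m → PP K ι, (∀ i, u i ∈ X) ∧ u ∉ T) ∧
    ∀ u : Fin m → PP K ι, (∀ i, u i ∈ X) → u ∉ T → P u

/-- The homogeneous vanishing ideal of `X` (as a set of homogeneous polynomials). -/
def homogVanishingIdeal (X : Set (PP K ι)) : Set (MvPolynomial ι K) :=
  {f | (∃ d : ℕ, f.IsHomogeneous d) ∧ ∀ x ∈ X, ∀ v ∈ x.submodule, MvPolynomial.eval v f = 0}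

/-- The embedded (projective) tangent space of `X` at `x`. -/
def embTangentSpace (X : Set (PP K ι)) (x : PP K ι) : Set (PP K ι) :=
  {y | ∀ f ∈ homogVanishingIdeal X,
    ∑ i : ι, y.rep i * MvPolynomial.eval x.rep (MvPolynomial.pderiv i f) = 0}

/-- Smooth points of `X`. -/
def IsSmoothPoint (X : Set (PP K ι)) (x : PP K ι) : Prop :=
  x ∈ X ∧ zdim (embTangentSpace X x) = zdim X

/-- `M_A`: the linear span of the tangent spaces of `X` at the points of `A`. -/
def tangentSpan (X A : Set (PP K ι)) : Set (PP K ι) :=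
  projSpan (⋃ a ∈ A, embTangentSpace X a)

/-- The locus of smooth points of `X` at which `M_A` is tangent to `X`. -/
def tangencyLocus (X A : Set (PP K ι)) : Set (PP K ι) :=
  {x | IsSmoothPoint X x ∧ embTangentSpace X x ⊆ tangentSpan X A}

/-- The tangential contact locus of `X` at `A`: the closure of the union of the
irreducible components of the tangency locus meeting `A`. -/
def contactLocus (X A : Set (PP K ι)) : Set (PP K ι) :=
  zclosure (⋃ C ∈ {C : Set (PP K ι) |
    IsZIrredComponent (tangencyLocus X A) C ∧ (C ∩ A).Nonempty}, C)

/-- `X` is weakly `k`-defective: the tangential contact locus at `k` general points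
has positive dimension. -/
def WeaklyDefective (X : Set (PP K ι)) (k : ℕ) : Prop :=
  HoldsForGeneralTuples X k fun u => 0 < zdim (contactLocus X (Set.range u))

/-- The `k`-th secant variety of `X`. -/
def secant (k : ℕ) (X : Set (PP K ι)) : Set (PP K ι) :=
  zclosure {q | ∃ S : Finset (PP K ι), ↑S ⊆ X ∧ S.card = k ∧ q ∈ projSpan (S : Set (PP K ι))}

/-- The `X`-rank of a point. -/
def xrank (X : Set (PP K ι)) (q : PP K ι) : ℕ :=
  sInf {k | ∃ S : Finset (PP K ι), ↑S ⊆ X ∧ S.card = k ∧ q ∈ projSpan (S : Set (PP K ι))}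

/-- `𝒮(q,X)`: the set of minimal `X`-decompositions of `q`. -/
def decompositions (X : Set (PP K ι)) (q : PP K ι) : Set (Finset (PP K ι)) :=
  {S | ↑S ⊆ X ∧ S.card = xrank X q ∧ q ∈ projSpan (S : Set (PP K ι))}

/-- `X` is `k`-identifiable: a general point of `σ_k(X)` has a unique minimal
decomposition. -/
def Identifiable (X : Set (PP K ι)) (k : ℕ) : Prop :=
  HoldsGenerically (secant k X) fun q => ∃! S : Finset (PP K ι), S ∈ decompositions X q

/-- `α` is the `k`-th secant degree of `X`. -/
def HasSecantDegree (X : Set (PP K ι)) (k α : ℕ) : Prop :=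
  HoldsGenerically (secant k X) fun q => (decompositions X q).ncard = α

/-- Projective linear subspaces. -/
def IsProjLinear (L : Set (PP K ι)) : Prop :=
  L = projSpan L

/-- Lines in projective space. -/
def IsLine (L : Set (PP K ι)) : Prop :=
  IsProjLinear L ∧ Module.finrank K (vspan L) = 2

/-- `X` is uniruled by lines: through a general point of `X` there is a line
contained in `X`. -/
def UniruledByLines (X : Set (PP K ι)) : Prop :=
  HoldsGenerically X fun x => ∃ L : Set (PP K ι), IsLine L ∧ x ∈ L ∧ L ⊆ X

/-- The join of two sets in projective space. -/
def join (A B : Set (PP K ι)) : Set (PP K ι) :=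
  zclosure (⋃ a ∈ A, ⋃ b ∈ B, projSpan {a, b})

/-- The linear space `M` is tangent to `X` along `W`. -/
def TangentAlong (M X W : Set (PP K ι)) : Prop :=
  ∀ x ∈ W, IsSmoothPoint X x → embTangentSpace X x ⊆ M

/-- `S` has exactly `m` irreducible components, all of them projective linear
subspaces, and these components are linearly independent. -/
def ComponentsAreIndepLinear (S : Set (PP K ι)) (m : ℕ) : Prop :=
  ∃ C : Fin m → Set (PP K ι), Function.Injective C ∧
    (∀ D : Set (PP K ι), IsZIrredComponent S D ↔ ∃ i, D = C i) ∧
    (∀ i, IsProjLinear (C i)) ∧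
    Module.finrank K (vspan S) = ∑ i, Module.finrank K (vspan (C i))


/-- The Segre variety: the image of `ℙ^{n 1} × ⋯ × ℙ^{n s}` under the Segre
embedding, given by the complete linear system `|O(1,…,1)|`. -/
def segreVariety (K : Type*) [Field K] (s : ℕ) (n : Fin s → ℕ) :
    Set (PP K (∀ i : Fin s, Fin (n i + 1))) :=
  {x | ∃ u : ∀ i : Fin s, Fin (n i + 1) → K,
    x.submodule = Submodule.span K
      ({fun t => ∏ i, u i (t i)} : Set ((∀ i : Fin s, Fin (n i + 1)) → K))}

/-- The projection of `L ⊆ Segre` to the `i`-th factor is a single point, i.e. `L`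
lies in a single fiber of the `i`-th projection. -/
def SegreFactorIsPoint (K : Type*) [Field K] (s : ℕ) (n : Fin s → ℕ) (i : Fin s)
    (L : Set (PP K (∀ j : Fin s, Fin (n j + 1)))) : Prop :=
  ∃ w : Fin (n i + 1) → K, w ≠ 0 ∧ ∀ x ∈ L,
    ∃ u : ∀ j : Fin s, Fin (n j + 1) → K,
      x.submodule = Submodule.span K
        ({fun t => ∏ j, u j (t j)} : Set ((∀ j : Fin s, Fin (n j + 1)) → K)) ∧
      u i ∈ Submodule.span K ({w} : Set (Fin (n i + 1) → K))

/-- Index type for the Segre–Veronese embedding of multidegree `d`: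
multi-indices of degree `d i` in the homogeneous variables of the `i`-th factor. -/
abbrev svIndex (s : ℕ) (n d : Fin s → ℕ) : Type :=
  ∀ i : Fin s, {w : Fin (n i + 1) → Fin (d i + 1) // ∑ j, (w j : ℕ) = d i}

/-- The Segre–Veronese variety of multidegree `d`: the image of
`ℙ^{n 1} × ⋯ × ℙ^{n s}` under the embedding by `|L_1^{d 1} ⊗ ⋯ ⊗ L_s^{d s}|`. -/
def segreVeroneseVariety (K : Type*) [Field K] (s : ℕ) (n d : Fin s → ℕ) :
    Set (PP K (svIndex s n d)) :=
  {x | ∃ u : ∀ i : Fin s, Fin (n i + 1) → K,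
    x.submodule = Submodule.span K
      ({fun t => ∏ i, ∏ j, u i j ^ ((t i).1 j : ℕ)} : Set (svIndex s n d → K))}

/-- The vector of the moments of degree `≤ d` of the one-dimensional Gaussian
distribution with mean `μ` and variance `t`. -/
def gaussMomentVec (K : Type*) [Field K] (d : ℕ) (μ t : K) : Fin (d + 1) → K := fun i =>
  ∑ j ∈ Finset.range ((i : ℕ) / 2 + 1),
    ((Nat.choose (i : ℕ) (2 * j) * Nat.doubleFactorial (2 * j - 1) : ℕ) : K) *
      t ^ j * μ ^ ((i : ℕ) - 2 * j)

/-- The Gaussian moment variety `𝒢_{1,d} ⊆ ℙ^d`. -/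
def gaussianMomentVariety (K : Type*) [Field K] (d : ℕ) : Set (PP K (Fin (d + 1))) :=
  zclosure {x | ∃ μ t : K,
    x.submodule = Submodule.span K ({gaussMomentVec K d μ t} : Set (Fin (d + 1) → K))}

/-- Zariski-closed families of `m`-tuples of coefficient vectors of linear forms. -/
def IsAffineClosedFamily {m : ℕ} (T : Set (Fin m → ι → K)) : Prop :=
  ∃ S : Set (MvPolynomial (Fin m × ι) K),
    T = {h | ∀ f ∈ S, MvPolynomial.eval (fun p => h p.1 p.2) f = 0}

/-- The linear subspace cut out by the `m` linear forms with coefficient vectors `h`. -/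
def linearSlice {m : ℕ} (h : Fin m → ι → K) : Set (PP K ι) :=
  {x | ∀ j : Fin m, ∑ i : ι, h j i * x.rep i = 0}

/-- `x` lies on the hyperplane with coefficient vector `f`. -/
def inHyperplane (f : ι → K) (x : PP K ι) : Prop :=
  ∑ i : ι, f i * x.rep i = 0

/-- `X ⊆ ℙ^r` (of dimension `n`, `r + 1 = card ι`) is very strange: for a general
codimension-`n` linear subspace `M`, some `r - n + 2` points of `X ∩ M` lie in a
hyperplane of `M`, i.e. in a linear subspace of projective dimension `r - n - 1`. -/
def VeryStrange (n : ℕ) (X : Set (PP K ι)) : Prop :=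
  ∃ T : Set (Fin n → ι → K), IsAffineClosedFamily T ∧ (∃ h, h ∉ T) ∧
    ∀ h : Fin n → ι → K, h ∉ T →
      ∃ A : Finset (PP K ι), ↑A ⊆ X ∩ linearSlice h ∧
        A.card = Fintype.card ι + 1 - n ∧
        Module.finrank K (vspan (A : Set (PP K ι))) ≤ Fintype.card ι - 1 - n


section
open MvPolynomial Module
universe u

section
/-- multilinear Segre map -/
def segM (R : Type*) [CommRing R] (s q : ℕ) :
    MultilinearMap R (fun _ : Fin s => Fin q → R) ((Fin s → Fin q) → R) :=
  MultilinearMap.pi fun p =>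
    (MultilinearMap.mkPiAlgebra R (Fin s) R).compLinearMap (fun j => LinearMap.proj (p j))

def seg {R : Type*} [CommRing R] {s q : ℕ} (u : Fin s → Fin q → R) : (Fin s → Fin q) → R :=
  fun p => ∏ j, u j (p j)

theorem segM_apply {R : Type*} [CommRing R] {s q : ℕ} (u : Fin s → Fin q → R) :
    segM R s q u = seg u := by
  ext p; simp [segM, seg]

/-- tangent vector -/
def tv {R : Type*} [CommRing R] {s q : ℕ} (u : Fin s → Fin q → R) (j : Fin s) (w : Fin q → R) :
    (Fin s → Fin q) → R := seg (Function.update u j w)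

def tvL {R : Type*} [CommRing R] {s q : ℕ} (u : Fin s → Fin q → R) (j : Fin s) :
    (Fin q → R) →ₗ[R] ((Fin s → Fin q) → R) := (segM R s q).toLinearMap u j

theorem tvL_apply {R : Type*} [CommRing R] {s q : ℕ} (u : Fin s → Fin q → R) (j : Fin s)
    (w : Fin q → R) : tvL u j w = tv u j w := by
  simp [tvL, tv, segM_apply]

def tb {R : Type*} [CommRing R] {s q : ℕ} (u : Fin s → Fin q → R) (c : Fin s × Fin q) :
    (Fin s → Fin q) → R := tv u c.1 (Pi.single c.2 1)

def Tsp {R : Type*} [CommRing R] {s q : ℕ} (u : Fin s → Fin q → R) :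
    Submodule R ((Fin s → Fin q) → R) := Submodule.span R (Set.range (tb u))

theorem tv_self {R : Type*} [CommRing R] {s q : ℕ} (u : Fin s → Fin q → R) (j : Fin s) :
    tv u j (u j) = seg u := by simp [tv]

theorem tv_apply {R : Type*} [CommRing R] {s q : ℕ} (u : Fin s → Fin q → R) (j : Fin s)
    (w : Fin q → R) (p : Fin s → Fin q) :
    tv u j w p = w (p j) * ∏ i ∈ Finset.univ.erase j, u i (p i) := by
  unfold tv seg
  rw [← Finset.mul_prod_erase _ _ (Finset.mem_univ j)]
  congr 1
  · simp
  · apply Finset.prod_congr rfl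
    intro i hi
    rw [Function.update_of_ne (Finset.ne_of_mem_erase hi)]

theorem tv_eq_sum {R : Type*} [CommRing R] {s q : ℕ} (u : Fin s → Fin q → R) (j : Fin s)
    (w : Fin q → R) : tv u j w = ∑ a, w a • tb u (j, a) := by
  have : w = ∑ a, w a • (Pi.single a 1 : Fin q → R) := by
    ext b; simp [Finset.sum_apply, Pi.single_apply]
  conv_lhs => rw [this]
  rw [← tvL_apply, map_sum]
  simp [tvL_apply, tb]

theorem tb_mem {R : Type*} [CommRing R] {s q : ℕ} (u : Fin s → Fin q → R) (c : Fin s × Fin q) :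
    tb u c ∈ Tsp u := Submodule.subset_span ⟨c, rfl⟩

theorem tv_mem {R : Type*} [CommRing R] {s q : ℕ} (u : Fin s → Fin q → R) (j : Fin s)
    (w : Fin q → R) : tv u j w ∈ Tsp u := by
  rw [tv_eq_sum]
  exact Submodule.sum_mem _ fun a _ => Submodule.smul_mem _ _ (tb_mem u _)

theorem seg_mem {R : Type*} [CommRing R] {s q : ℕ} (u : Fin (s+1) → Fin q → R) :
    seg u ∈ Tsp u := by
  rw [← tv_self u 0]; exact tv_mem _ _ _

theorem mem_Tsp {R : Type*} [CommRing R] {s q : ℕ} {u : Fin s → Fin q → R}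
    {v : (Fin s → Fin q) → R} : v ∈ Tsp u ↔ ∃ w : Fin s → Fin q → R, v = ∑ j, tv u j (w j) := by
  constructor
  · intro h
    unfold Tsp at h
    rw [Submodule.mem_span_range_iff_exists_fun] at h
    obtain ⟨c, rfl⟩ := h
    refine ⟨fun j a => c (j, a), ?_⟩
    simp_rw [tv_eq_sum]
    rw [Fintype.sum_prod_type]
  · rintro ⟨w, rfl⟩
    exact Submodule.sum_mem _ fun j _ => tv_mem _ _ _

theorem finrank_Tsp_le {F : Type*} [Field F] {s m : ℕ} (u : Fin (s+1) → Fin (m+1) → F) :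
    Module.finrank F (Tsp u) ≤ m * (s+1) + 1 := by
  by_cases h : ∀ j, ∃ a, u j a ≠ 0
  · choose a ha using h
    let g : Option (Fin (s+1) × Fin m) → ((Fin (s+1) → Fin (m+1)) → F) := fun o =>
      match o with
      | none => seg u
      | some c => tb u (c.1, (a c.1).succAbove c.2)
    have hle : Tsp u ≤ Submodule.span F (Set.range g) := by
      unfold Tsp
      rw [Submodule.span_le]
      rintro _ ⟨⟨j, b⟩, rfl⟩
      have hs : ∀ c : Fin m, tb u (j, (a j).succAbove c) ∈ Submodule.span F (Set.range g) :=
        fun c => Submodule.subset_span ⟨some (j, c), rfl⟩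
      have h0 : seg u ∈ Submodule.span F (Set.range g) := Submodule.subset_span ⟨none, rfl⟩
      by_cases hb : b = a j
      · subst hb
        have h1 : seg u = u j (a j) • tb u (j, a j)
            + ∑ c, u j ((a j).succAbove c) • tb u (j, (a j).succAbove c) := by
          rw [← tv_self u j, tv_eq_sum, Fin.sum_univ_succAbove _ (a j)]
        have h2 : tb u (j, a j) = (u j (a j))⁻¹ • (seg u -
            ∑ c, u j ((a j).succAbove c) • tb u (j, (a j).succAbove c)) := by
          rw [h1, add_sub_cancel_right, smul_smul, inv_mul_cancel₀ (ha j), one_smul]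
        change tb u (j, a j) ∈ _
        rw [h2]
        exact Submodule.smul_mem _ _ (Submodule.sub_mem _ h0
          (Submodule.sum_mem _ fun c _ => Submodule.smul_mem _ _ (hs c)))
      · obtain ⟨c, rfl⟩ := Fin.exists_succAbove_eq hb
        exact hs c
    refine (Submodule.finrank_mono hle).trans ((finrank_range_le_card g).trans ?_)
    simp [mul_comm]
  · push Not at h
    obtain ⟨j, hj⟩ := h
    let g : Fin (m+1) → ((Fin (s+1) → Fin (m+1)) → F) := fun a => tb u (j, a)
    have hle : Tsp u ≤ Submodule.span F (Set.range g) := by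
      unfold Tsp
      rw [Submodule.span_le]
      rintro _ ⟨⟨j', b⟩, rfl⟩
      by_cases hb : j' = j
      · subst hb; exact Submodule.subset_span ⟨b, rfl⟩
      · have : tb u (j', b) = 0 := by
          ext p
          simp only [tb, tv_apply]
          rw [Finset.prod_eq_zero (i := j)]
          · simp
          · simp [Ne.symm hb]
          · simp [hj]
        rw [this]; exact Submodule.zero_mem _
    refine (Submodule.finrank_mono hle).trans ((finrank_range_le_card g).trans ?_)
    simp
    nlinarith

/-- basis tensors are rank one -/
theorem seg_single {R : Type*} [CommRing R] {s q : ℕ} (p : Fin s → Fin q) :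
    seg (fun j => (Pi.single (p j) 1 : Fin q → R)) = Pi.single p 1 := by
  ext p'
  simp only [seg, Pi.single_apply]
  by_cases h : p' = p
  · subst h; simp
  · rw [if_neg h]
    obtain ⟨j, hj⟩ := Function.ne_iff.1 h
    exact Finset.prod_eq_zero (Finset.mem_univ j) (by simp [hj])

theorem exists_seg_notMem {F : Type*} [Field F] {s q : ℕ} (U : Submodule F ((Fin s → Fin q) → F))
    (hU : U ≠ ⊤) : ∃ u : Fin s → Fin q → F, seg u ∉ U := by
  by_contra! h
  apply hU
  rw [eq_top_iff]
  intro v _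
  have : v = ∑ p, v p • (Pi.single p 1 : (Fin s → Fin q) → F) := by
    ext b; simp [Finset.sum_apply, Pi.single_apply]
  rw [this]
  refine Submodule.sum_mem _ fun p _ => Submodule.smul_mem _ _ ?_
  rw [← seg_single]; exact h _

theorem tv_smul_add {R : Type*} [CommRing R] {s q : ℕ} (u : Fin s → Fin q → R) (j : Fin s)
    (c : R) (w w' : Fin q → R) : tv u j (c • w + w') = c • tv u j w + tv u j w' := by
  simp [← tvL_apply]

theorem tv_smul {R : Type*} [CommRing R] {s q : ℕ} (u : Fin s → Fin q → R) (j : Fin s)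
    (c : R) (w : Fin q → R) : tv u j (c • w) = c • tv u j w := by
  simp [← tvL_apply]

theorem seg_map {R S : Type*} [CommRing R] [CommRing S] (φ : R →+* S) {s q : ℕ}
    (u : Fin s → Fin q → R) (p) : φ (seg u p) = seg (fun j a => φ (u j a)) p := by
  simp [seg]

theorem tv_map {R S : Type*} [CommRing R] [CommRing S] (φ : R →+* S) {s q : ℕ}
    (u : Fin s → Fin q → R) (j) (w) (p) :
    φ (tv u j w p) = tv (fun j a => φ (u j a)) j (fun a => φ (w a)) p := by
  simp [tv_apply]

theorem tb_map {R S : Type*} [CommRing R] [CommRing S] (φ : R →+* S) {s q : ℕ}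
    (u : Fin s → Fin q → R) (c) (p) :
    φ (tb u c p) = tb (fun j a => φ (u j a)) c p := by
  unfold tb; rw [tv_map]; congr 1
  ext a; simp [Pi.single_apply, apply_ite φ]

end

section
theorem open_rank {F : Type u} [Field F] {σ κ ι' : Type*} [Fintype ι']
    (f : κ → ι' → MvPolynomial σ F) (a0 : σ → F) (r : ℕ)
    (h : r ≤ finrank F (Submodule.span F (Set.range fun c p => eval a0 (f c p)))) :
    ∃ G : MvPolynomial σ F, G ≠ 0 ∧ ∀ (L : Type v) [Field L] [Algebra F L] (t : σ → L),
      aeval t G ≠ 0 →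
      r ≤ finrank L (Submodule.span L (Set.range fun c p => aeval t (f c p))) := by
  classical
  obtain ⟨g, hg, -, hli⟩ := Submodule.exists_fun_fin_finrank_span_eq F (Set.range fun c p => eval a0 (f c p))
  choose d hd using hg
  let e : Fin r → κ := fun i => d (Fin.castLE h i)
  have hli' : LinearIndependent F (fun i : Fin r => fun p => eval a0 (f (e i) p)) := by
    have := hli.comp (Fin.castLE h) (Fin.castLE_injective h)
    have h3 : (fun i : Fin r => fun p => eval a0 (f (e i) p)) = g ∘ Fin.castLE h := by
      funext i; exact hd _
    rw [h3]; exact this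
  obtain ⟨φ, hφ⟩ : ∃ φ : (ι' → F) →ₗ[F] (Fin r → F),
      ∀ i, φ (fun p => eval a0 (f (e i) p)) = Pi.single i 1 := by
    obtain ⟨φ, hφ⟩ := LinearMap.exists_leftInverse_of_injective
      (Fintype.linearCombination F (fun i : Fin r => fun p => eval a0 (f (e i) p)))
      (LinearMap.ker_eq_bot.2 (linearIndependent_iff_injective_fintypeLinearCombination.1 hli'))
    refine ⟨φ, fun i => ?_⟩
    have := LinearMap.congr_fun hφ (Pi.single i 1)
    simpa [Fintype.linearCombination_apply_single] using this
  let C : ι' → Fin r → F := fun p => φ (Pi.single p 1)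
  have hC : ∀ v i, φ v i = ∑ p, v p * C p i := by
    intro v i
    conv_lhs => rw [LinearMap.pi_apply_eq_sum_univ φ v]
    simp only [Finset.sum_apply, Pi.smul_apply, smul_eq_mul, C]
    refine Finset.sum_congr rfl fun p _ => ?_
    have : (fun j => if p = j then (1:F) else 0) = Pi.single p 1 := by
      ext j; simp [Pi.single_apply, eq_comm]
    rw [this]
  let M : Matrix (Fin r) (Fin r) (MvPolynomial σ F) := Matrix.of fun i j =>
    ∑ p, f (e i) p * MvPolynomial.C (C p j)
  have hM : ∀ i j, M i j = ∑ p, f (e i) p * MvPolynomial.C (C p j) := fun i j => rfl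
  refine ⟨M.det, ?_, ?_⟩
  · intro h0
    have : eval a0 M.det = 1 := by
      rw [RingHom.map_det]
      have : (eval a0).mapMatrix M = 1 := by
        ext i j
        have := congrFun (hφ i) j
        rw [hC] at this
        rw [RingHom.mapMatrix_apply, Matrix.map_apply, hM, map_sum]
        simp [this, Matrix.one_apply, Pi.single_apply, eq_comm]
      rw [this, Matrix.det_one]
    rw [h0] at this; simp at this
  · intro L _ _ t ht
    rw [AlgHom.map_det] at ht
    have hli2 : LinearIndependent L (fun i : Fin r => fun p => aeval t (f (e i) p)) := by
      have h1 : LinearIndependent L ((aeval t).mapMatrix M).row :=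
        Matrix.linearIndependent_rows_iff_isUnit.2 ((Matrix.isUnit_iff_isUnit_det _).2
          (isUnit_iff_ne_zero.2 ht))
      rw [Fintype.linearIndependent_iff] at h1 ⊢
      intro c hc i
      apply h1 c _ i
      ext j
      have : ∀ p, ∑ i, c i * aeval t (f (e i) p) = 0 := fun p => by
        simpa using congrFun hc p
      simp only [Finset.sum_apply, Pi.smul_apply, Matrix.row, AlgHom.mapMatrix_apply,
        Matrix.map_apply, M, Matrix.of_apply, map_sum, map_mul, smul_eq_mul, Finset.mul_sum, Pi.zero_apply]
      rw [Finset.sum_comm]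
      apply Finset.sum_eq_zero
      intro p _
      rw [← zero_mul (aeval t (MvPolynomial.C (C p j))), ← this p, Finset.sum_mul]
      exact Finset.sum_congr rfl fun i _ => by ring
    have h2 := finrank_span_eq_card hli2
    rw [Fintype.card_fin] at h2
    rw [← h2]
    apply Submodule.finrank_mono
    apply Submodule.span_mono
    rintro _ ⟨i, rfl⟩
    exact ⟨e i, rfl⟩

/-- nonzero polynomials over infinite fields are nonzero somewhere -/
theorem exists_eval_ne {F : Type*} [Field F] [Infinite F] {σ : Type*}
    {G : MvPolynomial σ F} (h : G ≠ 0) : ∃ a, eval a G ≠ 0 := by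
  by_contra! hh
  exact h (MvPolynomial.funext fun a => by simpa using hh a)

theorem open_rank_self {F : Type*} [Field F] {σ κ ι' : Type*} [Fintype ι']
    (f : κ → ι' → MvPolynomial σ F) (a0 : σ → F) (r : ℕ)
    (h : r ≤ finrank F (Submodule.span F (Set.range fun c p => eval a0 (f c p)))) :
    ∃ G : MvPolynomial σ F, G ≠ 0 ∧ ∀ a : σ → F, eval a G ≠ 0 →
      r ≤ finrank F (Submodule.span F (Set.range fun c p => eval a (f c p))) := by
  obtain ⟨G, hG, h2⟩ := open_rank f a0 r h
  exact ⟨G, hG, fun a ha => h2 F a ha⟩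

/-- combine finitely many generic conditions -/
theorem generic_combine {F : Type*} [Field F] [Infinite F] {σ B : Type*} [Fintype B]
    (Pr : B → (σ → F) → Prop)
    (h : ∀ b, ∃ G : MvPolynomial σ F, G ≠ 0 ∧ ∀ a : σ → F, eval a G ≠ 0 → Pr b a) :
    ∃ a : σ → F, ∀ b, Pr b a := by
  choose G hG hG' using h
  obtain ⟨a, ha⟩ := exists_eval_ne (Finset.prod_ne_zero_iff.2 fun b (_ : b ∈ Finset.univ) => hG b)
  refine ⟨a, fun b => hG' b a ?_⟩
  rw [map_prod, Finset.prod_ne_zero_iff] at ha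
  exact ha b (Finset.mem_univ _)

/-- greedy -/
theorem greedy {F : Type*} [Field F] {s q : ℕ} {P : Type*} (S : Finset P)
    (U : Submodule F ((Fin s → Fin q) → F)) (r : ℕ) (hr : r ≤ finrank F U + S.card)
    (hr2 : r ≤ q ^ s) :
    ∃ y : P → Fin s → Fin q → F,
      r ≤ finrank F (U ⊔ Submodule.span F ((fun i => seg (y i)) '' S) :
        Submodule F ((Fin s → Fin q) → F)) := by
  classical
  induction S using Finset.induction_on generalizing r with
  | empty => exact ⟨fun _ => 0, (by simpa using hr : r ≤ finrank F U).trans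
      (Submodule.finrank_mono le_sup_left)⟩
  | insert i S hi ih =>
    rw [Finset.card_insert_of_notMem hi] at hr
    obtain ⟨y, hy⟩ := ih (r - 1) (by omega) (by omega)
    set U' := U ⊔ Submodule.span F ((fun i => seg (y i)) '' S) with hU'
    by_cases hlt : r ≤ finrank F U'
    · refine ⟨y, hlt.trans (Submodule.finrank_mono ?_)⟩
      apply sup_le_sup_left
      apply Submodule.span_mono
      apply Set.image_mono
      simp
    · have hne : U' ≠ ⊤ := by
        intro h
        rw [h, finrank_top] at hlt
        simp at hlt
        omega
      obtain ⟨u, hu⟩ := exists_seg_notMem U' hne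
      refine ⟨Function.update y i u, ?_⟩
      have hlt2 : U' < U ⊔ Submodule.span F
          ((fun j => seg (Function.update y i u j)) '' (insert i S : Finset P)) := by
        rw [SetLike.lt_iff_le_and_exists]
        constructor
        · apply sup_le le_sup_left
          apply le_sup_of_le_right
          apply Submodule.span_mono
          rintro _ ⟨j, hj, rfl⟩
          refine ⟨j, by simp; right; exact hj, ?_⟩
          have : j ≠ i := by rintro rfl; exact hi hj
          simp [Function.update_of_ne this]
        · refine ⟨seg u, ?_, hu⟩
          apply Submodule.mem_sup_right
          apply Submodule.subset_span
          exact ⟨i, by simp, by simp⟩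
      have := Submodule.finrank_lt_finrank_of_lt hlt2
      omega

end

section
def Ufam {R : Type*} [CommRing R] {s q : ℕ} {N : Type*} [DecidableEq N] (G : Finset N)
    (x : N → Fin s → Fin q → R) : (N × (Fin s × Fin q)) ⊕ N → (Fin s → Fin q) → R :=
  Sum.elim (fun c => if c.1 ∈ G then tb (x c.1) c.2 else 0) (fun i => seg (x i))

def Usp {R : Type*} [CommRing R] {s q : ℕ} {N : Type*} [DecidableEq N] (G : Finset N)
    (x : N → Fin s → Fin q → R) : Submodule R ((Fin s → Fin q) → R) :=
  Submodule.span R (Set.range (Ufam G x))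

theorem Tsp_le_Usp {R : Type*} [CommRing R] {s q : ℕ} {N : Type*} [DecidableEq N] {G : Finset N}
    {x : N → Fin s → Fin q → R} {i : N} (hi : i ∈ G) : Tsp (x i) ≤ Usp G x := by
  unfold Tsp
  rw [Submodule.span_le]
  rintro _ ⟨c, rfl⟩
  exact Submodule.subset_span ⟨Sum.inl (i, c), by simp [Ufam, hi]⟩

theorem seg_mem_Usp {R : Type*} [CommRing R] {s q : ℕ} {N : Type*} [DecidableEq N] {G : Finset N}
    {x : N → Fin s → Fin q → R} (i : N) : seg (x i) ∈ Usp G x :=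
  Submodule.subset_span ⟨Sum.inr i, by simp [Ufam]⟩

theorem Usp_le {R : Type*} [CommRing R] {s q : ℕ} {N : Type*} [DecidableEq N] {G : Finset N}
    {x : N → Fin s → Fin q → R} {U : Submodule R ((Fin s → Fin q) → R)}
    (h1 : ∀ i ∈ G, Tsp (x i) ≤ U) (h2 : ∀ i, seg (x i) ∈ U) : Usp G x ≤ U := by
  unfold Usp
  rw [Submodule.span_le]
  rintro _ ⟨(⟨i, c⟩ | i), rfl⟩
  · by_cases hi : i ∈ G
    · simpa [Ufam, hi] using h1 i hi (tb_mem _ c)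
    · simp [Ufam, hi]
  · simpa [Ufam] using h2 i

theorem Ufam_map {R S : Type*} [CommRing R] [CommRing S] (φ : R →+* S) {s q : ℕ} {N : Type*}
    [DecidableEq N] (G : Finset N) (x : N → Fin s → Fin q → R) (c) (p) :
    φ (Ufam G x c p) = Ufam G (fun i j a => φ (x i j a)) c p := by
  rcases c with (c | c)
  · simp only [Ufam, Sum.elim_inl]
    split_ifs
    · exact tb_map φ _ _ _
    · simp
  · exact seg_map φ _ _

/-- generic variables -/
def gen (F : Type*) [Field F] (N : Type*) (s q : ℕ) :
    N → Fin s → Fin q → MvPolynomial (N × Fin s × Fin q) F := fun i j a => X (i, j, a)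

def pt {R : Type*} {N : Type*} {s q : ℕ} (a : N × Fin s × Fin q → R) : N → Fin s → Fin q → R :=
  fun i j b => a (i, j, b)

def unpt {R : Type*} {N : Type*} {s q : ℕ} (x : N → Fin s → Fin q → R) : N × Fin s × Fin q → R :=
  fun c => x c.1 c.2.1 c.2.2

theorem Usp_generic {F : Type*} [Field F] {s q : ℕ} {N : Type*} [DecidableEq N] (G : Finset N)
    (r : ℕ) (h : ∃ x : N → Fin s → Fin q → F, r ≤ finrank F (Usp G x)) :
    ∃ P : MvPolynomial (N × Fin s × Fin q) F, P ≠ 0 ∧ ∀ a, eval a P ≠ 0 →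
      r ≤ finrank F (Usp G (pt a)) := by
  obtain ⟨x, hx⟩ := h
  have key : ∀ a : N × Fin s × Fin q → F,
      Usp G (pt a) = Submodule.span F (Set.range fun c p => eval a (Ufam G (gen F N s q) c p)) := by
    intro a
    unfold Usp
    congr 2
    funext c p
    rw [Ufam_map]
    simp only [gen, eval_X]
    rfl
  obtain ⟨P, hP, h2⟩ := open_rank_self (Ufam G (gen F N s q)) (unpt x) r (by
    rw [← key]; exact hx)
  refine ⟨P, hP, fun a ha => ?_⟩
  rw [key]; exact h2 a ha

/-- non-defectivity -/
def ND (F : Type*) [Field F] (m s k : ℕ) : Prop :=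
  ∃ x : Fin k → Fin s → Fin (m+1) → F,
    k * (m * s + 1) ≤ finrank F (⨆ i, Tsp (x i) : Submodule F ((Fin s → Fin (m+1)) → F))

theorem MND {F : Type*} [Field F] {m s : ℕ} {N : Type*} [Fintype N] [DecidableEq N] (G : Finset N)
    (h : ND F m s G.card)
    (h2 : G.card * (m * s + 1) + (Fintype.card N - G.card) ≤ (m+1) ^ s) :
    ∃ x : N → Fin s → Fin (m+1) → F,
      G.card * (m * s + 1) + (Fintype.card N - G.card) ≤ finrank F (Usp G x) := by
  obtain ⟨x0, hx0⟩ := h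
  obtain ⟨y, hy⟩ := greedy (Finset.univ \ G) (⨆ i, Tsp (x0 i)) _
    (by rw [Finset.card_univ_diff]; exact Nat.add_le_add_right hx0 _) h2
  let e := G.equivFin
  refine ⟨fun i => if hi : i ∈ G then x0 (e ⟨i, hi⟩) else y i, hy.trans ?_⟩
  apply Submodule.finrank_mono
  apply sup_le
  · apply iSup_le
    intro i
    have := Tsp_le_Usp (G := G)
      (x := fun i => if hi : i ∈ G then x0 (e ⟨i, hi⟩) else y i) (e.symm i).2
    simpa using this
  · rw [Submodule.span_le]
    rintro _ ⟨i, hi, rfl⟩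
    have hi' : i ∉ G := by simpa using hi
    have := seg_mem_Usp (G := G)
      (x := fun i => if hi : i ∈ G then x0 (e ⟨i, hi⟩) else y i) i
    simpa [hi'] using this

def tens {R : Type*} [CommRing R] {s q : ℕ} (w : Fin q → R) :
    ((Fin s → Fin q) → R) →ₗ[R] ((Fin (s+1) → Fin q) → R) where
  toFun v := fun p => w (p 0) * v (Fin.tail p)
  map_add' v v' := by ext p; simp [mul_add]
  map_smul' c v := by ext p; simp; ring

theorem tens_apply {R : Type*} [CommRing R] {s q : ℕ} (w : Fin q → R) (v : (Fin s → Fin q) → R)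
    (p) : tens w v p = w (p 0) * v (Fin.tail p) := rfl

theorem tens_seg {R : Type*} [CommRing R] {s q : ℕ} (w : Fin q → R) (u : Fin s → Fin q → R) :
    tens w (seg u) = seg (Fin.cons w u : Fin (s+1) → Fin q → R) := by
  ext p; simp [tens_apply, seg, Fin.prod_univ_succ, Fin.tail]

theorem tens_tv {R : Type*} [CommRing R] {s q : ℕ} (w : Fin q → R) (u : Fin s → Fin q → R) (j)
    (w') : tens w (tv u j w') = tv (Fin.cons w u : Fin (s+1) → Fin q → R) j.succ w' := by
  unfold tv
  rw [tens_seg, Fin.cons_update]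

theorem tv_cons_zero {R : Type*} [CommRing R] {s q : ℕ} (w : Fin q → R) (u : Fin s → Fin q → R)
    (w') : tv (Fin.cons w u : Fin (s+1) → Fin q → R) 0 w' = tens w' (seg u) := by
  unfold tv
  rw [tens_seg, Fin.update_cons_zero]

theorem tens_Tsp {R : Type*} [CommRing R] {s q : ℕ} (w : Fin q → R) (u : Fin s → Fin q → R) :
    (Tsp u).map (tens w) ≤ Tsp (Fin.cons w u : Fin (s+1) → Fin q → R) := by
  unfold Tsp
  rw [Submodule.map_span, Submodule.span_le]
  rintro _ ⟨_, ⟨c, rfl⟩, rfl⟩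
  unfold tb
  rw [tens_tv]
  exact tv_mem _ _ _

theorem tens_seg_mem {R : Type*} [CommRing R] {s q : ℕ} (w w' : Fin q → R)
    (u : Fin s → Fin q → R) :
    tens w' (seg u) ∈ Tsp (Fin.cons w u : Fin (s+1) → Fin q → R) := by
  rw [← tv_cons_zero w]; exact tv_mem _ _ _

theorem tens_inj {F : Type*} [Field F] {s q : ℕ} (w : Fin q → F) (hw : w ≠ 0) :
    Function.Injective (tens (s := s) w) := by
  obtain ⟨b, hb⟩ := Function.ne_iff.1 hw
  intro v v' h
  ext p
  have := congrFun h (Fin.cons b p)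
  simp only [tens_apply, Fin.cons_zero, Fin.tail_cons] at this
  exact mul_left_cancel₀ hb this

theorem sum_finrank_le {F : Type*} [Field F] {ι' B : Type*} [Fintype ι'] [Fintype B]
    (blk : ι' → B) (U : B → Submodule F (ι' → F)) (W : Submodule F (ι' → F))
    (h1 : ∀ b, ∀ v ∈ U b, ∀ p, blk p ≠ b → v p = 0) (h2 : ∀ b, U b ≤ W) :
    ∑ b, finrank F (U b) ≤ finrank F W := by
  classical
  let φ : (∀ b, U b) →ₗ[F] W :=
    ∑ b, (Submodule.inclusion (h2 b)).comp (LinearMap.proj b)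
  have hφ : ∀ e p, (φ e : ι' → F) p = (e (blk p) : ι' → F) p := by
    intro e p
    have : (φ e : ι' → F) = ∑ b, (e b : ι' → F) := by
      simp [φ, LinearMap.sum_apply]
    rw [this, Finset.sum_apply]
    rw [Finset.sum_eq_single (blk p)]
    · intro b _ hb
      exact h1 b _ (e b).2 p (Ne.symm hb)
    · simp
  have hinj : Function.Injective φ := by
    rw [← LinearMap.ker_eq_bot, LinearMap.ker_eq_bot']
    intro e he
    funext b
    ext p
    by_cases hb : blk p = b
    · subst hb
      rw [← hφ, he]; simp
    · rw [h1 b _ (e b).2 p hb]; simp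
  rw [← finrank_pi_fintype]
  exact LinearMap.finrank_le_finrank_of_injective hinj

theorem drop_points {F V : Type*} [Field F] [AddCommGroup V] [Module F V] [FiniteDimensional F V]
    {N : Type*} [Fintype N] [DecidableEq N] (T : N → Submodule F V) (c : ℕ)
    (hT : ∀ i, finrank F (T i) ≤ c) (Y : Submodule F V) (S : Finset N) :
    finrank F ((⨆ i, T i) ⊔ Y : Submodule F V) ≤
      finrank F ((⨆ i ∈ S, T i) ⊔ Y : Submodule F V) + (Fintype.card N - S.card) * c := by
  have key : ∀ S' : Finset N, finrank F ((⨆ i ∈ S ∪ S', T i) ⊔ Y : Submodule F V) ≤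
      finrank F ((⨆ i ∈ S, T i) ⊔ Y : Submodule F V) + S'.card * c := by
    intro S'
    induction S' using Finset.induction_on with
    | empty => rw [Finset.union_empty]; simp
    | insert i S' hi ih =>
      have h1 : ((⨆ j ∈ S ∪ insert i S', T j) ⊔ Y : Submodule F V) ≤
          ((⨆ i ∈ S ∪ S', T i) ⊔ Y) ⊔ T i := by
        apply sup_le
        · apply iSup₂_le
          intro j hj
          by_cases h : j = i
          · subst h; exact le_sup_right
          · refine le_sup_of_le_left (le_sup_of_le_left
              (le_iSup₂_of_le j ?_ le_rfl))
            simp at hj ⊢; tauto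
        · exact le_sup_of_le_left le_sup_right
      have h2 := Submodule.finrank_mono h1
      have h3 := Submodule.finrank_add_le_finrank_add_finrank ((⨆ i ∈ S ∪ S', T i) ⊔ Y) (T i)
      rw [Finset.card_insert_of_notMem hi]
      have h4 := hT i
      nlinarith
  have := key (Finset.univ \ S)
  rw [Finset.card_univ_diff] at this
  refine le_trans (Submodule.finrank_mono ?_) this
  apply sup_le_sup_right
  exact iSup_le fun i => le_iSup₂_of_le i (by simp) le_rfl

end

section
def CERT (F : Type*) [Field F] (m s k : ℕ) : Prop :=
  ∃ (x : Fin k → Fin (s+1) → Fin (m+1) → F) (i0 : Fin k) (e : Fin (m+1) → F),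
    k * (m * (s+1) + 1) + m * s ≤ finrank F ((⨆ i, Tsp (x i)) ⊔ Tsp (Function.update (x i0) 0 e) :
      Submodule F ((Fin (s+1) → Fin (m+1)) → F))

theorem CERT_of_fintype {F : Type*} [Field F] {m s k : ℕ} {N : Type*} [Fintype N]
    (x : N → Fin (s+1) → Fin (m+1) → F) (i0 : N) (e : Fin (m+1) → F)
    (h : Fintype.card N * (m * (s+1) + 1) + m * s ≤
      finrank F ((⨆ i, Tsp (x i)) ⊔ Tsp (Function.update (x i0) 0 e) :
      Submodule F ((Fin (s+1) → Fin (m+1)) → F))) (hk : 1 ≤ k) (hk2 : k ≤ Fintype.card N) :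
    CERT F m s k := by
  classical
  obtain ⟨S, h1, -, h2⟩ := Finset.exists_subsuperset_card_eq (n := k)
    (Finset.subset_univ ({i0} : Finset N)) (by simpa using hk) (by simpa using hk2)
  have h3 := drop_points (fun i => Tsp (x i)) _ (fun i => finrank_Tsp_le (x i))
    (Tsp (Function.update (x i0) 0 e)) S
  subst h2
  let f := S.equivFin
  refine ⟨fun i => x (f.symm i), f ⟨i0, by simpa using h1⟩, e, ?_⟩
  have h4 : (⨆ i, Tsp (x (f.symm i))) = ⨆ i ∈ S, Tsp (x i) := by
    apply le_antisymm
    · exact iSup_le fun i => le_iSup₂_of_le (f.symm i : N) (f.symm i).2 le_rfl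
    · exact iSup₂_le fun i hi => le_iSup_of_le (f ⟨i, hi⟩) (by simp)
  rw [h4]; beta_reduce; rw [Equiv.symm_apply_apply]
  obtain ⟨d, hd⟩ := Nat.exists_eq_add_of_le hk2
  rw [hd] at h h3
  rw [Nat.add_sub_cancel_left] at h3
  nlinarith

theorem ND_of_fintype {F : Type*} [Field F] {m s k : ℕ} {N : Type*} [Fintype N]
    (x : N → Fin (s+1) → Fin (m+1) → F)
    (h : Fintype.card N * (m * (s+1) + 1) ≤
      finrank F (⨆ i, Tsp (x i) :
      Submodule F ((Fin (s+1) → Fin (m+1)) → F))) (hk2 : k ≤ Fintype.card N) :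
    ND F m (s+1) k := by
  classical
  obtain ⟨S, -, h2⟩ := Finset.exists_subset_card_eq (n := k) (s := (Finset.univ : Finset N))
    (by simpa using hk2)
  have h3 := drop_points (fun i => Tsp (x i)) _ (fun i => finrank_Tsp_le (x i)) ⊥ S
  rw [sup_bot_eq, sup_bot_eq] at h3
  subst h2
  let f := S.equivFin
  refine ⟨fun i => x (f.symm i), ?_⟩
  have h4 : (⨆ i, Tsp (x (f.symm i))) = ⨆ i ∈ S, Tsp (x i) := by
    apply le_antisymm
    · exact iSup_le fun i => le_iSup₂_of_le (f.symm i : N) (f.symm i).2 le_rfl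
    · exact iSup₂_le fun i hi => le_iSup_of_le (f ⟨i, hi⟩) (by simp)
  rw [h4]
  obtain ⟨d, hd⟩ := Nat.exists_eq_add_of_le hk2
  rw [hd] at h h3
  rw [Nat.add_sub_cancel_left] at h3
  nlinarith

theorem ND_mono {F : Type*} [Field F] {m s k k' : ℕ} (h : ND F m (s+1) k) (hk : k' ≤ k) :
    ND F m (s+1) k' := by
  obtain ⟨x, hx⟩ := h
  exact ND_of_fintype x (by simpa using hx) (by simpa using hk)

theorem split_le {F : Type*} [Field F] {q s : ℕ} {N : Type*} [Fintype N] [DecidableEq N]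
    (x' : N → Fin s → Fin q → F) (g : N → Fin q) (G : Fin q → Finset N)
    (W : Submodule F ((Fin (s+1) → Fin q) → F))
    (h1 : ∀ i, Tsp (Fin.cons (Pi.single (g i) 1) (x' i) : Fin (s+1) → Fin q → F) ≤ W)
    (h2 : ∀ b, ∀ i ∈ G b, Tsp (Fin.cons (Pi.single b 1) (x' i) : Fin (s+1) → Fin q → F) ≤ W) :
    ∑ b, finrank F (Usp (G b) x') ≤ finrank F W := by
  have h3 : ∀ b, finrank F (Usp (G b) x') =
      finrank F ((Usp (G b) x').map (tens (Pi.single b (1:F)))) := fun b =>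
    (LinearEquiv.finrank_eq (Submodule.equivMapOfInjective _
      (tens_inj _ (by simp)) _))
  simp_rw [h3]
  apply sum_finrank_le (fun p => p 0)
  · rintro b _ ⟨v, -, rfl⟩ p hp
    simp [tens_apply, hp]
  · intro b
    rw [Submodule.map_le_iff_le_comap]
    apply Usp_le
    · intro i hi
      rw [← Submodule.map_le_iff_le_comap]
      exact (tens_Tsp _ _).trans (h2 b i hi)
    · intro i
      exact h1 i (tens_seg_mem _ _ _)

theorem exists_common {F : Type*} [Field F] [CharZero F] {m s : ℕ} {N B : Type*} [Fintype N]
    [DecidableEq N] [Fintype B] (G : B → Finset N)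
    (h : ∀ b, ND F m s (G b).card)
    (h2 : ∀ b, (G b).card * (m * s + 1) + (Fintype.card N - (G b).card) ≤ (m+1) ^ s) :
    ∃ x : N → Fin s → Fin (m+1) → F, ∀ b,
      (G b).card * (m * s + 1) + (Fintype.card N - (G b).card) ≤ finrank F (Usp (G b) x) := by
  obtain ⟨a, ha⟩ := generic_combine _ fun b => Usp_generic (G b) _ (MND (G b) (h b) (h2 b))
  exact ⟨pt a, ha⟩

theorem card_fiber (m l : ℕ) (b : Fin (m+1)) :
    (Finset.univ.filter fun i : Fin (m+1) × Fin l => i.1 = b).card = l := by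
  have : (Finset.univ.filter fun i : Fin (m+1) × Fin l => i.1 = b) = {b} ×ˢ Finset.univ := by
    ext ⟨i, j⟩; simp [eq_comm]
  rw [this]; simp

theorem ND_split {F : Type*} [Field F] [CharZero F] {m s l k : ℕ} (h : ND F m s l)
    (h2 : l * (m * (s+1) + 1) ≤ (m+1)^s) (hk : k ≤ (m+1) * l) : ND F m (s+1) k := by
  classical
  obtain ⟨x', hx'⟩ := exists_common (F := F) (m := m) (s := s)
    (fun b : Fin (m+1) => Finset.univ.filter fun i : Fin (m+1) × Fin l => i.1 = b)
    (fun b => by rw [card_fiber]; exact h)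
    (fun b => by
      rw [card_fiber]; simp
      rw [show (m+1)*l - l = m * l by rw [add_mul]; simp]; nlinarith)
  refine ND_of_fintype (N := Fin (m+1) × Fin l)
    (fun i => (Fin.cons (Pi.single i.1 1) (x' i) : Fin (s+1) → Fin (m+1) → F)) ?_ (by simpa using hk)
  refine le_trans ?_ (split_le x' (fun i => i.1)
    (fun b : Fin (m+1) => Finset.univ.filter fun i : Fin (m+1) × Fin l => i.1 = b) _ ?_ ?_)
  · refine le_trans ?_ (Finset.sum_le_sum fun b _ => hx' b)
    simp only [card_fiber, Finset.sum_const, smul_eq_mul, Fintype.card_prod, Fintype.card_fin,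
      Finset.card_univ]
    rw [show (m+1)*l - l = m * l by rw [add_mul]; simp]; nlinarith
  · intro i; exact le_iSup_of_le i le_rfl
  · intro b i hi
    simp at hi; subst hi
    exact le_iSup_of_le i le_rfl

theorem CERT_split {F : Type*} [Field F] [CharZero F] {m s l k : ℕ} (hm : 1 ≤ m)
    (h0 : ND F m s l) (h : ND F m s (l+1))
    (h2 : l * (m * (s+1) + 1) + m * s ≤ (m+1)^s) (hk1 : 1 ≤ k) (hk : k ≤ (m+1) * l) :
    CERT F m s k := by
  classical
  have hl : 0 < l := by
    rcases Nat.eq_zero_or_pos l with h | h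
    · subst h; omega
    · exact h
  let i0 : Fin (m+1) × Fin l := (0, ⟨0, hl⟩)
  have hne : (Fin.last m) ≠ 0 := by
    intro h; have := congrArg Fin.val h; simp at this; omega
  let G : Fin (m+1) → Finset (Fin (m+1) × Fin l) := fun b =>
    if b = Fin.last m then insert i0 (Finset.univ.filter fun i => i.1 = b)
    else Finset.univ.filter fun i => i.1 = b
  have hG : ∀ b, (G b).card = if b = Fin.last m then l + 1 else l := by
    intro b
    simp only [G]
    split_ifs with hb
    · rw [Finset.card_insert_of_notMem, card_fiber]
      simp [i0, hb, Ne.symm hne]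
    · rw [card_fiber]
  have hml : (m+1)*l - l = m * l := by rw [add_mul]; simp
  have hml2 : (m+1)*l - (l+1) + 1 = m * l := by
    have : 1 ≤ m * l := Nat.mul_pos hm hl
    have : (m+1)*l = m * l + l := by ring
    omega
  obtain ⟨x', hx'⟩ := exists_common (F := F) (m := m) (s := s) G
    (fun b => by rw [hG]; split_ifs <;> assumption)
    (fun b => by
      rw [hG]
      simp only [Fintype.card_prod, Fintype.card_fin]
      split_ifs
      · nlinarith
      · rw [hml]; nlinarith)
  refine CERT_of_fintype (N := Fin (m+1) × Fin l)
    (fun i => (Fin.cons (Pi.single i.1 1) (x' i) : Fin (s+1) → Fin (m+1) → F)) i0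
    (Pi.single (Fin.last m) 1) ?_ hk1 (by simpa using hk)
  refine le_trans ?_ (split_le x' (fun i => i.1) G _ ?_ ?_)
  · refine le_trans ?_ (Finset.sum_le_sum fun b _ => hx' b)
    have h5 : ∀ b, (G b).card * (m*s+1) + (Fintype.card (Fin (m+1) × Fin l) - (G b).card) =
        l * (m*(s+1)+1) + if b = Fin.last m then m*s else 0 := by
      intro b
      rw [hG]
      simp only [Fintype.card_prod, Fintype.card_fin]
      split_ifs
      · nlinarith
      · rw [hml]; nlinarith
    rw [Finset.sum_congr rfl fun b _ => h5 b]
    simp only [Finset.sum_add_distrib, Finset.sum_const, Finset.sum_ite_eq', smul_eq_mul,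
      Fintype.card_prod, Fintype.card_fin, Finset.card_univ, Finset.mem_univ, if_true]
    nlinarith
  · intro i; exact le_sup_of_le_left (le_iSup_of_le i le_rfl)
  · intro b i hi
    by_cases hb : i.1 = b
    · subst hb
      exact le_sup_of_le_left (le_iSup_of_le i le_rfl)
    · simp only [G] at hi
      split_ifs at hi with hbl
      · simp only [Finset.mem_insert, Finset.mem_filter, Finset.mem_univ, true_and, hb,
          or_false] at hi
        subst hi; subst hbl
        apply le_sup_of_le_right
        rw [Fin.update_cons_zero]
      · simp at hi; exact absurd hi hb

end

section
def tens2 {R : Type*} [CommRing R] {s q : ℕ} (w : Fin 2 → R) :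
    ((Fin s → Fin q) → R) →ₗ[R] ((Fin 2 × (Fin s → Fin q)) → R) where
  toFun v := fun p => w p.1 * v p.2
  map_add' v v' := by ext p; simp [mul_add]
  map_smul' c v := by ext p; simp; ring

theorem tens2_apply {R : Type*} [CommRing R] {s q : ℕ} (w : Fin 2 → R)
    (v : (Fin s → Fin q) → R) (p) : tens2 w v p = w p.1 * v p.2 := rfl

def Bfam {R : Type*} [CommRing R] {s q : ℕ} {N : Type*} [DecidableEq N] (G : Finset N)
    (w : N → Fin 2 → R) (x : N → Fin s → Fin q → R) :
    (N × (Fin s × Fin q)) ⊕ (N × Fin 2) → (Fin 2 × (Fin s → Fin q)) → R :=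
  Sum.elim (fun c => if c.1 ∈ G then tens2 (w c.1) (tb (x c.1) c.2) else 0)
    (fun i => tens2 (Pi.single i.2 1) (seg (x i.1)))

def Bsp {R : Type*} [CommRing R] {s q : ℕ} {N : Type*} [DecidableEq N] (G : Finset N)
    (w : N → Fin 2 → R) (x : N → Fin s → Fin q → R) :
    Submodule R ((Fin 2 × (Fin s → Fin q)) → R) :=
  Submodule.span R (Set.range (Bfam G w x))

theorem Bfam_map {R S : Type*} [CommRing R] [CommRing S] (φ : R →+* S) {s q : ℕ} {N : Type*}
    [DecidableEq N] (G : Finset N) (w : N → Fin 2 → R) (x : N → Fin s → Fin q → R) (c) (p) :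
    φ (Bfam G w x c p) = Bfam G (fun i c => φ (w i c)) (fun i j a => φ (x i j a)) c p := by
  rcases c with (c | c)
  · simp only [Bfam, Sum.elim_inl]
    split_ifs
    · simp only [tens2_apply, map_mul, tb_map]
    · simp
  · simp only [Bfam, Sum.elim_inr, tens2_apply, map_mul, seg_map]
    simp [Pi.single_apply, apply_ite φ]

theorem Bsp_le {R : Type*} [CommRing R] {s q : ℕ} {N : Type*} [DecidableEq N] {G : Finset N}
    {w : N → Fin 2 → R}
    {x : N → Fin s → Fin q → R} {U : Submodule R ((Fin 2 × (Fin s → Fin q)) → R)}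
    (h1 : ∀ i ∈ G, (Tsp (x i)).map (tens2 (w i)) ≤ U)
    (h2 : ∀ i c, tens2 (Pi.single c 1) (seg (x i)) ∈ U) : Bsp G w x ≤ U := by
  unfold Bsp
  rw [Submodule.span_le]
  rintro _ ⟨(⟨i, c⟩ | ⟨i, c⟩), rfl⟩
  · by_cases hi : i ∈ G
    · simpa [Bfam, hi] using h1 i hi ⟨_, (tb_mem _ c), rfl⟩
    · simp [Bfam, hi]
  · simpa [Bfam] using h2 i c

theorem Tsp_le_Bsp {R : Type*} [CommRing R] {s q : ℕ} {N : Type*} [DecidableEq N] {G : Finset N}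
    {w : N → Fin 2 → R} {x : N → Fin s → Fin q → R} {i : N} (hi : i ∈ G) :
    (Tsp (x i)).map (tens2 (w i)) ≤ Bsp G w x := by
  unfold Tsp
  rw [Submodule.map_span, Submodule.span_le]
  rintro _ ⟨_, ⟨c, rfl⟩, rfl⟩
  exact Submodule.subset_span ⟨Sum.inl (i, c), by simp [Bfam, hi]⟩

theorem seg_mem_Bsp {R : Type*} [CommRing R] {s q : ℕ} {N : Type*} [DecidableEq N] {G : Finset N}
    {w : N → Fin 2 → R} {x : N → Fin s → Fin q → R} (i : N) (c) :
    tens2 (Pi.single c 1) (seg (x i)) ∈ Bsp G w x :=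
  Submodule.subset_span ⟨Sum.inr (i, c), by simp [Bfam]⟩

theorem Bsp_generic {F : Type*} [Field F] {s q : ℕ} {N : Type*} [DecidableEq N] (G : Finset N)
    (w : N → Fin 2 → F)
    (r : ℕ) (h : ∃ x : N → Fin s → Fin q → F, r ≤ finrank F (Bsp G w x)) :
    ∃ P : MvPolynomial (N × Fin s × Fin q) F, P ≠ 0 ∧ ∀ a, eval a P ≠ 0 →
      r ≤ finrank F (Bsp G w (pt a)) := by
  obtain ⟨x, hx⟩ := h
  have key : ∀ a : N × Fin s × Fin q → F,
      Bsp G w (pt a) = Submodule.span F (Set.range fun c p =>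
        eval a (Bfam G (fun i c => C (w i c)) (gen F N s q) c p)) := by
    intro a
    unfold Bsp
    congr 2
    funext c p
    rw [Bfam_map]
    simp only [gen, eval_X, eval_C]
    rfl
  obtain ⟨P, hP, h2⟩ := open_rank_self (Bfam G (fun i c => C (w i c)) (gen F N s q)) (unpt x) r (by
    rw [← key]; exact hx)
  refine ⟨P, hP, fun a ha => ?_⟩
  rw [key]; exact h2 a ha

/-- elementary vector -/
def ev (F : Type*) [Field F] (q n : ℕ) : Fin q → F := fun a => if (a : ℕ) = n then 1 else 0

def el {F : Type*} [Field F] {q : ℕ} (w : Fin 2 → F) (y z : Fin q → F) :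
    (Fin 2 × (Fin 2 → Fin q)) → F := fun p => w p.1 * (y (p.2 0) * z (p.2 1))

theorem tens2_seg {F : Type*} [Field F] {q : ℕ} (w : Fin 2 → F) (y z : Fin q → F) :
    tens2 w (seg ![y, z]) = el w y z := by
  ext p; simp [tens2_apply, seg, el]

theorem el_spread {F : Type*} [Field F] {q : ℕ} (y z : Fin q → F) (α β : F) (h : α ≠ β)
    (U : Submodule F ((Fin 2 × (Fin 2 → Fin q)) → F)) (h1 : el ![1, α] y z ∈ U)
    (h2 : el ![1, β] y z ∈ U) (w : Fin 2 → F) : el w y z ∈ U := by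
  have hab : β - α ≠ 0 := sub_ne_zero.2 h.symm
  have : el w y z = ((w 0 * β - w 1) / (β - α)) • el ![1, α] y z +
      ((w 1 - w 0 * α) / (β - α)) • el ![1, β] y z := by
    ext ⟨c, p⟩
    fin_cases c
    · simp [el]; field_simp; ring
    · simp [el]; field_simp; ring
  rw [this]
  exact U.add_mem (U.smul_mem _ h1) (U.smul_mem _ h2)

/-- the Q-points -/
def Qpt (F : Type*) [Field F] (q h d : ℕ) :
    (Fin d × Fin d) ⊕ (Fin h × Fin d) ⊕ (Fin d × Fin h) → Fin 2 → Fin q → F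
  | Sum.inl (a, b) => ![ev F q (2*h+a), ev F q (2*h+b)]
  | Sum.inr (Sum.inl (i, b)) => ![ev F q (2*i) + ev F q (2*i+1), ev F q (2*h+b)]
  | Sum.inr (Sum.inr (a, i)) => ![ev F q (2*h+a), ev F q (2*i) + ev F q (2*i+1)]

theorem block_top {F : Type*} [Field F] [CharZero F] {q h d : ℕ} (hq : q = 2*h+d)
    (U : Submodule F ((Fin 2 × (Fin 2 → Fin q)) → F))
    (h1 : ∀ i : ℕ, i < 2*h → ∀ w, el w (ev F q i) (ev F q i) ∈ U)
    (h2 : ∀ i : ℕ, i < 2*h → ∀ y, el ![1, (i:F)] y (ev F q i) ∈ U)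
    (h2' : ∀ i : ℕ, i < 2*h → ∀ y, el ![1, (i:F)] (ev F q i) y ∈ U)
    (h3 : ∀ o w, tens2 w (seg (Qpt F q h d o)) ∈ U) : U = ⊤ := by
  have add1 : ∀ w (y y' z : Fin q → F), el w (y + y') z = el w y z + el w y' z := by
    intros; ext p; simp [el]; ring
  have add2 : ∀ w (y z z' : Fin q → F), el w y (z + z') = el w y z + el w y z' := by
    intros; ext p; simp [el]; ring
  have key : ∀ a b : ℕ, a < q → b < q → ∀ w, el w (ev F q a) (ev F q b) ∈ U := by
    intro a b ha hb
    by_cases ha' : a < 2*h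
    · by_cases hb' : b < 2*h
      · by_cases hab : a = b
        · subst hab; exact h1 a ha'
        · exact el_spread _ _ (a:F) (b:F) (by exact_mod_cast hab) U (h2' a ha' _) (h2 b hb' _)
      · have hQ := fun w => h3 (Sum.inr (Sum.inl (⟨a/2, by omega⟩, ⟨b - 2*h, by omega⟩))) w
        simp only [Qpt, tens2_seg, add1] at hQ
        rw [show 2*h + (b-2*h) = b by omega] at hQ
        rcases Nat.even_or_odd' a with ⟨i, rfl | rfl⟩
        · rw [show 2*i/2 = i by omega] at hQ
          refine el_spread _ _ ((2*i:ℕ):F) ((2*i+1:ℕ):F) (by norm_cast; omega) U (h2' _ ha' _) ?_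
          have := U.sub_mem (hQ ![1, ((2*i+1:ℕ):F)]) (h2' (2*i+1) (by omega) (ev F q b))
          simpa using this
        · rw [show (2*i+1)/2 = i by omega] at hQ
          refine el_spread _ _ ((2*i+1:ℕ):F) ((2*i:ℕ):F) (by norm_cast; omega) U (h2' _ ha' _) ?_
          have := U.sub_mem (hQ ![1, ((2*i:ℕ):F)]) (h2' (2*i) (by omega) (ev F q b))
          simpa using this
    · by_cases hb' : b < 2*h
      · have hQ := fun w => h3 (Sum.inr (Sum.inr (⟨a - 2*h, by omega⟩, ⟨b/2, by omega⟩))) w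
        simp only [Qpt, tens2_seg, add2] at hQ
        rw [show 2*h + (a-2*h) = a by omega] at hQ
        rcases Nat.even_or_odd' b with ⟨i, rfl | rfl⟩
        · rw [show 2*i/2 = i by omega] at hQ
          refine el_spread _ _ ((2*i:ℕ):F) ((2*i+1:ℕ):F) (by norm_cast; omega) U (h2 _ hb' _) ?_
          have := U.sub_mem (hQ ![1, ((2*i+1:ℕ):F)]) (h2 (2*i+1) (by omega) (ev F q a))
          simpa using this
        · rw [show (2*i+1)/2 = i by omega] at hQ
          refine el_spread _ _ ((2*i+1:ℕ):F) ((2*i:ℕ):F) (by norm_cast; omega) U (h2 _ hb' _) ?_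
          have := U.sub_mem (hQ ![1, ((2*i:ℕ):F)]) (h2 (2*i) (by omega) (ev F q a))
          simpa using this
      · intro w
        have hQ := h3 (Sum.inl (⟨a - 2*h, by omega⟩, ⟨b - 2*h, by omega⟩)) w
        simp only [Qpt, tens2_seg] at hQ
        rwa [show 2*h + (a-2*h) = a by omega, show 2*h + (b-2*h) = b by omega] at hQ
  rw [eq_top_iff]
  intro v _
  have : v = ∑ p, v p • (Pi.single p 1 : Fin 2 × (Fin 2 → Fin q) → F) := by
    ext b; simp [Finset.sum_apply, Pi.single_apply]
  rw [this]
  refine Submodule.sum_mem _ fun p _ => Submodule.smul_mem _ _ ?_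
  have h5 : (Pi.single p 1 : Fin 2 × (Fin 2 → Fin q) → F) =
      el (Pi.single p.1 1) (ev F q (p.2 0)) (ev F q (p.2 1)) := by
    ext p'
    obtain ⟨c, p⟩ := p
    obtain ⟨c', p'⟩ := p'
    by_cases h : (c', p') = (c, p)
    · cases h; simp [el, ev]
    · rw [Pi.single_eq_of_ne h]
      simp only [el, ev, Pi.single_apply]
      by_cases hc : c' = c
      · by_cases hp0 : p' 0 = p 0
        · by_cases hp1 : p' 1 = p 1
          · exact absurd (by
              rw [hc, Prod.mk.injEq]; refine ⟨rfl, ?_⟩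
              ext i; fin_cases i <;> simp [hp0, hp1]) h
          · simp [Fin.val_inj, hp1]
        · simp [Fin.val_inj, hp0]
      · simp [hc]
  rw [h5]
  exact key _ _ (p.2 0).2 (p.2 1).2 _

theorem block_exists {F : Type*} [Field F] [CharZero F] {q h d : ℕ} (hq : q = 2*h+d)
    {N : Type*} [Fintype N] [DecidableEq N] (G : Finset N) (num : N → ℕ)
    (hnum : ∀ n < 2*h, ∃ i ∈ G, num i = n) (hG : G.card = 2*h)
    (hp : Fintype.card N - G.card ≤ d * q) :
    ∃ x : N → Fin 2 → Fin q → F, 2*q*(2*h) + 2*(Fintype.card N - G.card) ≤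
      finrank F (Bsp G (fun i => ![1, (num i : F)]) x) := by
  classical
  obtain ⟨inj, hinj⟩ : ∃ f : {i // i ∉ G} →
      ((Fin d × Fin d) ⊕ (Fin h × Fin d) ⊕ (Fin d × Fin h)), Function.Injective f := by
    have : Fintype.card {i // i ∉ G} ≤
      Fintype.card ((Fin d × Fin d) ⊕ (Fin h × Fin d) ⊕ (Fin d × Fin h)) := by
      rw [Fintype.card_subtype_compl]
      simp
      subst hq
      have e1 : d * d + (h*d + d*h) = d * (2*h+d) := by ring
      rw [e1]
      omega
    obtain ⟨f⟩ := Function.Embedding.nonempty_of_card_le this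
    exact ⟨f, f.injective⟩
  let x : N → Fin 2 → Fin q → F := fun i =>
    if hi : i ∈ G then ![ev F q (num i), ev F q (num i)] else Qpt F q h d (inj ⟨i, hi⟩)
  have hxG : ∀ i ∈ G, x i = ![ev F q (num i), ev F q (num i)] := fun i hi => by simp [x, hi]
  refine ⟨x, ?_⟩
  let T : ((Fin d × Fin d) ⊕ (Fin h × Fin d) ⊕ (Fin d × Fin h)) →
      Submodule F ((Fin 2 × (Fin 2 → Fin q)) → F) := fun o =>
    Submodule.span F (Set.range fun c : Fin 2 => tens2 (Pi.single c 1) (seg (Qpt F q h d o)))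
  have hT : ∀ o w, tens2 w (seg (Qpt F q h d o)) ∈ T o := by
    intro o w
    have : tens2 w (seg (Qpt F q h d o)) =
        ∑ c, w c • tens2 (Pi.single c 1) (seg (Qpt F q h d o)) := by
      ext ⟨c, p⟩; fin_cases c <;> simp [tens2_apply]
    rw [this]
    exact Submodule.sum_mem _ fun c _ => Submodule.smul_mem _ _ (Submodule.subset_span ⟨c, rfl⟩)
  set S : Finset ((Fin d × Fin d) ⊕ (Fin h × Fin d) ⊕ (Fin d × Fin h)) :=
    Finset.univ.image inj with hS
  set B := Bsp G (fun i => ![1, (num i : F)]) x with hB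
  have hd := drop_points T 2 (fun o => (finrank_range_le_card _).trans (by simp)) B S
  have htop : (⨆ o, T o) ⊔ B = ⊤ := by
    have hBi : ∀ i ∈ G, ∀ j y, tens2 ![1, (num i : F)] (tv (x i) j y) ∈ B := fun i hi j y =>
      Tsp_le_Bsp hi ⟨_, tv_mem _ _ _, rfl⟩
    apply block_top hq
    · intro n hn w
      obtain ⟨i, hi, rfl⟩ := hnum n hn
      apply Submodule.mem_sup_right
      have : el w (ev F q (num i)) (ev F q (num i)) =
          ∑ c, w c • tens2 (Pi.single c 1) (seg (x i)) := by
        rw [hxG i hi]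
        ext ⟨c, p⟩; fin_cases c <;> simp [tens2_apply, el, seg]
      rw [this]
      exact Submodule.sum_mem _ fun c _ => Submodule.smul_mem _ _ (seg_mem_Bsp _ _)
    · intro n hn y
      obtain ⟨i, hi, rfl⟩ := hnum n hn
      apply Submodule.mem_sup_right
      have := hBi i hi 0 y
      rw [hxG i hi] at this
      convert this using 1
      ext p; simp [tens2_apply, tv, seg, el]
    · intro n hn y
      obtain ⟨i, hi, rfl⟩ := hnum n hn
      apply Submodule.mem_sup_right
      have := hBi i hi 1 y
      rw [hxG i hi] at this
      convert this using 1
      ext p; simp [tens2_apply, tv, seg, el]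
    · intro o w
      exact Submodule.mem_sup_left (Submodule.mem_iSup_of_mem o (hT o w))
  have hSB : (⨆ o ∈ S, T o) ⊔ B = B := by
    apply sup_eq_right.2
    apply iSup₂_le
    intro o ho
    simp only [hS, Finset.mem_image, Finset.mem_univ, true_and] at ho
    obtain ⟨i, rfl⟩ := ho
    rw [Submodule.span_le]
    rintro _ ⟨c, rfl⟩
    have : Qpt F q h d (inj i) = x i := by simp [x, i.2]
    beta_reduce
    rw [this]
    exact seg_mem_Bsp _ _
  have hcS : S.card = Fintype.card N - G.card := by
    rw [hS, Finset.card_image_of_injective _ hinj, Finset.card_univ,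
      Fintype.card_subtype_compl]
    simp
  rw [htop, hSB, hcS, finrank_top] at hd
  simp at hd
  have e1 : d * d + (h*d + d*h) = d * q := by subst hq; ring
  rw [e1] at hd
  obtain ⟨z, hz⟩ := Nat.exists_eq_add_of_le hp
  rw [hz, Nat.add_sub_cancel_left] at hd
  have e2 : 2 * q^2 = 2*q*(2*h) + 2 * (d*q) := by subst hq; ring
  omega

end

section
theorem ND_two_one {F : Type*} [Field F] {m : ℕ} : ND F m 2 1 := by
  let x : Fin 2 → Fin (m+1) → F := fun _ => Pi.single 0 1
  refine ⟨fun _ => x, ?_⟩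
  let pos : Fin (m+1) ⊕ Fin m → (Fin 2 → Fin (m+1)) := Sum.elim (fun a => ![a, 0])
    (fun b => ![0, b.succ])
  have hpos : Function.Injective pos := by
    rintro (a | a) (b | b) h
    · have := congrFun h 0; simp [pos] at this; simp [this]
    · have := congrFun h 1; simp [pos] at this
      exact absurd this.symm (Fin.succ_ne_zero _)
    · have := congrFun h 1; simp [pos] at this
    · have := congrFun h 1; simp [pos] at this; simp [this]
  have hli : LinearIndependent F fun o => (Pi.single (pos o) 1 : (Fin 2 → Fin (m+1)) → F) := by
    have := (Pi.basisFun F (Fin 2 → Fin (m+1))).linearIndependent.comp pos hpos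
    convert this using 1
    funext o; simp
  have h2 := finrank_span_eq_card hli
  have h3 : Fintype.card (Fin (m+1) ⊕ Fin m) = 1 * (m * 2 + 1) := by simp; ring
  rw [← h3, ← h2]
  apply Submodule.finrank_mono
  refine le_iSup_of_le 0 ?_
  rw [Submodule.span_le]
  rintro _ ⟨o, rfl⟩
  rcases o with (a | b)
  · have : (Pi.single (pos (Sum.inl a)) 1 : (Fin 2 → Fin (m+1)) → F) = tv x 0 (Pi.single a 1) := by
      rw [← seg_single]
      unfold tv
      congr 1; funext j; fin_cases j <;> simp [pos, x]
    beta_reduce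
    rw [this]; exact tv_mem _ _ _
  · have : (Pi.single (pos (Sum.inr b)) 1 : (Fin 2 → Fin (m+1)) → F)
        = tv x 1 (Pi.single b.succ 1) := by
      rw [← seg_single]
      unfold tv
      congr 1; funext j; fin_cases j <;> simp [pos, x]
    beta_reduce
    rw [this]; exact tv_mem _ _ _

theorem ND_zero {F : Type*} [Field F] {m s : ℕ} : ND F m s 0 := ⟨fun _ => 0, by simp⟩

/-- block inclusion -/
def bext {F : Type*} [Field F] {s q : ℕ} (n : ℕ) :
    ((Fin 2 × (Fin s → Fin q)) → F) →ₗ[F] ((Fin (s+1) → Fin q) → F) where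
  toFun v := fun p => ∑ c : Fin 2, if (p 0 : ℕ) = 2 * n + c then v (c, Fin.tail p) else 0
  map_add' v v' := by ext p; simp only [Pi.add_apply, ← Finset.sum_add_distrib]; congr 1; funext c; split_ifs <;> simp
  map_smul' c v := by ext p; simp [mul_add]

theorem bext_apply {F : Type*} [Field F] {s q : ℕ} (n : ℕ) (v : (Fin 2 × (Fin s → Fin q)) → F)
    (p) : bext n v p = ∑ c : Fin 2, if (p 0 : ℕ) = 2 * n + c then v (c, Fin.tail p) else 0 := rfl

def bw {F : Type*} [Field F] (q n : ℕ) (w : Fin 2 → F) : Fin q → F :=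
  fun a => ∑ c : Fin 2, if (a : ℕ) = 2 * n + c then w c else 0

theorem bext_tens2 {F : Type*} [Field F] {s q : ℕ} (n : ℕ) (w : Fin 2 → F)
    (v : (Fin s → Fin q) → F) : bext n (tens2 w v) = tens (bw q n w) v := by
  ext p
  simp only [bext_apply, tens2_apply, tens_apply, bw, Finset.sum_mul, ite_mul, zero_mul]

theorem bext_inj {F : Type*} [Field F] {s q : ℕ} (n : ℕ) (hn : 2 * n + 1 < q) :
    Function.Injective (bext (F := F) (s := s) (q := q) n) := by
  intro v v' h
  ext ⟨c, p⟩
  have := congrFun h (Fin.cons ⟨2 * n + c, by omega⟩ p)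
  simp only [bext_apply, Fin.cons_zero, Fin.tail_cons] at this
  simpa [Fin.val_inj] using this

theorem block_le {F : Type*} [Field F] {q s r : ℕ} (hr : 2 * r ≤ q) {N : Type*} [Fintype N]
    [DecidableEq N]
    (x' : N → Fin s → Fin q → F) (g : N → Fin r) (w : N → Fin 2 → F) (H : Fin q → Finset N)
    (W : Submodule F ((Fin (s+1) → Fin q) → F))
    (h1 : ∀ i, Tsp (Fin.cons (bw q (g i) (w i)) (x' i) : Fin (s+1) → Fin q → F) ≤ W)
    (h2 : ∀ b : Fin q, 2 * r ≤ b →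
      ∀ i ∈ H b, Tsp (Fin.cons (Pi.single b 1) (x' i) : Fin (s+1) → Fin q → F) ≤ W) :
    ∑ b : Fin r, finrank F (Bsp (Finset.univ.filter fun i => g i = b) w x') +
    ∑ b : Fin q, (if 2 * r ≤ b then finrank F (Usp (H b) x') else 0) ≤ finrank F W := by
  let U : Fin r ⊕ Fin q → Submodule F ((Fin (s+1) → Fin q) → F) := Sum.elim
    (fun b => (Bsp (Finset.univ.filter fun i => g i = b) w x').map (bext b))
    (fun b => if 2 * r ≤ b then (Usp (H b) x').map (tens (Pi.single b (1:F))) else ⊥)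
  have h3 := sum_finrank_le (F := F) (B := Fin r ⊕ Fin q) (fun p : Fin (s+1) → Fin q =>
    if h : (p 0 : ℕ) < 2 * r then Sum.inl ⟨(p 0 : ℕ)/2, by omega⟩ else Sum.inr (p 0)) U W ?_ ?_
  · rw [Fintype.sum_sum_type] at h3
    refine le_trans (le_of_eq ?_) h3
    congr 1
    · refine Finset.sum_congr rfl fun b _ => ?_
      exact LinearEquiv.finrank_eq (Submodule.equivMapOfInjective _ (bext_inj _ (by omega)) _)
    · refine Finset.sum_congr rfl fun b _ => ?_
      by_cases hb : 2 * r ≤ (b : ℕ)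
      · have hU : U (Sum.inr b) = (Usp (H b) x').map (tens (Pi.single b (1:F))) := by simp [U, hb]
        have hne : (Pi.single b (1:F) : Fin q → F) ≠ 0 := by
          intro h0; have := congrFun h0 b; simp at this
        rw [hU, if_pos hb]
        exact LinearEquiv.finrank_eq (Submodule.equivMapOfInjective _ (tens_inj _ hne) _)
      · have hU : U (Sum.inr b) = ⊥ := by simp [U, hb]
        rw [hU, if_neg hb, finrank_bot]
  · rintro (b | b) v hv p hp
    · obtain ⟨v, -, rfl⟩ := hv
      rw [bext_apply]
      apply Finset.sum_eq_zero
      intro c _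
      rw [if_neg]
      intro hc
      apply hp
      rw [dif_pos (by omega)]
      congr 1
      ext
      simp; omega
    · simp only [U, Sum.elim_inr] at hv
      split_ifs at hv with hb
      · obtain ⟨v, -, rfl⟩ := hv
        rw [tens_apply]
        by_cases hpb : p 0 = b
        · exfalso; apply hp; rw [dif_neg (by rw [hpb]; omega), hpb]
        · simp [hpb]
      · simp at hv; simp [hv]
  · rintro (b | b)
    · simp only [U, Sum.elim_inl]
      rw [Submodule.map_le_iff_le_comap]
      apply Bsp_le
      · intro i hi
        simp at hi; subst hi
        rintro _ ⟨v, hv, rfl⟩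
        change bext _ (tens2 _ _) ∈ W
        rw [bext_tens2]
        exact h1 i (tens_Tsp _ _ ⟨v, hv, rfl⟩)
      · intro i c
        change bext _ (tens2 _ _) ∈ W
        rw [bext_tens2]
        exact h1 i (tens_seg_mem _ _ _)
    · simp only [U, Sum.elim_inr]
      split_ifs with hb
      · rw [Submodule.map_le_iff_le_comap]
        apply Usp_le
        · intro i hi
          rw [← Submodule.map_le_iff_le_comap]
          exact (tens_Tsp _ _).trans (h2 b hb i hi)
        · intro i
          exact h1 i (tens_seg_mem _ _ _)
      · exact bot_le

theorem card_fiber' (r l : ℕ) (b : Fin r) :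
    (Finset.univ.filter fun i : Fin r × Fin l => i.1 = b).card = l := by
  have : (Finset.univ.filter fun i : Fin r × Fin l => i.1 = b) = {b} ×ˢ Finset.univ := by
    ext ⟨i, j⟩; simp [eq_comm]
  rw [this]; simp

theorem sum_tail (q r c : ℕ) (hr : 2*r ≤ q) :
    ∑ b : Fin q, (if 2 * r ≤ (b:ℕ) then c else 0) = (q - 2*r) * c := by
  rw [Fin.sum_univ_eq_sum_range (fun b => if 2 * r ≤ b then c else 0), Finset.sum_ite]
  simp
  left
  have : (Finset.range q).filter (fun b => 2*r ≤ b) = Finset.Ico (2*r) q := by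
    ext b; simp [and_comm]
  rw [this]; simp

theorem three_common {F : Type*} [Field F] [CharZero F] {m r h d : ℕ} (hq : m + 1 = 2*h+d)
    (hp : 2*h*r - 2*h ≤ d*(m+1)) (H : Fin (m+1) → Finset (Fin r × Fin (2*h)))
    (hH : ∀ b, ND F m 2 (H b).card)
    (hH2 : ∀ b, (H b).card * (m * 2 + 1) + (r*(2*h) - (H b).card) ≤ (m+1) ^ 2) :
    ∃ x' : Fin r × Fin (2*h) → Fin 2 → Fin (m+1) → F,
      (∀ b : Fin r, 2*(m+1)*(2*h) + 2*(2*h*r - 2*h) ≤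
        finrank F (Bsp (Finset.univ.filter fun i => i.1 = b)
          (fun i => ![1, ((i.2 : ℕ) : F)]) x')) ∧
      ∀ b, (H b).card * (m * 2 + 1) + (r*(2*h) - (H b).card) ≤ finrank F (Usp (H b) x') := by
  obtain ⟨a, ha⟩ := generic_combine (F := F) (σ := (Fin r × Fin (2*h)) × Fin 2 × Fin (m+1))
    (B := Fin r ⊕ Fin (m+1)) (Sum.elim
      (fun b a => 2*(m+1)*(2*h) + 2*(2*h*r - 2*h) ≤
        finrank F (Bsp (Finset.univ.filter fun i => i.1 = b)
          (fun i => ![1, ((i.2 : ℕ) : F)]) (pt a)))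
      (fun b a => (H b).card * (m * 2 + 1) + (r*(2*h) - (H b).card) ≤
        finrank F (Usp (H b) (pt a)))) (by
    rintro (b | b)
    · simp only [Sum.elim_inl]
      apply Bsp_generic
      have hc : Fintype.card (Fin r × Fin (2*h)) = 2*h*r := by simp; ring
      have := block_exists (F := F) hq (Finset.univ.filter fun i : Fin r × Fin (2*h) => i.1 = b)
        (fun i => (i.2 : ℕ)) (fun n hn => ⟨(b, ⟨n, hn⟩), by simp, rfl⟩) (card_fiber' _ _ _)
        (by rw [card_fiber', hc]; exact hp)
      rw [card_fiber', hc] at this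
      exact this
    · simp only [Sum.elim_inr]
      apply Usp_generic
      have := MND (F := F) (m := m) (s := 2) (H b) (hH b) (by simpa using hH2 b)
      simpa using this)
  exact ⟨pt a, fun b => ha (Sum.inl b), fun b => ha (Sum.inr b)⟩

theorem ND_three {F : Type*} [Field F] [CharZero F] {m r h d k : ℕ} (hq : m + 1 = 2*h+d)
    (hr : 2 * r ≤ m+1) (hp : 2*h*r - 2*h ≤ d*(m+1)) (hp2 : r*(2*h) ≤ (m+1)^2)
    (hk : k ≤ r*(2*h)) : ND F m 3 k := by
  classical
  rcases Nat.eq_zero_or_pos r with h0 | h0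
  · subst h0; simp at hk; subst hk; exact ND_zero
  obtain ⟨x', h1, h2⟩ := three_common (F := F) hq hp (fun _ => ∅) (fun b => ND_zero)
    (fun b => by simpa using hp2)
  refine ND_of_fintype (N := Fin r × Fin (2*h)) (fun i =>
    (Fin.cons (bw (m+1) i.1 ![1, ((i.2 : ℕ) : F)]) (x' i) : Fin 3 → Fin (m+1) → F)) ?_
    (by simpa using hk)
  refine le_trans ?_ (block_le hr x' (fun i => i.1) (fun i => ![1, ((i.2 : ℕ) : F)]) (fun _ => ∅)
    _ (fun i => le_iSup_of_le i le_rfl) (by simp))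
  refine le_trans ?_ (add_le_add (Finset.sum_le_sum fun b _ => h1 b)
    (Finset.sum_le_sum (g := fun b : Fin (m+1) => if 2 * r ≤ (b:ℕ) then _ else 0)
      (f := fun b : Fin (m+1) => if 2 * r ≤ (b:ℕ) then r*(2*h) else 0) fun b _ => ?_))
  · rw [sum_tail _ _ _ hr]
    simp
    obtain ⟨z, hz⟩ := Nat.exists_eq_add_of_le hr
    obtain ⟨r', rfl⟩ := Nat.exists_eq_add_of_le h0
    rw [show 2*h*(Nat.succ 0+r') - 2*h = 2*h*r' by rw [Nat.mul_add]; simp]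
    rw [hz, Nat.add_sub_cancel_left]
    have : m * (2+1) + 1 = 3 * (m+1) - 2 := by omega
    rw [this, hz]
    have : 3 * (2 * (Nat.succ 0 + r') + z) - 2 = 6 * r' + 3 * z + 4 := by simp; omega
    rw [this]
    simp
    apply le_of_eq; ring
  · have := h2 b
    simp only [Finset.card_empty, zero_mul, zero_add, Nat.sub_zero] at this
    split_ifs
    · exact this
    · exact le_rfl

theorem CERT_three {F : Type*} [Field F] [CharZero F] {m r h d k : ℕ} (hq : m + 1 = 2*h+d)
    (hr : 2 * r ≤ m) (hp : 2*h*r - 2*h ≤ d*(m+1)) (hp2 : r*(2*h) + 2 * m ≤ (m+1)^2)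
    (hk1 : 1 ≤ k) (hk : k ≤ r*(2*h)) : CERT F m 2 k := by
  classical
  have h0 : 0 < r := by
    rcases Nat.eq_zero_or_pos r with h0 | h0
    · subst h0; simp at hk; omega
    · exact h0
  have hh0 : 0 < 2 * h := by
    rcases Nat.eq_zero_or_pos (2*h) with h0 | h0
    · rw [h0] at hk; simp at hk; omega
    · exact h0
  let i0 : Fin r × Fin (2*h) := (⟨0, h0⟩, ⟨0, hh0⟩)
  let H : Fin (m+1) → Finset (Fin r × Fin (2*h)) := fun b => if b = Fin.last m then {i0} else ∅
  have hHc : ∀ b, (H b).card * (m * 2 + 1) + (r*(2*h) - (H b).card) =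
      r * (2*h) + if b = Fin.last m then 2 * m else 0 := by
    intro b
    have : 1 ≤ r * (2 * h) := Nat.mul_pos h0 hh0
    by_cases hb : b = Fin.last m
    · simp [H, hb]; omega
    · simp [H, hb]
  obtain ⟨x', h1, h2⟩ := three_common (F := F) hq hp H
    (fun b => by
      by_cases hb : b = Fin.last m
      · simp [H, hb]; exact ND_two_one
      · simp [H, hb]; exact ND_zero)
    (fun b => by rw [hHc]; split_ifs <;> omega)
  refine CERT_of_fintype (N := Fin r × Fin (2*h)) (fun i =>
    (Fin.cons (bw (m+1) i.1 ![1, ((i.2 : ℕ) : F)]) (x' i) : Fin 3 → Fin (m+1) → F)) i0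
    (Pi.single (Fin.last m) 1) ?_ hk1 (by simpa using hk)
  have hr' : 2 * r ≤ m + 1 := by omega
  refine le_trans ?_ (block_le hr' x' (fun i => i.1) (fun i => ![1, ((i.2 : ℕ) : F)]) H
    _ (fun i => le_sup_of_le_left (le_iSup_of_le i le_rfl)) ?_)
  · refine le_trans ?_ (add_le_add (Finset.sum_le_sum fun b _ => h1 b)
      (Finset.sum_le_sum (g := fun b : Fin (m+1) => if 2 * r ≤ (b:ℕ) then _ else 0)
        (f := fun b : Fin (m+1) => (if 2 * r ≤ (b:ℕ) then r*(2*h) else 0) +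
          if b = Fin.last m then 2 * m else 0) fun b _ => ?_))
    · have hs : ∑ b : Fin (m+1), ((if 2*r ≤ (b:ℕ) then r*(2*h) else 0) +
          if b = Fin.last m then 2*m else 0) = (m+1-2*r)*(r*(2*h)) + 2*m := by
        rw [Finset.sum_add_distrib, sum_tail _ _ _ hr', Finset.sum_ite_eq']; simp
      rw [hs]
      simp
      obtain ⟨z, hz⟩ := Nat.exists_eq_add_of_le hr'
      obtain ⟨r', rfl⟩ := Nat.exists_eq_add_of_le h0
      rw [show 2*h*(Nat.succ 0+r') - 2*h = 2*h*r' by rw [Nat.mul_add]; simp]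
      have : m * (2+1) + 1 = 3 * (m+1) - 2 := by omega
      rw [this, hz, Nat.add_sub_cancel_left]
      have : 3 * (2 * (Nat.succ 0 + r') + z) - 2 = 6 * r' + 3 * z + 4 := by simp; omega
      rw [this]
      simp
      apply le_of_eq; ring
    · have := h2 b
      rw [hHc] at this
      by_cases hb : b = Fin.last m
      · have h7 : 2 * r ≤ (b:ℕ) := by rw [hb]; simpa using hr
        simp only [h7, if_true]
        exact this
      · simp only [hb, if_false, add_zero] at this ⊢
        split_ifs
        · exact this
        · exact le_rfl
  · intro b hb i hi
    by_cases hb : b = Fin.last m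
    · subst hb
      simp [H] at hi
      subst hi
      apply le_sup_of_le_right
      rw [Fin.update_cons_zero]
    · simp [H, hb] at hi

end

section
theorem num_three {m k : ℕ} (hm : 2 ≤ m) (hk : 1 ≤ k)
    (H : (k + m * 3) * (m * 3 + 1) ≤ (m+1)^3) :
    ∃ r h d, m + 1 = 2*h+d ∧ 2 * r ≤ m ∧ 2*h*r - 2*h ≤ d*(m+1) ∧ r*(2*h) + 2 * m ≤ (m+1)^2 ∧
      k ≤ r*(2*h) := by
  obtain ⟨r, hr⟩ : ∃ r, m = 2 * r ∨ m = 2 * r + 1 := ⟨m/2, by omega⟩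
  have hr1 : 1 ≤ r := by omega
  set h := (m+1)^2 / (2*(m+r)) with hh
  have h1 : h * (2 * (m+r)) ≤ (m+1)^2 := Nat.div_mul_le_self _ _
  have h2 : (m+1)^2 < (2*h+2)*(m+r) := by
    have := Nat.lt_mul_div_succ ((m+1)^2) (b := 2*(m+r)) (by omega)
    rw [← hh] at this; nlinarith
  have h3 : 2 * h ≤ m + 1 := by
    by_contra hc
    push Not at hc
    nlinarith
  obtain ⟨d, hd⟩ := Nat.exists_eq_add_of_le h3
  refine ⟨r, h, d, hd, by omega, ?_, ?_, ?_⟩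
  · rw [Nat.sub_le_iff_le_add]
    have : (m+1)^2 = (m+1)*(2*h+d) := by rw [← hd]; ring
    nlinarith
  · rcases hr with hr | hr <;> subst hr <;> nlinarith
  · by_contra hc
    push Not at hc
    rcases hr with hr | hr
    · subst hr
      nlinarith [mul_le_mul_right hc (3*r)]
    · subst hr
      have e1 : 4*r^2+2*r+3 ≤ 2*h*(3*r+1) := by nlinarith
      have e2 : (r*(2*h)+1+(2*r+1)*3) * ((2*r+1)*3+1) ≤ (2*r+1+1)^3 :=
        le_trans (Nat.mul_le_mul_right _ (by omega)) H
      have e3 := Nat.mul_le_mul_left (r * (6*r+4)) e1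
      have e4 := Nat.mul_le_mul_right (3*r+1) e2
      nlinarith

theorem num_base {m k : ℕ} (hm : 2 ≤ m) (H : (k+1) * (m * 4 + 1) ≤ (m+1)^3+1) :
    ∃ r h d, m + 1 = 2*h+d ∧ 2 * r ≤ m+1 ∧ 2*h*r - 2*h ≤ d*(m+1) ∧ r*(2*h) ≤ (m+1)^2 ∧
      k ≤ r*(2*h) := by
  obtain ⟨r, hr, hr0⟩ : ∃ r, (m + 1 = 2 * r ∨ m = 2 * r) ∧ r = (m+1)/2 := ⟨_, by omega, rfl⟩
  have hr1 : 1 ≤ r := by omega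
  set h := (m+1)^2 / (2*(m+r)) with hh
  have h1 : h * (2 * (m+r)) ≤ (m+1)^2 := Nat.div_mul_le_self _ _
  have h2 : (m+1)^2 < (2*h+2)*(m+r) := by
    have := Nat.lt_mul_div_succ ((m+1)^2) (b := 2*(m+r)) (by omega)
    rw [← hh] at this; nlinarith
  have h3 : 2 * h ≤ m + 1 := by
    by_contra hc
    push Not at hc
    nlinarith
  obtain ⟨d, hd⟩ := Nat.exists_eq_add_of_le h3
  refine ⟨r, h, d, hd, by omega, ?_, ?_, ?_⟩
  · rw [Nat.sub_le_iff_le_add]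
    have : (m+1)^2 = (m+1)*(2*h+d) := by rw [← hd]; ring
    nlinarith
  · nlinarith
  · by_cases hm16 : m < 18
    · interval_cases m <;> subst hr0 <;> norm_num at hh H <;> rw [hh] <;> norm_num <;> omega
    by_contra hc
    push Not at hc
    rcases hr with hr | hr
    · obtain rfl : m = 2 * r - 1 := by omega
      obtain ⟨t, rfl⟩ : ∃ t, r = t + 9 := ⟨r - 9, by omega⟩
      rw [show 2 * (t+9) - 1 = 2*t+17 by omega] at *
      have e1 : (2*t+18)^2+1 ≤ 2*h*(3*t+26)+2*(3*t+26) := by nlinarith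
      have e2 : ((t+9)*(2*h)+2) * ((2*t+17)*4+1) ≤ (2*t+18)^3+1 :=
        le_trans (Nat.mul_le_mul_right _ (by omega)) H
      have e3 := Nat.mul_le_mul_left ((t+9) * ((2*t+17)*4+1)) e1
      have e4 := Nat.mul_le_mul_right (3*t+26) e2
      nlinarith
    · subst hr
      obtain ⟨t, rfl⟩ : ∃ t, r = t + 9 := ⟨r - 9, by omega⟩
      have e2 : ((t+9)*(2*h)+2) * ((2*t+18)*4+1) ≤ (2*t+19)^3+1 := by
        refine le_trans (Nat.mul_le_mul_right _ (by omega : _ ≤ k+1)) (le_trans (le_of_eq ?_) (H.trans (le_of_eq ?_))) <;> ring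
      have e1 : (2*t+19)^2+1 ≤ 2*h*(3*t+27)+2*(3*t+27) := by nlinarith
      have e3 := Nat.mul_le_mul_left (((2*t+18)*4+1)) e1
      nlinarith

theorem ND_base {F : Type*} [Field F] [CharZero F] {m k : ℕ} (hm : 2 ≤ m)
    (H : (k+1) * (m * 4 + 1) ≤ (m+1)^3+1) : ND F m 3 k := by
  obtain ⟨r, h, d, h1, h2, h3, h4, h5⟩ := num_base hm H
  exact ND_three h1 h2 h3 h4 h5

theorem ceil_div (q k : ℕ) (m : ℕ) (hq : q = m + 1) : ∃ l, k ≤ q * l ∧ l * q ≤ k + m := by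
  refine ⟨(k + m)/q, ?_, Nat.div_mul_le_self _ _⟩
  have := Nat.lt_mul_div_succ (k+m) (b := q) (by omega)
  rw [Nat.mul_add] at this
  omega

theorem num_big {m s : ℕ} (hm : 2 ≤ m) (hs : 4 ≤ s)
    (hne : ¬ ((s = 4 ∧ m ≤ 4) ∨ (s = 5 ∧ m = 2))) :
    (2*m*s+2)*(m*(s+1)+1) ≤ (m+1)^s := by
  have step : ∀ s, 4 ≤ s → (2*m*s+2)*(m*(s+1)+1) ≤ (m+1)^s →
      (2*m*(s+1)+2)*(m*(s+1+1)+1) ≤ (m+1)^(s+1) := by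
    intro s hs h
    rw [pow_succ]
    refine le_trans ?_ (Nat.mul_le_mul_right _ h)
    obtain ⟨t, rfl⟩ := Nat.exists_eq_add_of_le hs
    obtain ⟨n, rfl⟩ := Nat.exists_eq_add_of_le hm
    have : ((2*(2+n)*(4+t+1)+2)*((2+n)*(4+t+1+1)+1)) +
      (2*(2+n)*(4+t)*((2+n)*(4+t)) ) ≤ (2*(2+n)*(4+t)+2)*((2+n)*(4+t+1)+1) * (2+n+1) := by
      have e : (0:ℤ) ≤ (2*(2+n)*(4+t)+2)*((2+n)*(4+t+1)+1) * (2+n+1) - (((2*(2+n)*(4+t+1)+2)*((2+n)*(4+t+1+1)+1)) + (2*(2+n)*(4+t)*((2+n)*(4+t)) )) := by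
        ring_nf; positivity
      zify; linarith
    omega
  have gen : ∀ s0, 4 ≤ s0 → (2*m*s0+2)*(m*(s0+1)+1) ≤ (m+1)^s0 → ∀ s, s0 ≤ s →
      (2*m*s+2)*(m*(s+1)+1) ≤ (m+1)^s := by
    intro s0 h0 h s hs
    induction s, hs using Nat.le_induction with
    | base => exact h
    | succ s hs ih => exact step s (h0.trans hs) ih
  rcases Nat.lt_or_ge 4 m with h | h
  · refine gen 4 le_rfl ?_ s hs
    obtain ⟨n, rfl⟩ := Nat.exists_eq_add_of_lt h
    ring_nf; nlinarith
  · interval_cases m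
    · exact gen 6 (by norm_num) (by norm_num) s (by omega)
    · exact gen 5 (by norm_num) (by norm_num) s (by omega)
    · exact gen 5 (by norm_num) (by norm_num) s (by omega)

theorem ND_all {F : Type*} [Field F] [CharZero F] {m : ℕ} (hm : 2 ≤ m) (s : ℕ) (hs : 3 ≤ s) :
    ∀ k, (k+1) * (m * (s+1) + 1) ≤ (m+1)^s → ND F m s k := by
  induction s, hs using Nat.le_induction with
  | base => exact fun k hk => ND_base hm (by simp at hk ⊢; omega)
  | succ s hs ih =>
    intro k hk
    by_cases hne : ((s+1 = 4 ∧ m ≤ 4) ∨ (s+1 = 5 ∧ m = 2))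
    · rcases hne with ⟨h1, h2⟩ | ⟨h1, h2⟩
      · obtain rfl : s = 3 := by omega
        interval_cases m
        · norm_num at hk
          exact ND_split (l := 2) (ND_base hm (by norm_num)) (by norm_num) (by omega)
        · norm_num at hk
          exact ND_split (l := 4) (ND_base hm (by norm_num)) (by norm_num) (by omega)
        · norm_num at hk
          exact ND_split (l := 6) (ND_base hm (by norm_num)) (by norm_num) (by omega)
      · obtain rfl : s = 4 := by omega
        subst h2
        norm_num at hk
        exact ND_split (l := 6) (ih _ (by norm_num)) (by norm_num) (by omega)
    · have hb := num_big hm (by omega) hne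
      suffices hh : ∀ k, 2*(m*(s+1)+1) ≤ k + 1 → (k+1) * (m * (s+1+1) + 1) ≤ (m+1)^(s+1) →
          ND F m (s+1) k by
        rcases le_total (2*(m*(s+1)+1)) (k+1) with h | h
        · exact hh k h hk
        · refine ND_mono (k := 2*(m*(s+1)+1) - 1) (hh _ (by omega) ?_) (by omega)
          refine le_trans (le_of_eq ?_) hb
          rw [show 2*(m*(s+1)+1) - 1 + 1 = 2*(m*(s+1)+1) by omega]; ring
      intro k h2 hk
      obtain ⟨l, hl1, hl2⟩ := ceil_div (m+1) k m rfl
      have h3 : (l+1) * (m*(s+1)+1) ≤ (m+1)^s := by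
        rw [pow_succ] at hk
        have e1 : (l+1)*(m+1) ≤ k + 1 + 2*m := by nlinarith
        have e2 : (l+1)*(m+1)*(m*(s+1)+1) ≤ (k+1+2*m)*(m*(s+1)+1) := Nat.mul_le_mul_right _ e1
        have e3 : m * (2*(m*(s+1)+1)) ≤ m*(k+1) := Nat.mul_le_mul_left _ h2
        have e4 : (l+1) * (m*(s+1)+1) * (m+1) ≤ (m+1)^s * (m+1) := by nlinarith
        exact Nat.le_of_mul_le_mul_right e4 (by omega)
      refine ND_split (l := l) (ih l h3) (by nlinarith) hl1

theorem CERT_all {F : Type*} [Field F] [CharZero F] {m s k : ℕ} (hm : 2 ≤ m) (hs : 2 ≤ s)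
    (hk : 1 ≤ k) (H : (k + m * (s+1)) * (m * (s+1) + 1) ≤ (m+1)^(s+1)) : CERT F m s k := by
  rcases Nat.eq_or_lt_of_le hs with h | h
  · subst h
    obtain ⟨r, h, d, h1, h2, h3, h4, h5⟩ := num_three hm hk H
    exact CERT_three h1 h2 h3 h4 hk h5
  · obtain ⟨l, hl1, hl2⟩ := ceil_div (m+1) k m rfl
    have e0 : (l * (m+1) + m * s) * (m * (s+1) + 1) ≤ (m+1)^(s+1) :=
      le_trans (Nat.mul_le_mul_right _ (by nlinarith)) H
    rw [pow_succ] at e0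
    have e1 : l * (m*(s+1)+1) + m * s ≤ (m+1)^s := by
      have : (l * (m*(s+1)+1) + m * s) * (m+1) ≤ (m+1)^s * (m+1) := by
        refine le_trans ?_ e0
        have : m * s * (m+1) ≤ m * s * (m*(s+1)+1) := Nat.mul_le_mul_left _ (by nlinarith)
        nlinarith
      exact Nat.le_of_mul_le_mul_right this (by omega)
    have e2 : (l+1+1) * (m*(s+1)+1) ≤ (m+1)^s := by
      have : ((l+1+1) * (m*(s+1)+1)) * (m+1) ≤ (m+1)^s * (m+1) := by
        refine le_trans ?_ e0
        have : (l+1+1) * (m+1) ≤ l * (m+1) + m * s := by nlinarith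
        nlinarith [Nat.mul_le_mul_right (m*(s+1)+1) this]
      exact Nat.le_of_mul_le_mul_right this (by omega)
    refine CERT_split (by omega) (l := l) ?_ ?_ e1 hk hl1
    · exact ND_all hm s (by omega) l (by nlinarith)
    · exact ND_all hm s (by omega) (l+1) e2

end

section
/-- permuting tensor factors -/
def perL (F : Type*) [Field F] {s q : ℕ} (π : Equiv.Perm (Fin s)) :
    ((Fin s → Fin q) → F) ≃ₗ[F] ((Fin s → Fin q) → F) :=
  LinearEquiv.funCongrLeft F F (Equiv.arrowCongr π (Equiv.refl (Fin q)))

theorem perL_seg {F : Type*} [Field F] {s q : ℕ} (π : Equiv.Perm (Fin s)) (u : Fin s → Fin q → F) :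
    perL F π (seg u) = seg (fun j => u (π j)) := by
  ext p
  simp only [perL, LinearEquiv.funCongrLeft_apply, LinearMap.funLeft_apply, seg]
  rw [← Equiv.prod_comp π]
  simp [Equiv.arrowCongr]

theorem perL_tv {F : Type*} [Field F] {s q : ℕ} (π : Equiv.Perm (Fin s)) (u : Fin s → Fin q → F)
    (j : Fin s) (w : Fin q → F) :
    perL F π (tv u (π j) w) = tv (fun j => u (π j)) j w := by
  unfold tv
  rw [perL_seg]
  congr 1
  funext i
  by_cases h : i = j
  · subst h; simp
  · rw [Function.update_of_ne h, Function.update_of_ne (fun h' => h (π.injective h'))]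

theorem perL_Tsp {F : Type*} [Field F] {s q : ℕ} (π : Equiv.Perm (Fin s)) (u : Fin s → Fin q → F) :
    (Tsp u).map (perL F π).toLinearMap ≤ Tsp (fun j => u (π j)) := by
  rintro _ ⟨v, hv, rfl⟩
  obtain ⟨w, rfl⟩ := mem_Tsp.1 hv
  simp only [LinearEquiv.coe_coe, map_sum]
  refine Submodule.sum_mem _ fun j _ => ?_
  obtain ⟨j, rfl⟩ := π.surjective j
  rw [perL_tv]
  exact tv_mem _ _ _

theorem CERT_sym {F : Type*} [Field F] {m s k : ℕ} (h : CERT F m s k) (i0 : Fin k)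
    (j0 : Fin (s+1)) :
    ∃ (x : Fin k → Fin (s+1) → Fin (m+1) → F) (e : Fin (m+1) → F),
    k * (m * (s+1) + 1) + m * s ≤ finrank F ((⨆ i, Tsp (x i)) ⊔ Tsp (Function.update (x i0) j0 e) :
      Submodule F ((Fin (s+1) → Fin (m+1)) → F)) := by
  obtain ⟨x, i1, e, hx⟩ := h
  let π : Equiv.Perm (Fin (s+1)) := Equiv.swap 0 j0
  let ρ : Equiv.Perm (Fin k) := Equiv.swap i1 i0
  refine ⟨fun i j => x (ρ i) (π j), e, hx.trans ?_⟩
  rw [← LinearEquiv.finrank_map_eq (perL F π)]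
  apply Submodule.finrank_mono
  rw [Submodule.map_sup, Submodule.map_iSup]
  refine sup_le_sup (iSup_le fun i => ?_) ?_
  · refine le_iSup_of_le (ρ.symm i) ?_
    refine (perL_Tsp π _).trans (le_of_eq ?_)
    simp
  · refine (perL_Tsp π _).trans (le_of_eq ?_)
    congr 1
    funext j
    by_cases h : j = j0
    · subst h; simp [π]
    · have : π j ≠ 0 := by
        intro h'
        apply h
        apply π.injective
        rw [h']; simp [π]
      rw [Function.update_of_ne h, Function.update_of_ne this]
      simp [ρ]

def Cfam {R : Type*} [CommRing R] {s q : ℕ} {N : Type*} (x : N → Fin s → Fin q → R)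
    (y : Fin s → Fin q → R) : (N × (Fin s × Fin q)) ⊕ (Fin s × Fin q) → (Fin s → Fin q) → R :=
  Sum.elim (fun c => tb (x c.1) c.2) (fun c => tb y c)

theorem span_Cfam {R : Type*} [CommRing R] {s q : ℕ} {N : Type*} (x : N → Fin s → Fin q → R)
    (y : Fin s → Fin q → R) :
    Submodule.span R (Set.range (Cfam x y)) = (⨆ i, Tsp (x i)) ⊔ Tsp y := by
  unfold Cfam
  rw [Set.Sum.elim_range, Submodule.span_union]
  congr 1
  apply le_antisymm
  · rw [Submodule.span_le]
    rintro _ ⟨⟨i, c⟩, rfl⟩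
    exact (le_iSup (fun i => Tsp (x i)) i) (tb_mem _ _)
  · refine iSup_le fun i => ?_
    unfold Tsp
    apply Submodule.span_mono
    rintro _ ⟨c, rfl⟩
    exact ⟨(i, c), rfl⟩

/-- the certificate at a point -/
def Good {L : Type*} [Field L] {m s k : ℕ} (x : Fin k → Fin (s+1) → Fin (m+1) → L) : Prop :=
  ∀ (i0 : Fin k) (j0 : Fin (s+1)), ∃ e : Fin (m+1) → L,
    k * (m * (s+1) + 1) + m * s ≤ finrank L ((⨆ i, Tsp (x i)) ⊔ Tsp (Function.update (x i0) j0 e) :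
      Submodule L ((Fin (s+1) → Fin (m+1)) → L))

theorem Good_generic {F : Type u} [Field F] {m s k : ℕ} (h : CERT F m s k) :
    ∃ G : MvPolynomial (Fin k × Fin (s+1) × Fin (m+1)) F, G ≠ 0 ∧
      ∀ (L : Type v) [Field L] [Algebra F L] (t : Fin k × Fin (s+1) × Fin (m+1) → L),
      aeval t G ≠ 0 → Good (pt t) := by
  classical
  have h1 : ∀ c : Fin k × Fin (s+1), ∃ e : Fin (m+1) → F,
      ∃ G : MvPolynomial (Fin k × Fin (s+1) × Fin (m+1)) F, G ≠ 0 ∧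
      ∀ (L : Type v) [Field L] [Algebra F L] (t : Fin k × Fin (s+1) × Fin (m+1) → L),
      aeval t G ≠ 0 →
      k * (m * (s+1) + 1) + m * s ≤ finrank L ((⨆ i, Tsp (pt t i)) ⊔
        Tsp (Function.update (pt t c.1) c.2 (fun a => algebraMap F L (e a))) :
        Submodule L ((Fin (s+1) → Fin (m+1)) → L)) := by
    rintro ⟨i0, j0⟩
    obtain ⟨x, e, hx⟩ := CERT_sym h i0 j0
    refine ⟨e, ?_⟩
    let gg : Fin k → Fin (s+1) → Fin (m+1) → MvPolynomial (Fin k × Fin (s+1) × Fin (m+1)) F :=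
      gen F (Fin k) (s+1) (m+1)
    let f := Cfam gg (Function.update (gg i0) j0 (fun a => C (e a)))
    have key : ∀ (L : Type _) [Field L] [Algebra F L] (t : Fin k × Fin (s+1) × Fin (m+1) → L),
        (fun c p => aeval t (f c p)) = Cfam (pt t)
          (Function.update (pt t i0) j0 (fun a => algebraMap F L (e a))) := by
      intro L _ _ t
      funext c p
      rcases c with (c | c)
      · simp only [f, Cfam, Sum.elim_inl]
        have := tb_map (aeval t : _ →ₐ[F] L).toRingHom (gg c.1) c.2 p
        simp only [AlgHom.toRingHom_eq_coe, RingHom.coe_coe] at this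
        rw [this]
        simp only [gg, gen, aeval_X]; rfl
      · simp only [f, Cfam, Sum.elim_inr]
        have := tb_map (aeval t : _ →ₐ[F] L).toRingHom
          (Function.update (gg i0) j0 (fun a => C (e a))) c p
        simp only [AlgHom.toRingHom_eq_coe, RingHom.coe_coe] at this
        rw [this]
        congr 1
        funext j a
        by_cases hj : j = j0
        · subst hj; simp [MvPolynomial.algebraMap_eq]
        · simp [Function.update_of_ne hj, gg, gen, pt]
    have key0 : (fun c p => eval (unpt x) (f c p)) = Cfam x (Function.update (x i0) j0 e) := by
      have := key F (unpt x)
      simp only [MvPolynomial.aeval_eq_eval] at this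
      exact this
    have hop : ∃ G : MvPolynomial (Fin k × Fin (s+1) × Fin (m+1)) F, G ≠ 0 ∧
        ∀ (L : Type v) [Field L] [Algebra F L] (t : Fin k × Fin (s+1) × Fin (m+1) → L),
        aeval t G ≠ 0 → k * (m * (s+1) + 1) + m * s ≤
          finrank L (Submodule.span L (Set.range fun c p => aeval t (f c p))) := by
      apply open_rank f (unpt x) (k * (m * (s+1) + 1) + m * s)
      rw [key0, span_Cfam]; exact hx
    obtain ⟨G, hG, hG2⟩ := hop
    refine ⟨G, hG, fun L _ _ t ht => ?_⟩
    have := hG2 L t ht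
    have key1 : (fun c p => aeval t (f c p)) = Cfam (pt t)
          (Function.update (pt t i0) j0 (fun a => algebraMap F L (e a))) := by
      funext c p
      rcases c with (c | c)
      · simp only [f, Cfam, Sum.elim_inl]
        have := tb_map (aeval t : _ →ₐ[F] L).toRingHom (gg c.1) c.2 p
        simp only [AlgHom.toRingHom_eq_coe, RingHom.coe_coe] at this
        rw [this]
        simp only [gg, gen, aeval_X]; rfl
      · simp only [f, Cfam, Sum.elim_inr]
        have := tb_map (aeval t : _ →ₐ[F] L).toRingHom
          (Function.update (gg i0) j0 (fun a => C (e a))) c p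
        simp only [AlgHom.toRingHom_eq_coe, RingHom.coe_coe] at this
        rw [this]
        congr 1
        funext j a
        by_cases hj : j = j0
        · subst hj; simp [MvPolynomial.algebraMap_eq]
        · simp [Function.update_of_ne hj, gg, gen, pt]
    rw [key1, span_Cfam] at this
    exact this
  choose e G hG hG2 using h1
  refine ⟨∏ c, G c, Finset.prod_ne_zero_iff.2 fun c _ => hG c, fun L _ _ t ht i0 j0 => ?_⟩
  rw [map_prod, Finset.prod_ne_zero_iff] at ht
  exact ⟨_, hG2 (i0, j0) L t (ht _ (Finset.mem_univ _))⟩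

/-! consequences of `Good` -/

theorem mem_sup_upd {L : Type*} [Field L] {m s k : ℕ} (x : Fin k → Fin (s+1) → Fin (m+1) → L)
    (i0 j0) (e : Fin (m+1) → L) (φ : ({j : Fin (s+1) // j ≠ j0} → Fin (m+1) → L) →ₗ[L]
      ((Fin (s+1) → Fin (m+1)) → L)) 
    (hφ : ∀ w, φ w = ∑ j, tv (Function.update (x i0) j0 e) j.1 (w j)) :
    (⨆ i, Tsp (x i)) ⊔ Tsp (Function.update (x i0) j0 e) ≤ (⨆ i, Tsp (x i)) ⊔ LinearMap.range φ := by
  refine sup_le le_sup_left ?_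
  intro v hv
  obtain ⟨w, rfl⟩ := mem_Tsp.1 hv
  rw [← Finset.add_sum_erase _ _ (Finset.mem_univ j0)]
  apply Submodule.add_mem_sup
  · refine (le_iSup (fun i => Tsp (x i)) i0) ?_
    have : tv (Function.update (x i0) j0 e) j0 (w j0) = tv (x i0) j0 (w j0) := by
      simp [tv]
    rw [this]; exact tv_mem _ _ _
  · refine ⟨fun j => w j, ?_⟩
    rw [hφ]
    symm
    refine Finset.sum_subtype _ ?_ _
    intro j; simp

def phiU {L : Type*} [Field L] {m s : ℕ} (y : Fin (s+1) → Fin (m+1) → L) (j0 : Fin (s+1)) :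
    ({j : Fin (s+1) // j ≠ j0} → Fin (m+1) → L) →ₗ[L] ((Fin (s+1) → Fin (m+1)) → L) :=
  ∑ j : {j : Fin (s+1) // j ≠ j0}, tvL y j.1 ∘ₗ LinearMap.proj j

theorem phiU_apply {L : Type*} [Field L] {m s : ℕ} (y : Fin (s+1) → Fin (m+1) → L) (j0 w) :
    phiU y j0 w = ∑ j, tv y j.1 (w j) := by
  simp [phiU, tvL_apply]

theorem finrank_iSup_Tsp_le {L : Type*} [Field L] {m s k : ℕ}
    (x : Fin k → Fin (s+1) → Fin (m+1) → L) :
    finrank L (⨆ i, Tsp (x i) : Submodule L ((Fin (s+1) → Fin (m+1)) → L)) ≤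
      k * (m * (s+1) + 1) := by
  let φ : (∀ i, Tsp (x i)) →ₗ[L] ((Fin (s+1) → Fin (m+1)) → L) :=
    ∑ i, (Tsp (x i)).subtype ∘ₗ LinearMap.proj i
  have h1 : (⨆ i, Tsp (x i)) ≤ LinearMap.range φ := by
    refine iSup_le fun i v hv => ?_
    refine ⟨Pi.single i ⟨v, hv⟩, ?_⟩
    simp only [φ, LinearMap.sum_apply, LinearMap.comp_apply, LinearMap.proj_apply]
    rw [Finset.sum_eq_single i]
    · simp
    · intro b _ hb; simp [Pi.single_eq_of_ne hb]
    · simp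
  refine (Submodule.finrank_mono h1).trans ((LinearMap.finrank_range_le φ).trans ?_)
  rw [finrank_pi_fintype]
  refine (Finset.sum_le_card_nsmul _ _ _ fun i _ => finrank_Tsp_le (x i)).trans ?_
  simp

/-- independence of tangent spaces from the dimension -/
theorem indep_of_finrank {L : Type*} [Field L] {m s k : ℕ}
    (x : Fin k → Fin (s+1) → Fin (m+1) → L)
    (h : k * (m * (s+1) + 1) ≤ finrank L (⨆ i, Tsp (x i) :
      Submodule L ((Fin (s+1) → Fin (m+1)) → L)))
    (v : Fin k → (Fin (s+1) → Fin (m+1)) → L) (hv : ∀ i, v i ∈ Tsp (x i)) (h0 : ∑ i, v i = 0) :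
    ∀ i, v i = 0 := by
  let φ : (∀ i, Tsp (x i)) →ₗ[L] ((Fin (s+1) → Fin (m+1)) → L) :=
    ∑ i, (Tsp (x i)).subtype ∘ₗ LinearMap.proj i
  have h1 : (⨆ i, Tsp (x i)) ≤ LinearMap.range φ := by
    refine iSup_le fun i v hv => ?_
    refine ⟨Pi.single i ⟨v, hv⟩, ?_⟩
    simp only [φ, LinearMap.sum_apply, LinearMap.comp_apply, LinearMap.proj_apply]
    rw [Finset.sum_eq_single i]
    · simp
    · intro b _ hb; simp [Pi.single_eq_of_ne hb]
    · simp
  have h2 : finrank L (∀ i, Tsp (x i)) ≤ k * (m * (s+1)+1) := by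
    rw [finrank_pi_fintype]
    refine (Finset.sum_le_card_nsmul _ _ _ fun i _ => finrank_Tsp_le (x i)).trans ?_
    simp
  have h3 := Submodule.finrank_mono h1
  have h4 := LinearMap.finrank_range_add_finrank_ker φ
  have h5 : finrank L (LinearMap.ker φ) = 0 := by omega
  rw [Submodule.finrank_eq_zero] at h5
  have h6 : (fun i => (⟨v i, hv i⟩ : Tsp (x i))) ∈ LinearMap.ker φ := by
    rw [LinearMap.mem_ker]
    simp only [φ, LinearMap.sum_apply, LinearMap.comp_apply, LinearMap.proj_apply,
      Submodule.subtype_apply]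
    exact h0
  rw [h5, Submodule.mem_bot] at h6
  intro i
  have := congrFun h6 i
  simpa using this

theorem Good.finrank {L : Type*} [Field L] {m s k : ℕ} {x : Fin k → Fin (s+1) → Fin (m+1) → L}
    (h : Good x) (hk : 1 ≤ k) (hx : ∀ i j, x i j ≠ 0):
    k * (m * (s+1) + 1) ≤ finrank L (⨆ i, Tsp (x i) :
      Submodule L ((Fin (s+1) → Fin (m+1)) → L)) ∧
    ∀ i0 j0, ∃ e : Fin (m+1) → L, ∀ w : Fin (s+1) → Fin (m+1) → L,
      ∑ j ∈ Finset.univ.erase j0, tv (Function.update (x i0) j0 e) j (w j) ∈ (⨆ i, Tsp (x i) :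
        Submodule L ((Fin (s+1) → Fin (m+1)) → L)) → ∀ j, j ≠ j0 → ∃ c : L, w j = c • x i0 j := by
  set W : Submodule L ((Fin (s+1) → Fin (m+1)) → L) := ⨆ i, Tsp (x i) with hW
  have main : ∀ i0 j0, ∃ e : Fin (m+1) → L, k * (m * (s+1) + 1) ≤ Module.finrank L W ∧
      ∀ w : Fin (s+1) → Fin (m+1) → L,
      ∑ j ∈ Finset.univ.erase j0, tv (Function.update (x i0) j0 e) j (w j) ∈ W →
        ∀ j, j ≠ j0 → ∃ c : L, w j = c • x i0 j := by
    intro i0 j0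
    obtain ⟨e, he⟩ := h i0 j0
    refine ⟨e, ?_⟩
    let y := Function.update (x i0) j0 e
    let φ := phiU y j0
    let ψ := W.mkQ ∘ₗ φ
    let C : ({j : Fin (s+1) // j ≠ j0} → L) →ₗ[L] ({j : Fin (s+1) // j ≠ j0} → Fin (m+1) → L) :=
      LinearMap.pi fun j => (LinearMap.toSpanSingleton L _ (x i0 j.1)) ∘ₗ LinearMap.proj j
    have hC : ∀ c j, C c j = c j • x i0 j.1 := fun c j => rfl
    have hCi : Function.Injective C := by
      intro c c' hc
      funext j
      have h1 := congrFun hc j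
      rw [hC, hC] at h1
      exact smul_left_injective L (hx i0 j.1) h1
    have hcard : Fintype.card {j : Fin (s+1) // j ≠ j0} = s := by
      rw [Fintype.card_subtype_compl]; simp
    have hCk : LinearMap.range C ≤ LinearMap.ker ψ := by
      rintro _ ⟨c, rfl⟩
      rw [LinearMap.mem_ker]
      simp only [ψ, LinearMap.comp_apply, Submodule.mkQ_apply, Submodule.Quotient.mk_eq_zero]
      simp only [φ]
      rw [phiU_apply]
      refine Submodule.sum_mem _ fun j _ => ?_
      rw [hC, ← tvL_apply, map_smul, tvL_apply]
      refine Submodule.smul_mem _ _ ?_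
      have h1 : y j.1 = x i0 j.1 := Function.update_of_ne j.2 _ _
      rw [← h1, tv_self]
      exact (le_iSup (fun i => Tsp (x i)) i0) (tv_mem (x i0) j0 e)
    have d1 : Module.finrank L (LinearMap.range C) = s := by
      rw [LinearMap.finrank_range_of_inj hCi, finrank_fintype_fun_eq_card, hcard]
    have d2 := LinearMap.finrank_range_add_finrank_ker ψ
    have d3 : Module.finrank L ({j : Fin (s+1) // j ≠ j0} → Fin (m+1) → L) = s * (m+1) := by
      rw [finrank_pi_fintype]; simp [hcard]
    have d4 : k * (m * (s+1) + 1) + m * s ≤ Module.finrank L (W ⊔ LinearMap.range φ :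
        Submodule L ((Fin (s+1) → Fin (m+1)) → L)) :=
      he.trans (Submodule.finrank_mono (mem_sup_upd x i0 j0 e φ (fun w => phiU_apply _ _ _)))
    have d5 : Module.finrank L (W ⊔ LinearMap.range φ :
        Submodule L ((Fin (s+1) → Fin (m+1)) → L)) =
        Module.finrank L W + Module.finrank L (LinearMap.range ψ) := by
      have e1 : LinearMap.range ψ = (W ⊔ LinearMap.range φ).map W.mkQ := by
        rw [Submodule.map_sup, LinearMap.range_comp]
        simp
      have e2 := Submodule.finrank_quotient_add_finrank (W.comap (W ⊔ LinearMap.range φ).subtype)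
      have e3 := LinearMap.finrank_range_add_finrank_ker (W.mkQ.domRestrict (W ⊔ LinearMap.range φ))
      rw [LinearMap.range_domRestrict, ← e1, LinearMap.ker_domRestrict, Submodule.ker_mkQ] at e3
      rw [← e3, add_comm]
      congr 1
      exact LinearEquiv.finrank_eq (Submodule.comapSubtypeEquivOfLe le_sup_left)
    have d6 := finrank_iSup_Tsp_le x
    rw [← hW] at d6
    have d7 := Submodule.finrank_mono hCk
    rw [d1] at d7
    have d8 : s * (m+1) = m * s + s := by ring
    have d9 : LinearMap.range C = LinearMap.ker ψ :=
      Submodule.eq_of_le_of_finrank_le hCk (by omega)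
    refine ⟨by omega, fun w hw j hj => ?_⟩
    have : (fun j : {j : Fin (s+1) // j ≠ j0} => w j.1) ∈ LinearMap.ker ψ := by
      rw [LinearMap.mem_ker]
      simp only [ψ, LinearMap.comp_apply, Submodule.mkQ_apply, Submodule.Quotient.mk_eq_zero, φ]
      rw [phiU_apply]
      convert hw using 1
      symm
      refine Finset.sum_subtype _ ?_ _
      intro j; simp
    rw [← d9] at this
    obtain ⟨c, hc⟩ := this
    refine ⟨c ⟨j, hj⟩, ?_⟩
    have := congrFun hc ⟨j, hj⟩
    rw [hC] at this
    exact this.symm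
  refine ⟨(main ⟨0, hk⟩ 0).choose_spec.1, fun i0 j0 => ?_⟩
  obtain ⟨e, he⟩ := main i0 j0
  exact ⟨e, he.2⟩

end

section
/-- the universal field -/
abbrev Uni (F : Type u) [Field F] (σ : Type) : Type u :=
  AlgebraicClosure (FractionRing (MvPolynomial σ F))

theorem Uni_inj {F : Type u} [Field F] {σ : Type} :
    Function.Injective (algebraMap (MvPolynomial σ F) (Uni F σ)) := by
  rw [IsScalarTower.algebraMap_eq (MvPolynomial σ F) (FractionRing (MvPolynomial σ F)) (Uni F σ)]
  exact (algebraMap (FractionRing (MvPolynomial σ F)) (Uni F σ)).injective.comp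
    (IsFractionRing.injective _ _)

def upt (F : Type u) [Field F] (σ : Type) : σ → Uni F σ :=
  fun c => algebraMap (MvPolynomial σ F) (Uni F σ) (X c)

theorem aeval_upt {F : Type u} [Field F] {σ : Type} (G : MvPolynomial σ F) :
    aeval (upt F σ) G = algebraMap (MvPolynomial σ F) (Uni F σ) G := by
  have : (aeval (upt F σ) : MvPolynomial σ F →ₐ[F] Uni F σ) =
      IsScalarTower.toAlgHom F (MvPolynomial σ F) (Uni F σ) := by
    ext i; simp [upt]
  rw [this]; rfl

theorem aeval_upt_ne {F : Type u} [Field F] {σ : Type} {G : MvPolynomial σ F} (h : G ≠ 0) :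
    aeval (upt F σ) G ≠ 0 := by
  rw [aeval_upt]
  intro h0
  exact h (Uni_inj (by rw [h0, map_zero]))

theorem exists_der {F : Type u} [Field F] [CharZero F] {σ : Type} (δ : σ → Uni F σ) :
    ∃ D : Derivation F (Uni F σ) (Uni F σ), ∀ c, D (upt F σ c) = δ c := by
  have i1 : Algebra.FormallyEtale (MvPolynomial σ F) (FractionRing (MvPolynomial σ F)) :=
    Algebra.FormallyEtale.of_isLocalization (nonZeroDivisors (MvPolynomial σ F))
  have : CharZero (FractionRing (MvPolynomial σ F)) :=
    charZero_of_injective_algebraMap (IsFractionRing.injective (MvPolynomial σ F) _)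
  have i2 : Algebra.FormallyEtale (FractionRing (MvPolynomial σ F)) (Uni F σ) :=
    Algebra.FormallyEtale.of_isSeparable _ _
  have i3 : Algebra.FormallyEtale (MvPolynomial σ F) (Uni F σ) :=
    Algebra.FormallyEtale.comp _ (FractionRing (MvPolynomial σ F)) _
  let D0 : Derivation F (MvPolynomial σ F) (Uni F σ) := mkDerivation F δ
  let e := KaehlerDifferential.tensorKaehlerEquivOfFormallyEtale F (MvPolynomial σ F) (Uni F σ)
  let φ := (D0.liftKaehlerDifferential.liftBaseChange (Uni F σ)) ∘ₗ e.symm.toLinearMap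
  refine ⟨φ.compDer (KaehlerDifferential.D F (Uni F σ)), fun c => ?_⟩
  have h1 : e.symm (KaehlerDifferential.D F (Uni F σ) (upt F σ c)) = _ :=
    KaehlerDifferential.tensorKaehlerEquivOfFormallyEtale_symm_D_algebraMap
      F (MvPolynomial σ F) (Uni F σ) (X c)
  change (D0.liftKaehlerDifferential.liftBaseChange (Uni F σ))
    (e.symm (KaehlerDifferential.D F (Uni F σ) (upt F σ c))) = δ c
  rw [h1, LinearMap.liftBaseChange_tmul, Derivation.liftKaehlerDifferential_comp_D, one_smul]
  exact mkDerivation_X _ _ _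

theorem der_seg {F L : Type*} [Field F] [Field L] [Algebra F L] (D : Derivation F L L) {s q : ℕ}
    (u : Fin s → Fin q → L) (p) :
    D (seg u p) = (∑ j, tv u j (fun a => D (u j a))) p := by
  have : ∀ (S : Finset (Fin s)) (f : Fin s → L), D (∏ j ∈ S, f j) =
      ∑ j ∈ S, D (f j) * ∏ i ∈ S.erase j, f i := by
    intro S f
    induction S using Finset.induction_on with
    | empty => simp
    | insert a S ha ih =>
      rw [Finset.prod_insert ha, D.leibniz, ih, Finset.sum_insert ha, Finset.erase_insert ha]
      simp only [smul_eq_mul]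
      rw [add_comm, Finset.mul_sum]
      congr 1
      · ring
      · refine Finset.sum_congr rfl fun j hj => ?_
        rw [Finset.erase_insert_of_ne (by rintro rfl; exact ha hj),
          Finset.prod_insert (by simp [ha])]
        ring
  simp only [seg, this, Finset.sum_apply, tv_apply]

theorem mem_of_dual {L P : Type*} [Field L] [Fintype P] (W : Submodule L (P → L)) (v : P → L)
    (h : ∀ f : P → L, (∀ w ∈ W, f ⬝ᵥ w = 0) → f ⬝ᵥ v = 0) : v ∈ W := by
  classical
  by_contra hv
  obtain ⟨g, hg, hW⟩ := Submodule.exists_le_ker_of_notMem hv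
  have key : ∀ w, (fun p => g (Pi.single p 1)) ⬝ᵥ w = g w := by
    intro w
    conv_rhs => rw [LinearMap.pi_apply_eq_sum_univ g w]
    simp only [dotProduct, smul_eq_mul]
    refine Finset.sum_congr rfl fun p _ => ?_
    have : (fun j => if p = j then (1:L) else 0) = Pi.single p 1 := by
      ext j; simp [Pi.single_apply, eq_comm]
    rw [this, mul_comm]
  apply hg
  rw [← key]
  apply h
  intro w hw
  rw [key]
  exact hW hw

theorem mem_iSup_Tsp {L : Type*} [Field L] {k s q : ℕ} {t : Fin k → Fin s → Fin q → L}
    {v} (h : v ∈ (⨆ i, Tsp (t i))) : ∃ w : Fin k → Fin s → Fin q → L,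
      v = ∑ i, ∑ j, tv (t i) j (w i j) := by
  rw [Submodule.mem_iSup_iff_exists_finsupp] at h
  obtain ⟨f, hf, rfl⟩ := h
  choose w hw using fun i => mem_Tsp.1 (hf i)
  refine ⟨w, ?_⟩
  rw [Finsupp.sum_fintype _ _ (by simp)]
  exact Finset.sum_congr rfl fun i _ => hw i

theorem der_dot {F L P : Type*} [Field F] [Field L] [Algebra F L] [Fintype P]
    (D : Derivation F L L) (f v : P → L) :
    D (f ⬝ᵥ v) = (fun p => D (f p)) ⬝ᵥ v + f ⬝ᵥ (fun p => D (v p)) := by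
  simp only [dotProduct, map_sum, D.leibniz, smul_eq_mul, ← Finset.sum_add_distrib]
  refine Finset.sum_congr rfl fun p _ => ?_
  ring

section gen
variable {F L : Type*} [Field F] [Field L] [Algebra F L] {m s k : ℕ}
  {t : Fin k → Fin (s+1) → Fin (m+1) → L}

theorem step1 (hG : Good t) (hk : 1 ≤ k) (hs : 1 ≤ s) (ht : ∀ i j, t i j ≠ 0)
    (hD : ∀ δ : Fin k → Fin (s+1) → Fin (m+1) → L, ∃ D : Derivation F L L,
      ∀ i j a, D (t i j a) = δ i j a)
    (y : Fin (s+1) → Fin (m+1) → L) (hy : Tsp y ≤ ⨆ i, Tsp (t i)) :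
    ∃ c : Fin k → L, seg y = ∑ i, c i • seg (t i) := by
  obtain ⟨h1, h2⟩ := hG.finrank hk ht
  obtain ⟨w, hw⟩ := mem_iSup_Tsp (hy (seg_mem y))
  have key : ∀ i0 j0 e, ∑ j ∈ Finset.univ.erase j0, tv (Function.update (t i0) j0 e) j (w i0 j) ∈
      (⨆ i, Tsp (t i)) := by
    intro i0 j0 e
    apply mem_of_dual
    intro f hf
    obtain ⟨D, hD⟩ := hD (Function.update 0 i0 (Function.update 0 j0 e))
    have e1 : (fun p => D (f p)) ⬝ᵥ seg y = 0 := by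
      have := der_dot D f (seg y)
      rw [hf _ (hy (seg_mem y))] at this
      have h3 : (fun p => D (seg y p)) ∈ (⨆ i, Tsp (t i)) := by
        have : (fun p => D (seg y p)) = ∑ j, tv y j (fun a => D (y j a)) := by
          funext p; exact der_seg D y p
        rw [this]
        exact Submodule.sum_mem _ fun j _ => hy (tv_mem _ _ _)
      rw [hf _ h3] at this
      simpa using this.symm
    have e2 : ∀ i j, (fun p => D (f p)) ⬝ᵥ tv (t i) j (w i j) +
        f ⬝ᵥ (∑ j' ∈ Finset.univ.erase j, tv (Function.update (t i) j (w i j)) j'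
          (fun a => D (t i j' a))) = 0 := by
      intro i j
      have hm : ∀ z, tv (t i) j z ∈ (⨆ i, Tsp (t i)) := fun z =>
        (le_iSup (fun i => Tsp (t i)) i) (tv_mem _ _ _)
      have := der_dot D f (tv (t i) j (w i j))
      rw [hf _ (hm _)] at this
      have h3 : (fun p => D (tv (t i) j (w i j) p)) = tv (t i) j (fun a => D (w i j a)) +
          ∑ j' ∈ Finset.univ.erase j, tv (Function.update (t i) j (w i j)) j'
          (fun a => D (t i j' a)) := by
        funext p
        have := der_seg D (Function.update (t i) j (w i j)) p
        rw [← Finset.add_sum_erase _ _ (Finset.mem_univ j)] at this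
        have h4 : tv (Function.update (t i) j (w i j)) j
            (fun a => D (Function.update (t i) j (w i j) j a)) =
            tv (t i) j (fun a => D (w i j a)) := by simp [tv]
        have h5 : ∑ j' ∈ Finset.univ.erase j, tv (Function.update (t i) j (w i j)) j'
            (fun a => D (Function.update (t i) j (w i j) j' a)) =
            ∑ j' ∈ Finset.univ.erase j, tv (Function.update (t i) j (w i j)) j'
              (fun a => D (t i j' a)) := by
          refine Finset.sum_congr rfl fun j' hj' => ?_
          rw [Function.update_of_ne (Finset.ne_of_mem_erase hj')]
        rw [h4, h5] at this
        exact this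
      rw [h3, dotProduct_add, hf _ (hm _), zero_add] at this
      simpa using this.symm
    have e3 : ∑ i, ∑ j, f ⬝ᵥ (∑ j' ∈ Finset.univ.erase j,
        tv (Function.update (t i) j (w i j)) j' (fun a => D (t i j' a))) = 0 := by
      have : ∑ i, ∑ j, ((fun p => D (f p)) ⬝ᵥ tv (t i) j (w i j) +
        f ⬝ᵥ (∑ j' ∈ Finset.univ.erase j, tv (Function.update (t i) j (w i j)) j'
          (fun a => D (t i j' a)))) = 0 :=
        Finset.sum_eq_zero fun i _ => Finset.sum_eq_zero fun j _ => e2 i j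
      simp only [Finset.sum_add_distrib] at this
      rw [hw] at e1
      simp only [dotProduct_sum] at e1 this ⊢
      rw [e1, zero_add] at this
      exact this
    rw [Finset.sum_eq_single i0] at e3
    · have e4 : ∀ j, (∑ j' ∈ Finset.univ.erase j,
          tv (Function.update (t i0) j (w i0 j)) j' (fun a => D (t i0 j' a))) =
          if j = j0 then 0 else tv (Function.update (t i0) j0 e) j (w i0 j) := by
        intro j
        split_ifs with hj
        · subst hj
          refine Finset.sum_eq_zero fun j' hj' => ?_
          have : (fun a => D (t i0 j' a)) = 0 := by
            funext a
            rw [hD]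
            simp [Function.update_of_ne (Finset.ne_of_mem_erase hj')]
          rw [this, ← tvL_apply, map_zero]
        · rw [Finset.sum_eq_single j0]
          · have : (fun a => D (t i0 j0 a)) = e := by
              funext a; rw [hD]; simp
            rw [this]
            unfold tv
            rw [Function.update_comm hj]
          · intro j' _ hj'
            have : (fun a => D (t i0 j' a)) = 0 := by
              funext a
              rw [hD]
              simp [Function.update_of_ne hj']
            rw [this, ← tvL_apply, map_zero]
          · intro h; exfalso; apply h; simp [Ne.symm hj]
      simp only [e4] at e3
      rw [dotProduct_sum, ← e3, ← Finset.add_sum_erase _ _ (Finset.mem_univ j0)]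
      simp only [if_true, dotProduct_zero, zero_add]
      refine Finset.sum_congr rfl fun j hj => ?_
      rw [if_neg (Finset.ne_of_mem_erase hj)]
    · intro i _ hi
      refine Finset.sum_eq_zero fun j _ => ?_
      have : ∀ j', (fun a => D (t i j' a)) = 0 := by
        intro j'
        funext a
        rw [hD]
        simp [Function.update_of_ne hi]
      simp only [this, ← tvL_apply, map_zero]
      simp
    · simp
  have key2 : ∀ i j, ∃ c : L, w i j = c • t i j := by
    intro i j
    obtain ⟨j0, hj0⟩ : ∃ j0 : Fin (s+1), j ≠ j0 := by
      by_cases h : j = 0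
      · exact ⟨⟨1, by omega⟩, by subst h; intro h; simpa using congrArg Fin.val h⟩
      · exact ⟨0, h⟩
    obtain ⟨e, he⟩ := h2 i j0
    exact he (w i) (key i j0 e) j hj0
  choose c hc using key2
  refine ⟨fun i => ∑ j, c i j, ?_⟩
  rw [hw]
  refine Finset.sum_congr rfl fun i _ => ?_
  rw [Finset.sum_smul]
  refine Finset.sum_congr rfl fun j _ => ?_
  rw [hc, ← tvL_apply, map_smul, tvL_apply, tv_self]

theorem seg_ne_zero {s q : ℕ} {u : Fin s → Fin q → L} (h : ∀ j, u j ≠ 0) : seg u ≠ 0 := by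
  have : ∀ j, ∃ a, u j a ≠ 0 := fun j => Function.ne_iff.1 (h j)
  choose a ha using this
  intro h0
  have := congrFun h0 a
  simp only [seg, Pi.zero_apply, Finset.prod_eq_zero_iff] at this
  obtain ⟨j, -, hj⟩ := this
  exact ha j hj

theorem seg_update {s q : ℕ} (u : Fin s → Fin q → L) (p : Fin s → Fin q) (j) (a) :
    seg u (Function.update p j a) = u j a * ∏ i ∈ Finset.univ.erase j, u i (p i) := by
  unfold seg
  rw [← Finset.mul_prod_erase _ _ (Finset.mem_univ j)]
  congr 1
  · simp
  · refine Finset.prod_congr rfl fun i hi => ?_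
    rw [Function.update_of_ne (Finset.ne_of_mem_erase hi)]

theorem step2 (h1 : k * (m * (s+1) + 1) ≤ finrank L (⨆ i, Tsp (t i) :
      Submodule L ((Fin (s+1) → Fin (m+1)) → L))) (hk : 1 ≤ k) (ht : ∀ i j, t i j ≠ 0)
    (y : Fin (s+1) → Fin (m+1) → L) (c : Fin k → L) (hc : seg y = ∑ i, c i • seg (t i)) :
    ∃ i, ∀ p p', seg y p * seg (t i) p' = seg y p' * seg (t i) p := by
  by_cases h0 : ∀ i, c i = 0
  · refine ⟨⟨0, hk⟩, ?_⟩
    simp [hc, h0]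
  push Not at h0
  obtain ⟨i0, hi0⟩ := h0
  refine ⟨i0, ?_⟩
  have key : ∀ j a a', y j a' * t i0 j a = y j a * t i0 j a' := by
    intro j a a'
    have e0 : ∑ i, (c i * (y j a' * t i j a - y j a * t i j a')) • tv (t i) j (t i0 j) = 0 := by
      funext p
      have e1 := congrFun hc (Function.update p j a)
      have e2 := congrFun hc (Function.update p j a')
      simp only [Finset.sum_apply, Pi.smul_apply, smul_eq_mul, seg_update] at e1 e2
      simp only [Finset.sum_apply, Pi.smul_apply, smul_eq_mul, tv_apply, Pi.zero_apply]
      have e3 : ∑ i, c i * (y j a' * t i j a - y j a * t i j a') *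
          (∏ i' ∈ Finset.univ.erase j, t i i' (p i')) = 0 := by
        have : ∑ i, c i * (y j a' * t i j a - y j a * t i j a') *
          (∏ i' ∈ Finset.univ.erase j, t i i' (p i')) =
          y j a' * (∑ i, c i * (t i j a * ∏ i' ∈ Finset.univ.erase j, t i i' (p i'))) -
          y j a * (∑ i, c i * (t i j a' * ∏ i' ∈ Finset.univ.erase j, t i i' (p i'))) := by
          rw [Finset.mul_sum, Finset.mul_sum, ← Finset.sum_sub_distrib]
          refine Finset.sum_congr rfl fun i _ => ?_
          ring
        rw [this, ← e1, ← e2]; ring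
      have e4 := congrArg (fun z => t i0 j (p j) * z) e3
      simp only [mul_zero, Finset.mul_sum] at e4
      rw [← e4]
      refine Finset.sum_congr rfl fun i _ => ?_
      ring
    have e1 := indep_of_finrank t h1 _ (fun i => Submodule.smul_mem _ _ (tv_mem _ _ _)) e0 i0
    rw [tv_self, smul_eq_zero] at e1
    rcases e1 with e1 | e1
    · rcases mul_eq_zero.1 e1 with e1 | e1
      · exact absurd e1 hi0
      · exact sub_eq_zero.1 e1
    · exact absurd e1 (seg_ne_zero (ht i0))
  intro p p'
  simp only [seg, ← Finset.prod_mul_distrib]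
  refine Finset.prod_congr rfl fun j _ => ?_
  exact key j (p' j) (p j)

/-- tangency at a generic point -/
theorem tang_generic (hG : Good t) (hk : 1 ≤ k) (hs : 1 ≤ s) (ht : ∀ i j, t i j ≠ 0)
    (hD : ∀ δ : Fin k → Fin (s+1) → Fin (m+1) → L, ∃ D : Derivation F L L,
      ∀ i j a, D (t i j a) = δ i j a)
    (y : Fin (s+1) → Fin (m+1) → L) (hy : Tsp y ≤ ⨆ i, Tsp (t i)) :
    ∃ i, ∀ p p', seg y p * seg (t i) p' = seg y p' * seg (t i) p := by
  obtain ⟨c, hc⟩ := step1 hG hk hs ht hD y hy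
  exact step2 (hG.finrank hk ht).1 hk ht y c hc

/-- identifiability at a generic point -/
theorem ident_generic (hG : Good t) (hk : 1 ≤ k) (hs : 1 ≤ s) (ht : ∀ i j, t i j ≠ 0)
    (hD : ∀ δ : Fin k → Fin (s+1) → Fin (m+1) → L, ∃ D : Derivation F L L,
      ∀ i j a, D (t i j a) = δ i j a)
    (b : Fin k → Fin (s+1) → Fin (m+1) → L) (hb : ∑ i, seg (b i) = ∑ i, seg (t i)) (i1 : Fin k) :
    ∃ i, ∀ p p', seg (b i1) p * seg (t i) p' = seg (b i1) p' * seg (t i) p := by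
  have h1 := (hG.finrank hk ht).1
  have hle : (⨆ i, Tsp (t i)) ≤ ⨆ i, Tsp (b i) := by
    refine iSup_le fun i0 v hv => ?_
    obtain ⟨w, rfl⟩ := mem_Tsp.1 hv
    obtain ⟨D, hD⟩ := hD (Function.update 0 i0 w)
    have e1 : ∑ j, tv (t i0) j (w j) = ∑ i, ∑ j, tv (b i) j (fun a => D (b i j a)) := by
      funext p
      have := congrArg D (congrFun hb p)
      simp only [Finset.sum_apply, map_sum] at this
      simp only [der_seg] at this
      have e : (∑ i, ∑ j, tv (b i) j (fun a => D (b i j a))) p =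
        ∑ x, (∑ j, tv (b x) j (fun a => D (b x j a))) p := Finset.sum_apply ..
      rw [e, this, Finset.sum_eq_single i0]
      · simp only [hD]; simp
      · intro i _ hi
        simp only [hD, Function.update_of_ne hi]
        simp only [Finset.sum_apply]
        refine Finset.sum_eq_zero fun j _ => ?_
        have : (fun a => (0 : Fin k → Fin (s+1) → Fin (m+1) → L) i j a) = 0 := rfl
        rw [this, ← tvL_apply, map_zero]; rfl
      · simp
    rw [e1]
    refine Submodule.sum_mem _ fun i _ => Submodule.sum_mem _ fun j _ => ?_
    exact (le_iSup (fun i => Tsp (b i)) i) (tv_mem _ _ _)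
  have heq := Submodule.eq_of_le_of_finrank_le hle ((finrank_iSup_Tsp_le b).trans h1)
  apply tang_generic hG hk hs ht hD
  rw [heq]
  exact le_iSup (fun i => Tsp (b i)) i1

end gen

theorem hD_upt {F : Type u} [Field F] [CharZero F] {N : Type} {s q : ℕ}
    (δ : N → Fin s → Fin q → Uni F (N × Fin s × Fin q)) :
    ∃ D : Derivation F (Uni F (N × Fin s × Fin q)) (Uni F (N × Fin s × Fin q)),
      ∀ i j a, D (pt (upt F (N × Fin s × Fin q)) i j a) = δ i j a := by
  obtain ⟨D, hD⟩ := exists_der (unpt δ)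
  exact ⟨D, fun i j a => hD _⟩

theorem upt_ne {F : Type u} [Field F] {N : Type} {s q : ℕ} (i : N) (j : Fin s) :
    pt (upt F (N × Fin s × Fin (q+1))) i j ≠ 0 := by
  intro h
  have := congrFun h 0
  simp only [pt, upt, Pi.zero_apply] at this
  have := Uni_inj (this.trans (map_zero _).symm)
  exact X_ne_zero _ this

end

section
theorem spread {F : Type u} [Field F] {σ τ : Type} [Finite τ]
    (S : Set (MvPolynomial τ (MvPolynomial σ F)))
    (h : ¬ ∃ b : τ → Uni F σ, ∀ g ∈ S, aeval b g = 0) :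
    ∃ G : MvPolynomial σ F, G ≠ 0 ∧ ∀ a : σ → F, eval a G ≠ 0 →
      ¬ ∃ b : τ → F, ∀ g ∈ S, eval₂ (eval a) b g = 0 := by
  classical
  let F0 := FractionRing (MvPolynomial σ F)
  letI : Algebra (MvPolynomial τ (MvPolynomial σ F)) (MvPolynomial τ F0) :=
    MvPolynomial.algebraMvPolynomial
  let J := Ideal.span S
  by_cases hJ : J.map (algebraMap (MvPolynomial τ (MvPolynomial σ F)) (MvPolynomial τ F0)) = ⊤
  · have h1 := (IsLocalization.map_algebraMap_ne_top_iff_disjoint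
      ((nonZeroDivisors (MvPolynomial σ F)).map (C (σ := τ))) (S := MvPolynomial τ F0) J).not.1
      (by simpa using hJ)
    rw [Set.not_disjoint_iff] at h1
    obtain ⟨x, hx, hxJ⟩ := h1
    obtain ⟨G, hG, rfl⟩ := hx
    refine ⟨G, nonZeroDivisors.ne_zero hG, fun a ha => ?_⟩
    rintro ⟨b, hb⟩
    apply ha
    have h2 : J ≤ RingHom.ker (eval₂Hom (eval a) b) := Ideal.span_le.2 fun g hg => hb g hg
    have h3 := h2 hxJ
    simpa using h3
  · exfalso
    apply h
    obtain ⟨M, hM, hJM⟩ := Ideal.exists_le_maximal _ hJ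
    obtain ⟨b, hb⟩ := eq_vanishingIdeal_singleton_of_isMaximal (Uni F σ) hM
    refine ⟨b, fun g hg => ?_⟩
    have h1 : algebraMap (MvPolynomial τ (MvPolynomial σ F)) (MvPolynomial τ F0) g ∈ M :=
      hJM (Ideal.mem_map_of_mem _ (Ideal.subset_span hg))
    rw [hb, mem_vanishingIdeal_singleton_iff] at h1
    rw [← h1, MvPolynomial.algebraMap_def, aeval_map_algebraMap]

theorem spread' {F : Type u} [Field F] {σ τ P N : Type} [Finite τ] [Finite P] [Finite N]
    (S : Set (MvPolynomial τ (MvPolynomial σ F))) (M : N → P → MvPolynomial τ (MvPolynomial σ F))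
    (h : ∀ b : τ → Uni F σ, (∀ g ∈ S, aeval b g = 0) → ∃ i, ∀ p, aeval b (M i p) = 0) :
    ∃ G : MvPolynomial σ F, G ≠ 0 ∧ ∀ a : σ → F, eval a G ≠ 0 →
      ∀ b : τ → F, (∀ g ∈ S, eval₂ (eval a) b g = 0) →
        ∃ i, ∀ p, eval₂ (eval a) b (M i p) = 0 := by
  classical
  have key : ∀ sel : N → P, ∃ G : MvPolynomial σ F, G ≠ 0 ∧ ∀ a : σ → F, eval a G ≠ 0 →
      ∀ b : τ → F, (∀ g ∈ S, eval₂ (eval a) b g = 0) →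
        ∃ i, eval₂ (eval a) b (M i (sel i)) = 0 := by
    intro sel
    obtain ⟨G, hG, hG2⟩ := spread (F := F) (σ := σ) (τ := τ ⊕ N)
      ((rename Sum.inl '' S) ∪ Set.range fun i => X (Sum.inr i) * rename Sum.inl (M i (sel i)) - 1)
      (by
        rintro ⟨b, hb⟩
        obtain ⟨i, hi⟩ := h (fun c => b (Sum.inl c)) (fun g hg => by
          have := hb _ (Or.inl ⟨g, hg, rfl⟩)
          rw [aeval_rename] at this
          exact this)
        have := hb _ (Or.inr ⟨i, rfl⟩)
        simp only [map_sub, map_mul, aeval_X, aeval_rename, map_one] at this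
        have h2 : aeval (b ∘ Sum.inl) (M i (sel i)) = 0 := hi (sel i)
        rw [h2, mul_zero, zero_sub] at this
        exact one_ne_zero (neg_eq_zero.1 this))
    refine ⟨G, hG, fun a ha b hb => ?_⟩
    by_contra! hne
    refine hG2 a ha ⟨Sum.elim b fun i => (eval₂ (eval a) b (M i (sel i)))⁻¹, ?_⟩
    rintro g (⟨g, hg, rfl⟩ | ⟨i, rfl⟩)
    · rw [eval₂_rename]; exact hb g hg
    · beta_reduce
      rw [eval₂_sub, eval₂_mul, eval₂_X, eval₂_rename, eval₂_one]
      simp [hne i]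
  choose G hG hG2 using key
  have : Fintype (N → P) := Fintype.ofFinite _
  refine ⟨∏ sel, G sel, Finset.prod_ne_zero_iff.2 fun sel _ => hG sel, fun a ha b hb => ?_⟩
  by_contra! hne
  choose sel hsel using hne
  rw [map_prod, Finset.prod_ne_zero_iff] at ha
  obtain ⟨i, hi⟩ := hG2 sel a (ha sel (Finset.mem_univ _)) b hb
  exact hsel i hi

/-- parallel vectors -/
def Par {R P : Type*} [CommRing R] (x y : P → R) : Prop := ∀ p p', x p * y p' = x p' * y p

section
variable {F : Type u} [Field F] [CharZero F] {m s k : ℕ}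

theorem tang_spread (hC : CERT F m s k) (hk : 1 ≤ k) (hs : 1 ≤ s) :
    ∃ G : MvPolynomial (Fin k × Fin (s+1) × Fin (m+1)) F, G ≠ 0 ∧ ∀ a, eval a G ≠ 0 →
      ∀ y : Fin (s+1) → Fin (m+1) → F, Tsp y ≤ (⨆ i, Tsp (pt a i)) →
        ∃ i, Par (seg y) (seg (pt a i)) := by
  obtain ⟨G0, hG0, hGood⟩ := Good_generic.{u, u} hC
  let J := Fin (s+1) × Fin (m+1)
  let σ := Fin k × Fin (s+1) × Fin (m+1)
  let τ := J ⊕ J × Fin k × Fin (s+1) × Fin (m+1)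
  let R := MvPolynomial τ (MvPolynomial σ F)
  let A : Fin k → Fin (s+1) → Fin (m+1) → R := fun i j b => C (X (i, j, b))
  let Y : Fin (s+1) → Fin (m+1) → R := fun j b => X (Sum.inl (j, b))
  let W : J → Fin k → Fin (s+1) → Fin (m+1) → R := fun c i j b => X (Sum.inr (c, i, j, b))
  obtain ⟨G, hG, hG2⟩ := spread' (F := F) (σ := σ) (τ := τ)
    (P := (Fin (s+1) → Fin (m+1)) × (Fin (s+1) → Fin (m+1))) (N := Fin k)
    (Set.range fun (cp : J × (Fin (s+1) → Fin (m+1))) =>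
      tb Y cp.1 cp.2 - ∑ i, ∑ j, tv (A i) j (W cp.1 i j) cp.2)
    (fun i pp => seg Y pp.1 * seg (A i) pp.2 - seg Y pp.2 * seg (A i) pp.1) (by
      intro b hb
      let y : Fin (s+1) → Fin (m+1) → Uni F σ := fun j a => b (Sum.inl (j, a))
      have hA : ∀ i, (fun j a => (aeval b : R →ₐ[MvPolynomial σ F] _).toRingHom (A i j a)) =
          pt (upt F σ) i := by
        intro i; funext j a
        exact aeval_C _ _
      have hY : (fun j a => (aeval b : R →ₐ[MvPolynomial σ F] _).toRingHom (Y j a)) = y := by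
        funext j a
        exact aeval_X _ _
      have hy : Tsp y ≤ ⨆ i, Tsp (pt (upt F σ) i) := by
        refine Submodule.span_le.2 ?_
        rintro _ ⟨c, rfl⟩
        have : tb y c = ∑ i, ∑ j, tv (pt (upt F σ) i) j (fun a => b (Sum.inr (c, i, j, a))) := by
          funext p
          have h1 := hb _ ⟨(c, p), rfl⟩
          simp only [map_sub, map_sum] at h1
          have h2 := tb_map (aeval b : R →ₐ[MvPolynomial σ F] _).toRingHom Y c p
          rw [hY] at h2
          have h3 := fun i j => tv_map (aeval b : R →ₐ[MvPolynomial σ F] _).toRingHom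
            (A i) j (W c i j) p
          simp only [hA] at h3
          have h3' : ∀ i j, aeval b (tv (A i) j (W c i j) p) =
            tv (pt (upt F σ) i) j (fun a => b (Sum.inr (c, i, j, a))) p := by
            intro i j
            refine (h3 i j).trans ?_
            congr 1
            funext x; exact aeval_X _ _
          simp only [h3'] at h1
          rw [← h2]
          simp only [Finset.sum_apply]
          exact sub_eq_zero.1 h1
        rw [this]
        exact Submodule.sum_mem _ fun i _ => Submodule.sum_mem _ fun j _ =>
          (le_iSup (fun i => Tsp (pt (upt F σ) i)) i) (tv_mem _ _ _)
      obtain ⟨i, hi⟩ := tang_generic (F := F) (hGood (Uni F σ) (upt F σ) (aeval_upt_ne hG0)) hk hs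
        (fun i j => upt_ne i j) (fun δ => hD_upt δ) y hy
      refine ⟨i, fun pp => ?_⟩
      have h2 := fun p => seg_map (aeval b : R →ₐ[MvPolynomial σ F] _).toRingHom Y p
      rw [hY] at h2
      have h3 := fun p => seg_map (aeval b : R →ₐ[MvPolynomial σ F] _).toRingHom (A i) p
      rw [hA] at h3
      rw [map_sub, map_mul, map_mul, sub_eq_zero]
      have h4 := hi pp.1 pp.2
      rw [← h2, ← h2, ← h3, ← h3] at h4
      exact h4)
  refine ⟨G, hG, fun a ha y hy => ?_⟩
  have hw : ∀ c, ∃ w : Fin k → Fin (s+1) → Fin (m+1) → F,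
      tb y c = ∑ i, ∑ j, tv (pt a i) j (w i j) := fun c => mem_iSup_Tsp (hy (tb_mem y c))
  choose w hw using hw
  let b : τ → F := Sum.elim (fun c => y c.1 c.2) (fun c => w c.1 c.2.1 c.2.2.1 c.2.2.2)
  let e : R →+* F := eval₂Hom (eval a) b
  have hA : ∀ i, (fun j a => e (A i j a)) = pt a i := by
    intro i; funext j c
    exact (eval₂_C _ _ _).trans (eval_X _)
  have hY : (fun j a => e (Y j a)) = y := by
    funext j c
    exact eval₂_X _ _ _
  obtain ⟨i, hi⟩ := hG2 a ha b (by
    rintro _ ⟨⟨c, p⟩, rfl⟩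
    change e (tb Y c p - ∑ i, ∑ j, tv (A i) j (W c i j) p) = 0
    simp only [map_sub, map_sum, tb_map, tv_map]
    have hW : ∀ i j, (fun a => e (W c i j a)) = w c i j := by
      intro i j; funext x; exact eval₂_X _ _ _
    simp only [hA, hY, hW]
    rw [hw c]; simp only [Finset.sum_apply, sub_self])
  refine ⟨i, fun p p' => ?_⟩
  have h1 : e (seg Y p * seg (A i) p' - seg Y p' * seg (A i) p) = 0 := hi (p, p')
  simp only [map_sub, map_mul, seg_map, hA, hY] at h1
  exact sub_eq_zero.1 h1

theorem ident_spread (hC : CERT F m s k) (hk : 1 ≤ k) (hs : 1 ≤ s) (i1 : Fin k) :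
    ∃ G : MvPolynomial (Fin k × Fin (s+1) × Fin (m+1)) F, G ≠ 0 ∧ ∀ a, eval a G ≠ 0 →
      ∀ y : Fin k → Fin (s+1) → Fin (m+1) → F, ∑ i, seg (y i) = ∑ i, seg (pt a i) →
        ∃ i, Par (seg (y i1)) (seg (pt a i)) := by
  obtain ⟨G0, hG0, hGood⟩ := Good_generic.{u, u} hC
  let σ := Fin k × Fin (s+1) × Fin (m+1)
  let R := MvPolynomial σ (MvPolynomial σ F)
  let A : Fin k → Fin (s+1) → Fin (m+1) → R := fun i j b => C (X (i, j, b))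
  let Y : Fin k → Fin (s+1) → Fin (m+1) → R := fun i j b => X (i, j, b)
  obtain ⟨G, hG, hG2⟩ := spread' (F := F) (σ := σ) (τ := σ)
    (P := (Fin (s+1) → Fin (m+1)) × (Fin (s+1) → Fin (m+1))) (N := Fin k)
    (Set.range fun (p : Fin (s+1) → Fin (m+1)) => ∑ i, seg (Y i) p - ∑ i, seg (A i) p)
    (fun i pp => seg (Y i1) pp.1 * seg (A i) pp.2 - seg (Y i1) pp.2 * seg (A i) pp.1) (by
      intro b hb
      let e : R →+* Uni F σ := (aeval b : R →ₐ[MvPolynomial σ F] _).toRingHom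
      have hA : ∀ i, (fun j a => e (A i j a)) = pt (upt F σ) i := by
        intro i; funext j a
        exact aeval_C _ _
      have hY : ∀ i, (fun j a => e (Y i j a)) = pt b i := by
        intro i; funext j a
        exact aeval_X _ _
      obtain ⟨i, hi⟩ := ident_generic (F := F) (hGood (Uni F σ) (upt F σ) (aeval_upt_ne hG0)) hk hs
        (fun i j => upt_ne i j) (fun δ => hD_upt δ) (pt b) (by
          funext p
          have h1 : e (∑ i, seg (Y i) p - ∑ i, seg (A i) p) = 0 := hb _ ⟨p, rfl⟩
          simp only [map_sub, map_sum, seg_map, hA, hY] at h1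
          simp only [Finset.sum_apply]
          exact sub_eq_zero.1 h1) i1
      refine ⟨i, fun pp => ?_⟩
      change e (seg (Y i1) pp.1 * seg (A i) pp.2 - seg (Y i1) pp.2 * seg (A i) pp.1) = 0
      simp only [map_sub, map_mul, seg_map, hA, hY]
      exact sub_eq_zero.2 (hi _ _))
  refine ⟨G, hG, fun a ha y hy => ?_⟩
  let e : R →+* F := eval₂Hom (eval a) (unpt y)
  have hA : ∀ i, (fun j a => e (A i j a)) = pt a i := by
    intro i; funext j c
    exact (eval₂_C _ _ _).trans (eval_X _)
  have hY : ∀ i, (fun j a => e (Y i j a)) = y i := by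
    intro i; funext j c
    exact eval₂_X _ _ _
  obtain ⟨i, hi⟩ := hG2 a ha (unpt y) (by
    rintro _ ⟨p, rfl⟩
    change e (∑ i, seg (Y i) p - ∑ i, seg (A i) p) = 0
    simp only [map_sub, map_sum, seg_map, hA, hY]
    have := congrFun hy p
    simp only [Finset.sum_apply] at this
    exact sub_eq_zero.2 this)
  refine ⟨i, fun p p' => ?_⟩
  have h1 : e (seg (Y i1) p * seg (A i) p' - seg (Y i1) p' * seg (A i) p) = 0 := hi (p, p')
  simp only [map_sub, map_mul, seg_map, hA, hY] at h1
  exact sub_eq_zero.1 h1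

/-- the package of generic properties -/
structure Pkg (t : Fin k → Fin (s+1) → Fin (m+1) → F) : Prop where
  ne : ∀ i j, t i j ≠ 0
  li : ∀ v : Fin k → (Fin (s+1) → Fin (m+1)) → F, (∀ i, v i ∈ Tsp (t i)) → ∑ i, v i = 0 →
    ∀ i, v i = 0
  tang : ∀ y : Fin (s+1) → Fin (m+1) → F, Tsp y ≤ (⨆ i, Tsp (t i)) →
        ∃ i, Par (seg y) (seg (t i))
  ident : ∀ y : Fin k → Fin (s+1) → Fin (m+1) → F, ∑ i, seg (y i) = ∑ i, seg (t i) →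
        ∀ i1, ∃ i, Par (seg (y i1)) (seg (t i))

theorem Pkg_generic (hC : CERT F m s k) (hk : 1 ≤ k) (hs : 1 ≤ s) :
    ∃ G : MvPolynomial (Fin k × Fin (s+1) × Fin (m+1)) F, G ≠ 0 ∧ ∀ a, eval a G ≠ 0 →
      Pkg (pt a) := by
  obtain ⟨G0, hG0, h0⟩ := Good_generic.{u, u} hC
  obtain ⟨G1, hG1, h1⟩ := tang_spread hC hk hs
  choose G2 hG2 h2 using fun i1 => ident_spread hC hk hs i1
  refine ⟨G0 * G1 * (∏ i, G2 i) * ∏ c, X c, ?_, fun a ha => ?_⟩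
  · refine mul_ne_zero (mul_ne_zero (mul_ne_zero hG0 hG1) ?_) ?_
    · exact Finset.prod_ne_zero_iff.2 fun i _ => hG2 i
    · exact Finset.prod_ne_zero_iff.2 fun i _ => X_ne_zero i
  · simp only [map_mul, map_prod, eval_X, mul_ne_zero_iff, Finset.prod_ne_zero_iff] at ha
    obtain ⟨⟨⟨ha0, ha1⟩, ha2⟩, ha3⟩ := ha
    have hne : ∀ i j, pt a i j ≠ 0 := by
      intro i j h
      exact ha3 (i, j, 0) (Finset.mem_univ _) (congrFun h 0)
    have hg : Good (pt a) := h0 F a (by rwa [aeval_eq_eval] )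
    exact ⟨hne, fun v hv h => indep_of_finrank _ (hg.finrank hk hne).1 v hv h, h1 a ha1,
      fun y hy i1 => h2 i1 a (ha2 i1 (Finset.mem_univ _)) y hy⟩
end

end

section
theorem chev {F : Type u} [Field F] [IsAlgClosed F] {σ V : Type} [Finite σ] [Finite V]
    (φ : MvPolynomial V F →ₐ[F] MvPolynomial σ F) (G : MvPolynomial σ F) (hG : G ≠ 0) :
    ∃ g : MvPolynomial V F, φ g ≠ 0 ∧ ∀ v : V → F, (∀ f, φ f = 0 → eval v f = 0) → eval v g ≠ 0 →
      ∃ a : σ → F, eval a G ≠ 0 ∧ ∀ p, eval a (φ (X p)) = v p := by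
  classical
  have : Fintype σ := Fintype.ofFinite _
  have : Fintype V := Fintype.ofFinite _
  have hfp : φ.toRingHom.FinitePresentation := by
    refine RingHom.FinitePresentation.of_finiteType.1 ?_
    have h1 : AlgHom.FiniteType (φ.comp (Algebra.ofId F (MvPolynomial V F))) := by
      have : φ.comp (Algebra.ofId F (MvPolynomial V F)) = Algebra.ofId F _ := by
        exact Subsingleton.elim _ _
      rw [this]
      exact (RingHom.finiteType_algebraMap (A := F) (B := MvPolynomial σ F)).2 inferInstance
    exact AlgHom.FiniteType.of_comp_finiteType h1
  have hc := PrimeSpectrum.isConstructible_comap_image hfp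
    (PrimeSpectrum.isConstructible_basicOpen (f := G))
  obtain ⟨S, hS⟩ := PrimeSpectrum.exists_constructibleSetData_iff.2 hc
  have hη : PrimeSpectrum.comap φ.toRingHom (⊥ : PrimeSpectrum (MvPolynomial σ F)) ∈ S.toSet := by
    rw [hS]
    exact ⟨⊥, by simpa using hG, rfl⟩
  simp only [PrimeSpectrum.ConstructibleSetData.toSet, Set.mem_iUnion] at hη
  obtain ⟨D, hD, hη⟩ := hη
  obtain ⟨h1, h2⟩ := hη
  refine ⟨D.f, ?_, fun v hv hg => ?_⟩
  · intro h
    apply h2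
    simp only [PrimeSpectrum.mem_zeroLocus, Set.singleton_subset_iff]
    exact h
  · let mv : PrimeSpectrum (MvPolynomial V F) := ⟨MvPolynomial.vanishingIdeal F {v}, inferInstance⟩
    have hmv : mv ∈ S.toSet := by
      simp only [PrimeSpectrum.ConstructibleSetData.toSet, Set.mem_iUnion]
      refine ⟨D, hD, ?_, ?_⟩
      · rintro _ ⟨i, rfl⟩
        have h3 : φ (D.g i) = 0 := h1 ⟨i, rfl⟩
        exact (mem_vanishingIdeal_singleton_iff _ _).2 (by
          rw [aeval_eq_eval]; exact hv _ h3)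
      · intro h
        have h3 : D.f ∈ MvPolynomial.vanishingIdeal F {v} := h rfl
        rw [mem_vanishingIdeal_singleton_iff, aeval_eq_eval] at h3
        exact hg h3
    rw [hS] at hmv
    obtain ⟨Q, hQ, hQv⟩ := hmv
    have hQv' : ∀ f, φ f ∈ Q.asIdeal ↔ eval v f = 0 := by
      intro f
      have h3 : f ∈ (PrimeSpectrum.comap φ.toRingHom Q).asIdeal ↔ f ∈ mv.asIdeal := by rw [hQv]
      rw [PrimeSpectrum.comap_asIdeal, Ideal.mem_comap] at h3
      refine h3.trans ?_
      refine (mem_vanishingIdeal_singleton_iff _ _).trans ?_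
      rw [aeval_eq_eval]
    have hex : ∃ a ∈ MvPolynomial.zeroLocus F Q.asIdeal, eval a G ≠ 0 := by
      by_contra! h
      have hGQ : G ∈ MvPolynomial.vanishingIdeal F (MvPolynomial.zeroLocus F Q.asIdeal) := by
        intro a ha
        have := h a ha
        rwa [aeval_eq_eval]
      rw [MvPolynomial.IsPrime.vanishingIdeal_zeroLocus] at hGQ
      exact hQ hGQ
    obtain ⟨a, ha, haG⟩ := hex
    refine ⟨a, haG, fun p => ?_⟩
    have h3 := ha _ ((hQv' (X p - C (v p))).2 (by simp))
    have h4 : φ (C (v p)) = C (v p) := φ.commutes (v p)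
    rw [map_sub, map_sub, sub_eq_zero, aeval_eq_eval, h4] at h3
    simpa using h3

theorem deriv_aeval {F P : Type*} [Field F] [Fintype P] (f : MvPolynomial P F)
    (g : P → Polynomial F) : Polynomial.derivative (aeval g f) =
      ∑ p, aeval g (pderiv p f) * Polynomial.derivative (g p) := by
  classical
  induction f using MvPolynomial.induction_on with
  | C a => simp [algebraMap_eq]
  | add p q hp hq =>
    simp only [map_add, hp, hq, add_mul, Finset.sum_add_distrib]
  | mul_X p n hp =>
    have key : ∀ i, aeval g (pderiv i (p * X n)) * Polynomial.derivative (g i) =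
        aeval g (pderiv i p) * Polynomial.derivative (g i) * g n +
          (if i = n then aeval g p * Polynomial.derivative (g n) else 0) := by
      intro i
      rw [pderiv_mul, map_add, map_mul, map_mul, aeval_X]
      split_ifs with h
      · subst h
        rw [pderiv_X_self, map_one]; ring
      · rw [pderiv_X_of_ne (Ne.symm h), map_zero]; ring
    rw [Finset.sum_congr rfl fun i _ => key i, Finset.sum_add_distrib, ← Finset.sum_mul, ← hp,
      Finset.sum_ite_eq' Finset.univ n, if_pos (Finset.mem_univ _), map_mul, aeval_X,
      Polynomial.derivative_mul]

/-- directional derivative of a polynomial vanishing along a line -/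
theorem dir_deriv {F P : Type*} [Field F] [Infinite F] [Fintype P] (f : MvPolynomial P F)
    (x v : P → F) (h : ∀ c : F, eval (x + c • v) f = 0) :
    ∑ p, v p * eval x (pderiv p f) = 0 := by
  let g : P → Polynomial F := fun p => Polynomial.C (x p) + Polynomial.X * Polynomial.C (v p)
  have he : ∀ (c : F) (q : MvPolynomial P F), Polynomial.eval c (aeval g q) = eval (x + c • v) q := by
    intro c q
    induction q using MvPolynomial.induction_on with
    | C a => simp
    | add p q hp hq => simp [hp, hq]
    | mul_X p n hp =>
      rw [map_mul, Polynomial.eval_mul, hp, aeval_X, map_mul, eval_X]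
      have h5 : Polynomial.eval c (g n) = (x + c • v) n := by simp [g]; ring
      rw [h5]
  have h0 : aeval g f = 0 := by
    apply Polynomial.funext
    intro c
    rw [he, h]; simp
  have h1 := deriv_aeval f g
  rw [h0] at h1
  have h2 := congrArg (Polynomial.eval 0) h1
  simp only [Polynomial.derivative_zero, Polynomial.eval_zero, Polynomial.eval_finsetSum,
    Polynomial.eval_mul, he] at h2
  rw [h2]
  refine Finset.sum_congr rfl fun p _ => ?_
  have : Polynomial.eval 0 (Polynomial.derivative (g p)) = v p := by simp [g]
  rw [this, zero_smul, add_zero, mul_comm]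

end

section
/-- Segre variety with equal factors -/
abbrev SV (F : Type*) [Field F] (s m : ℕ) : Set (PP F (Fin s → Fin (m+1))) :=
  segreVariety F s (fun _ => m)

theorem mem_SV {F : Type*} [Field F] {s m : ℕ} {x : PP F (Fin s → Fin (m+1))} :
    x ∈ SV F s m ↔ ∃ u : Fin s → Fin (m+1) → F, x.submodule = Submodule.span F {seg u} := Iff.rfl

theorem mem_sub {F P : Type*} [Field F] {x : PP F P} {v : P → F} :
    v ∈ x.submodule ↔ ∃ c : F, c • x.rep = v := by
  rw [Projectivization.submodule_eq, Submodule.mem_span_singleton]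

theorem smul_seg {F : Type*} [Field F] {s q : ℕ} (u : Fin (s+1) → Fin q → F) (c : F) :
    ∃ u' : Fin (s+1) → Fin q → F, c • seg u = seg u' := by
  refine ⟨Function.update u 0 (c • u 0), ?_⟩
  have := tv_smul u 0 c (u 0)
  rw [tv_self] at this
  rw [← this]; rfl

theorem SV_mem {F : Type*} [Field F] {s m : ℕ} {x : PP F (Fin (s+1) → Fin (m+1))}
    (hx : x ∈ SV F (s+1) m) {v} (hv : v ∈ x.submodule) :
    ∃ u : Fin (s+1) → Fin (m+1) → F, v = seg u := by
  obtain ⟨u, hu⟩ := mem_SV.1 hx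
  rw [hu, Submodule.mem_span_singleton] at hv
  obtain ⟨c, rfl⟩ := hv
  exact smul_seg u c

theorem rep_mem {F P : Type*} [Field F] (x : PP F P) : x.rep ∈ x.submodule :=
  mem_sub.2 ⟨1, one_smul _ _⟩

theorem SV_rep {F : Type*} [Field F] {s m : ℕ} {x : PP F (Fin (s+1) → Fin (m+1))}
    (hx : x ∈ SV F (s+1) m) : ∃ u : Fin (s+1) → Fin (m+1) → F, x.rep = seg u :=
  SV_mem hx (rep_mem x)

theorem mk_mem_SV {F : Type*} [Field F] {s m : ℕ} (u : Fin s → Fin (m+1) → F) (h : seg u ≠ 0) :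
    (Projectivization.mk F (seg u) h : PP F (Fin s → Fin (m+1))) ∈ SV F s m :=
  mem_SV.2 ⟨u, Projectivization.submodule_mk _ _⟩

theorem seg_mk_mem {F P : Type*} [Field F] (v : P → F) (h : v ≠ 0) :
    v ∈ (Projectivization.mk F v h : PP F P).submodule := by
  rw [Projectivization.submodule_mk]; exact Submodule.mem_span_singleton_self v

theorem van_seg {F : Type*} [Field F] {s m : ℕ} {f} (hf : f ∈ homogVanishingIdeal (SV F s m))
    (u : Fin s → Fin (m+1) → F) : eval (seg u) f = 0 := by
  by_cases h : seg u = 0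
  · have h1 : seg (fun (j : Fin s) => (Pi.single ((fun _ => 0) j) 1 : Fin (m+1) → F)) ≠ 0 := by
      rw [seg_single]
      intro h
      have := congrFun h (fun _ => 0)
      simp at this
    rw [h]
    exact hf.2 _ (mk_mem_SV _ h1) 0 (Submodule.zero_mem _)
  · exact hf.2 _ (mk_mem_SV _ h) _ (seg_mk_mem _ _)

theorem tan_sup {F : Type*} [Field F] [Infinite F] {s m : ℕ} {f}
    (hf : f ∈ homogVanishingIdeal (SV F s m))
    (u : Fin s → Fin (m+1) → F) {v} (hv : v ∈ Tsp u) :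
    ∑ p, v p * eval (seg u) (pderiv p f) = 0 := by
  obtain ⟨w, rfl⟩ := mem_Tsp.1 hv
  simp only [Finset.sum_apply, Finset.sum_mul]
  rw [Finset.sum_comm]
  refine Finset.sum_eq_zero fun j _ => ?_
  apply dir_deriv
  intro c
  have : seg u + c • tv u j (w j) = seg (Function.update u j (c • w j + u j)) := by
    have h1 := tv_smul_add u j c (w j) (u j)
    rw [tv_self] at h1
    exact (add_comm (seg u) _).trans h1.symm
  rw [this]
  exact van_seg hf _

theorem pderiv_XX {F P : Type*} [Field F] [Fintype P] (p q : P) (v x : P → F) :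
    ∑ r, v r * eval x (pderiv r (X p * X q)) = v p * x q + x p * v q := by
  classical
  have h1 : ∀ r, v r * eval x (pderiv r (X p * X q : MvPolynomial P F)) =
      (if r = p then v p * x q else 0) + (if r = q then x p * v q else 0) := by
    intro r
    rw [pderiv_mul]
    simp only [pderiv_X, map_add, map_mul, eval_X]
    have h2 : ∀ p : P, eval x (Pi.single (M := fun _ => MvPolynomial P F) r 1 p) = if r = p then 1 else 0 := by
      intro p
      by_cases h : r = p
      · subst h; simp
      · rw [Pi.single_eq_of_ne (Ne.symm h)]; simp [h]
    have h3 : ∀ p : P, eval x (Pi.single (M := fun _ => MvPolynomial P F) p 1 r) = if r = p then 1 else 0 := by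
      intro p
      by_cases h : r = p
      · subst h; simp
      · rw [Pi.single_eq_of_ne h]; simp [h]
    simp only [h2, h3]
    split_ifs <;> subst_vars <;> ring
  simp only [h1, Finset.sum_add_distrib, Finset.sum_ite_eq', Finset.mem_univ, if_true]

theorem quad_mem {F : Type*} [Field F] {s m : ℕ} (p q : Fin (s+1) → Fin (m+1)) (j : Fin (s+1)) :
    (X p * X q - X (Function.update p j (q j)) * X (Function.update q j (p j)) :
      MvPolynomial (Fin (s+1) → Fin (m+1)) F) ∈ homogVanishingIdeal (SV F (s+1) m) := by
  refine ⟨⟨2, ?_⟩, ?_⟩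
  · exact ((isHomogeneous_X _ _).mul (isHomogeneous_X _ _)).sub
      ((isHomogeneous_X _ _).mul (isHomogeneous_X _ _))
  · intro x hx v hv
    obtain ⟨u, rfl⟩ := SV_mem hx hv
    simp only [map_sub, map_mul, eval_X, seg, ← Finset.prod_mul_distrib]
    rw [sub_eq_zero]
    refine Finset.prod_congr rfl fun i _ => ?_
    by_cases h : i = j
    · subst h; simp [mul_comm]
    · simp [h]

theorem tan_sub {F : Type*} [Field F] [Infinite F] {s m : ℕ} (u : Fin (s+1) → Fin (m+1) → F)
    (hu : seg u ≠ 0) (v : (Fin (s+1) → Fin (m+1)) → F)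
    (h : ∀ f ∈ homogVanishingIdeal (SV F (s+1) m), ∑ p, v p * eval (seg u) (pderiv p f) = 0) :
    v ∈ Tsp u := by
  classical
  obtain ⟨p0, hp0⟩ : ∃ p0, seg u p0 ≠ 0 := by
    by_contra! h; exact hu (funext h)
  let c := v p0 / seg u p0
  let π : Fin (s+1) → F := fun j => ∏ i ∈ Finset.univ.erase j, u i (p0 i)
  have hπ : ∀ j, u j (p0 j) * π j = seg u p0 := by
    intro j
    exact Finset.mul_prod_erase Finset.univ (fun i => u i (p0 i)) (Finset.mem_univ j)
  have hπ0 : ∀ j, π j ≠ 0 := fun j h => hp0 (by rw [← hπ j, h, mul_zero])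
  let w : Fin (s+1) → Fin (m+1) → F := fun j a =>
    (v (Function.update p0 j a) - c * u j a * π j) / π j
  have hw0 : ∀ j, w j (p0 j) = 0 := by
    intro j
    simp only [w, Function.update_eq_self, mul_assoc, hπ, c, div_mul_cancel₀ _ hp0, sub_self,
      zero_div]
  let v' := c • seg u + ∑ j, tv u j (w j)
  have hv' : v' ∈ Tsp u := Submodule.add_mem _ (Submodule.smul_mem _ _ (seg_mem u))
    (Submodule.sum_mem _ fun j _ => tv_mem _ _ _)
  let d := v - v'
  have hd : ∀ f ∈ homogVanishingIdeal (SV F (s+1) m),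
      ∑ p, d p * eval (seg u) (pderiv p f) = 0 := by
    intro f hf
    simp only [d, Pi.sub_apply, sub_mul, Finset.sum_sub_distrib]
    rw [h f hf, tan_sup hf u hv', sub_zero]
  have hE : ∀ p q j, d p * seg u q + seg u p * d q =
      d (Function.update p j (q j)) * seg u (Function.update q j (p j)) +
      seg u (Function.update p j (q j)) * d (Function.update q j (p j)) := by
    intro p q j
    have := hd _ (quad_mem p q j)
    simp only [map_sub, mul_sub, Finset.sum_sub_distrib, pderiv_XX] at this
    exact sub_eq_zero.1 this
  have hd1 : ∀ j a, d (Function.update p0 j a) = 0 := by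
    intro j a
    simp only [d, v', Pi.sub_apply, Pi.add_apply, Pi.smul_apply, smul_eq_mul, Finset.sum_apply]
    have h1 : ∀ b : Fin (s+1) → Fin (m+1) → F, ∏ i ∈ Finset.univ.erase j,
        b i (Function.update p0 j a i) = ∏ i ∈ Finset.univ.erase j, b i (p0 i) := by
      intro b
      refine Finset.prod_congr rfl fun i hi => ?_
      rw [Function.update_of_ne (Finset.ne_of_mem_erase hi)]
    have h2 : seg u (Function.update p0 j a) = u j a * π j := by
      unfold seg
      rw [← Finset.mul_prod_erase _ _ (Finset.mem_univ j), h1]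
      simp [π]
    rw [Finset.sum_eq_single j, h2, tv_apply, h1, Function.update_self]
    · change v (Function.update p0 j a) - (c * (u j a * π j) + w j a * π j) = 0
      simp only [w, div_mul_cancel₀ _ (hπ0 j)]
      ring
    · intro i _ hi
      rw [tv_apply, Function.update_of_ne hi, hw0, zero_mul]
    · simp
  have hd0 : d p0 = 0 := by simpa using hd1 0 (p0 0)
  have key : ∀ n : ℕ, ∀ q : Fin (s+1) → Fin (m+1),
      (Finset.univ.filter fun j => q j ≠ p0 j).card = n → d q = 0 := by
    intro n
    induction n with
    | zero =>
      intro q hq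
      have : q = p0 := by
        funext j
        by_contra hj
        have : j ∈ (Finset.univ.filter fun j => q j ≠ p0 j) := by simp [hj]
        rw [Finset.card_eq_zero.1 hq] at this
        simp at this
      rw [this, hd0]
    | succ n ih =>
      intro q hq
      obtain ⟨j, hj⟩ : (Finset.univ.filter fun j => q j ≠ p0 j).Nonempty := by
        rw [← Finset.card_pos]; omega
      have h1 := hE p0 q j
      have h2 : d (Function.update q j (p0 j)) = 0 := by
        apply ih
        have : (Finset.univ.filter fun i => Function.update q j (p0 j) i ≠ p0 i) =
            (Finset.univ.filter fun j => q j ≠ p0 j).erase j := by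
          ext i
          by_cases h : i = j
          · subst h; simp
          · simp [h]
        rw [this, Finset.card_erase_of_mem hj, hq]; rfl
      rw [hd0, hd1, h2, zero_mul, zero_mul, mul_zero, zero_add, zero_add] at h1
      exact (mul_eq_zero.1 h1).resolve_left hp0
  have hz : v = v' := by
    funext q
    have := key _ q rfl
    exact sub_eq_zero.1 this
  rw [hz]
  exact hv'

theorem mem_emb {F : Type*} [Field F] [Infinite F] {s m : ℕ} {x : PP F (Fin (s+1) → Fin (m+1))}
    {u : Fin (s+1) → Fin (m+1) → F} (hx : x.rep = seg u) (y) :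
    y ∈ embTangentSpace (SV F (s+1) m) x ↔ y.rep ∈ Tsp u := by
  constructor
  · intro h
    refine tan_sub u (hx ▸ x.rep_nonzero) _ fun f hf => ?_
    rw [← hx]
    exact h f hf
  · intro h f hf
    rw [hx]
    exact tan_sup hf u h

end

section
theorem homog_smul {F P : Type*} [Field F] {f : MvPolynomial P F} {n : ℕ}
    (hf : f.IsHomogeneous n) (c : F) (v : P → F) : eval (c • v) f = c ^ n * eval v f := by
  rw [eval_eq, eval_eq, Finset.mul_sum]
  refine Finset.sum_congr rfl fun d hd => ?_
  have h1 : d.degree = n := by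
    rw [Finsupp.degree_eq_weight_one]; exact hf (mem_support_iff.1 hd)
  have h2 : ∏ i ∈ d.support, (c • v) i ^ d i = c ^ n * ∏ i ∈ d.support, v i ^ d i := by
    simp only [Pi.smul_apply, smul_eq_mul, mul_pow, Finset.prod_mul_distrib,
      Finset.prod_pow_eq_pow_sum]
    rw [← h1]; rfl
  rw [h2]; ring

theorem homog_zero {F P : Type*} [Field F] {f : MvPolynomial P F} {n : ℕ}
    (hf : f.IsHomogeneous n) {x : PP F P} {v : P → F} (hv : v ∈ x.submodule)
    (h : eval v f ≠ 0) : ∀ w ∈ x.submodule, w ≠ 0 → eval w f ≠ 0 := by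
  intro w hw hw0 h0
  obtain ⟨c, rfl⟩ := mem_sub.1 hv
  obtain ⟨e, rfl⟩ := mem_sub.1 hw
  rw [homog_smul hf] at h h0
  have he : e ≠ 0 := by rintro rfl; simp at hw0
  rcases mul_eq_zero.1 h0 with h1 | h1
  · exact pow_ne_zero _ he h1
  · rw [h1, mul_zero] at h; exact h rfl

theorem closed_union {F P : Type*} [Field F] [Fintype P] {Y Z : Set (PP F P)} (hY : IsZClosed Y)
    (hZ : IsZClosed Z) : IsZClosed (Y ∪ Z) := by
  obtain ⟨S, hS, rfl⟩ := hY
  obtain ⟨T, hT, rfl⟩ := hZ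
  refine ⟨{h | ∃ f ∈ S, ∃ g ∈ T, h = f * g}, ?_, ?_⟩
  · rintro _ ⟨f, hf, g, hg, rfl⟩
    obtain ⟨d, hd⟩ := hS f hf
    obtain ⟨e, he⟩ := hT g hg
    exact ⟨d + e, hd.mul he⟩
  · ext x
    constructor
    · rintro (h | h)
      · rintro _ ⟨f, hf, g, hg, rfl⟩ v hv
        rw [map_mul, h f hf v hv, zero_mul]
      · rintro _ ⟨f, hf, g, hg, rfl⟩ v hv
        rw [map_mul, h g hg v hv, mul_zero]
    · intro h
      by_contra hx
      rw [Set.mem_union, not_or] at hx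
      obtain ⟨h1, h2⟩ := hx
      simp only [zeroLocus, Set.mem_setOf_eq, not_forall] at h1 h2
      obtain ⟨f, hf, v, hv, hfv⟩ := h1
      obtain ⟨g, hg, w, hw, hgw⟩ := h2
      obtain ⟨d, hd⟩ := hS f hf
      obtain ⟨e, he⟩ := hT g hg
      have := h _ ⟨f, hf, g, hg, rfl⟩ x.rep (rep_mem x)
      rw [map_mul] at this
      rcases mul_eq_zero.1 this with h3 | h3
      · exact homog_zero hd hv hfv _ (rep_mem x) x.rep_nonzero h3
      · exact homog_zero he hw hgw _ (rep_mem x) x.rep_nonzero h3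

theorem closed_empty {F P : Type*} [Field F] [Fintype P] : IsZClosed (∅ : Set (PP F P)) := by
  refine ⟨{1}, ?_, ?_⟩
  · rintro _ rfl; exact ⟨0, isHomogeneous_one _ _⟩
  · symm
    rw [Set.eq_empty_iff_forall_notMem]
    intro x hx
    have := hx 1 rfl x.rep (rep_mem x)
    simp at this

theorem Par_span {F P : Type*} [Field F] {x y : P → F} (h : Par x y) (hy : y ≠ 0) :
    ∃ c : F, c • y = x := by
  obtain ⟨p, hp⟩ : ∃ p, y p ≠ 0 := by
    by_contra! h; exact hy (funext h)
  refine ⟨x p / y p, ?_⟩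
  funext q
  have := h q p
  simp only [Pi.smul_apply, smul_eq_mul]
  field_simp
  linear_combination -this

theorem Par_mk {F P : Type*} [Field F] {x y : P → F} (h : Par x y) (hx : x ≠ 0) (hy : y ≠ 0) :
    (Projectivization.mk F x hx) = Projectivization.mk F y hy :=
  (Projectivization.mk_eq_mk_iff' F _ _ hx hy).2 (Par_span h hy)

theorem closed_singleton {F P : Type*} [Field F] [Fintype P] (x : PP F P) :
    IsZClosed ({x} : Set (PP F P)) := by
  refine ⟨Set.range fun pq : P × P => X pq.1 * C (x.rep pq.2) - X pq.2 * C (x.rep pq.1), ?_, ?_⟩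
  · rintro _ ⟨pq, rfl⟩
    refine ⟨1, ?_⟩
    exact ((isHomogeneous_X _ _).mul (isHomogeneous_C _ _)).sub
      ((isHomogeneous_X _ _).mul (isHomogeneous_C _ _))
  · ext y
    constructor
    · rintro rfl _ ⟨⟨p, q⟩, rfl⟩ v hv
      obtain ⟨c, rfl⟩ := mem_sub.1 hv
      simp; ring
    · intro h
      have hp : Par y.rep x.rep := by
        intro p q
        have := h _ ⟨(p, q), rfl⟩ y.rep (rep_mem y)
        simp only [map_sub, map_mul, eval_X, eval_C] at this
        exact sub_eq_zero.1 this
      have := Par_mk hp y.rep_nonzero x.rep_nonzero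
      rw [Projectivization.mk_rep, Projectivization.mk_rep] at this
      exact this

theorem closed_finite {F P : Type*} [Field F] [Fintype P] {A : Set (PP F P)} (hA : A.Finite) :
    IsZClosed A := by
  induction A, hA using Set.Finite.induction_on with
  | empty => exact closed_empty
  | insert _ _ ih =>
    rw [Set.insert_eq]
    exact closed_union (closed_singleton _) ih

theorem irred_finite {F P : Type*} [Field F] [Fintype P] {A Y : Set (PP F P)} (hA : A.Finite)
    (hY : IsZIrreducible Y) (h : Y ⊆ A) : ∃ x, Y ⊆ {x} := by
  induction A, hA using Set.Finite.induction_on with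
  | empty =>
    obtain ⟨x, hx⟩ := hY.1
    exact absurd (h hx) (Set.notMem_empty x)
  | @insert x A _ hA ih =>
    rw [Set.insert_eq] at h
    rcases hY.2 _ _ (closed_singleton x) (closed_finite hA) h with h1 | h1
    · exact ⟨x, h1⟩
    · exact ih h1

theorem zclosure_sub {F P : Type*} [Field F] [Fintype P] {A Y : Set (PP F P)} (hY : IsZClosed Y)
    (h : A ⊆ Y) : zclosure A ⊆ Y := Set.sInter_subset_of_mem ⟨hY, h⟩

theorem sub_zclosure {F P : Type*} [Field F] [Fintype P] (A : Set (PP F P)) :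
    A ⊆ zclosure A := Set.subset_sInter fun _ hY => hY.2

theorem zdim_finite {F P : Type*} [Field F] [Fintype P] {A S : Set (PP F P)} (hA : A.Finite)
    (h : S ⊆ A) : zdim S ≤ 0 := by
  unfold zdim
  rw [Order.krullDim_nonpos_iff_forall_isMax]
  rintro ⟨Y, hY1, hY2, hY3⟩ ⟨Z, hZ1, hZ2, hZ3⟩ hle
  have hle' : Y ⊆ Z := hle
  change Z ⊆ Y
  obtain ⟨x, hx⟩ := irred_finite hA hZ2 (hZ3.trans (zclosure_sub (closed_finite hA) h))
  obtain ⟨y, hy⟩ := hY2.1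
  have h1 : y = x := hx (hle' hy)
  intro z hz
  have h2 : z = x := hx hz
  rw [h2, ← h1]; exact hy

theorem zdim_contact {F P : Type*} [Field F] [Fintype P] {X A : Set (PP F P)} (hA : A.Finite)
    (h : tangencyLocus X A ⊆ A) : zdim (contactLocus X A) ≤ 0 := by
  apply zdim_finite hA
  unfold contactLocus
  apply zclosure_sub (closed_finite hA)
  refine Set.iUnion₂_subset fun C hC => ?_
  exact hC.1.2.1.trans h

theorem rep_mk_seg {F : Type*} [Field F] {s q : ℕ} (u : Fin (s+1) → Fin q → F) (h : seg u ≠ 0) :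
    ∃ u' : Fin (s+1) → Fin q → F, (Projectivization.mk F (seg u) h).rep = seg u' ∧
      Tsp u' ≤ Tsp u := by
  have h1 := rep_mem (Projectivization.mk F (seg u) h)
  rw [Projectivization.submodule_mk, Submodule.mem_span_singleton] at h1
  obtain ⟨c, hc⟩ := h1
  refine ⟨Function.update u 0 (c • u 0), ?_, ?_⟩
  · have := tv_smul u 0 c (u 0)
    rw [tv_self] at this
    rw [← hc, ← this]; rfl
  · refine Submodule.span_le.2 ?_
    rintro _ ⟨⟨j, a⟩, rfl⟩
    by_cases hj : j = 0
    · subst hj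
      have : tb (Function.update u 0 (c • u 0)) (0, a) = tv u 0 (Pi.single a 1) := by
        simp [tb, tv]
      rw [this]; exact tv_mem _ _ _
    · have : tb (Function.update u 0 (c • u 0)) (j, a) = c • tv u j (Pi.single a 1) := by
        funext p
        have h0 : (0 : Fin (s+1)) ∈ Finset.univ.erase j := by simp [Ne.symm hj]
        simp only [tb, tv_apply, Pi.smul_apply, smul_eq_mul]
        rw [← Finset.mul_prod_erase _ _ h0, ← Finset.mul_prod_erase _ _ h0]
        have : ∏ x ∈ (Finset.univ.erase j).erase 0, Function.update u 0 (c • u 0) x (p x) =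
            ∏ x ∈ (Finset.univ.erase j).erase 0, u x (p x) := by
          refine Finset.prod_congr rfl fun i hi => ?_
          rw [Function.update_of_ne (Finset.ne_of_mem_erase hi)]
        rw [this, Function.update_self]
        simp only [Pi.smul_apply, smul_eq_mul]; ring
      rw [this]; exact Submodule.smul_mem _ _ (tv_mem _ _ _)

section
variable {F : Type u} [Field F] [Infinite F] {m s k : ℕ}

theorem tangency_sub {t : Fin k → Fin (s+1) → Fin (m+1) → F} (ht : Pkg t)
    (hne : ∀ i, seg (t i) ≠ 0) :
    tangencyLocus (SV F (s+1) m) (Set.range fun i => Projectivization.mk F (seg (t i)) (hne i)) ⊆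
      Set.range fun i => Projectivization.mk F (seg (t i)) (hne i) := by
  rintro x ⟨⟨hx, -⟩, hx2⟩
  obtain ⟨y, hy⟩ := SV_rep hx
  have hv : vspan (⋃ a ∈ Set.range fun i => Projectivization.mk F (seg (t i)) (hne i),
      embTangentSpace (SV F (s+1) m) a) ≤ ⨆ i, Tsp (t i) := by
    refine Submodule.span_le.2 ?_
    intro w hw
    simp only [coneOf, Set.mem_iUnion] at hw
    obtain ⟨z, ⟨a, ⟨i, rfl⟩, hz⟩, hw⟩ := hw
    obtain ⟨u', h1, h2⟩ := rep_mk_seg (t i) (hne i)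
    have h3 := (mem_emb h1 z).1 hz
    obtain ⟨c, rfl⟩ := mem_sub.1 hw
    exact Submodule.smul_mem _ _ ((le_iSup (fun i => Tsp (t i)) i) (h2 h3))
  obtain ⟨i, hi⟩ := ht.tang y (by
    intro v hvT
    by_cases h0 : v = 0
    · rw [h0]; exact Submodule.zero_mem _
    have hm : (Projectivization.mk F v h0 : PP F _) ∈ embTangentSpace (SV F (s+1) m) x := by
      rw [mem_emb hy]
      have h1 := rep_mem (Projectivization.mk F v h0)
      rw [Projectivization.submodule_mk, Submodule.mem_span_singleton] at h1
      obtain ⟨c, hc⟩ := h1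
      rw [← hc]; exact Submodule.smul_mem _ _ hvT
    exact hv (hx2 hm (seg_mk_mem v h0)))
  refine ⟨i, ?_⟩
  have := Par_mk hi (hy ▸ x.rep_nonzero) (hne i)
  have h9 : Projectivization.mk F (seg y) (hy ▸ x.rep_nonzero) = x := by
    have h8 : ∀ (w) (hw : w ≠ 0), w = x.rep → Projectivization.mk F w hw = x := by
      rintro w hw rfl; exact x.mk_rep
    exact h8 _ _ hy.symm
  exact this.symm.trans h9

/-- pullback to the parameter space -/
def pull (f : MvPolynomial (Fin k × (Fin (s+1) → Fin (m+1))) F) :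
    MvPolynomial (Fin k × Fin (s+1) × Fin (m+1)) F :=
  aeval (fun c : Fin k × (Fin (s+1) → Fin (m+1)) => ∏ j, X (c.1, j, c.2 j)) f

theorem eval_pull (f : MvPolynomial (Fin k × (Fin (s+1) → Fin (m+1))) F) (a) :
    eval a (pull f) = eval (fun c => seg (pt a c.1) c.2) f := by
  unfold pull
  have : ∀ f : MvPolynomial (Fin k × (Fin (s+1) → Fin (m+1))) F,
    eval a (aeval (fun c : Fin k × (Fin (s+1) → Fin (m+1)) =>
      (∏ j, X (c.1, j, c.2 j) : MvPolynomial (Fin k × Fin (s+1) × Fin (m+1)) F)) f) =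
      eval (fun c => seg (pt a c.1) c.2) f := by
    intro f
    induction f using MvPolynomial.induction_on with
    | C a => simp [algebraMap_eq]
    | add p q hp hq => rw [map_add, map_add, map_add, hp, hq]
    | mul_X p n hp =>
      rw [map_mul, map_mul, map_mul, hp, aeval_X, eval_X, map_prod]
      simp [seg, pt]
  exact this f

theorem not_wd (h : ∃ G : MvPolynomial (Fin k × Fin (s+1) × Fin (m+1)) F, G ≠ 0 ∧
    ∀ a, eval a G ≠ 0 → Pkg (pt a)) : ¬ WeaklyDefective (SV F (s+1) m) k := by
  obtain ⟨G, hG, hP⟩ := h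
  rintro ⟨T, ⟨S, hS, rfl⟩, ⟨u0, hu0, hT⟩, hall⟩
  simp only [multiZeroLocus, Set.mem_setOf_eq, not_forall] at hT
  obtain ⟨f, hf, v, hv, hfv⟩ := hT
  choose b hb using fun i => SV_mem (hu0 i) (hv i)
  have hpf : pull f ≠ 0 := by
    intro h0
    apply hfv
    have := eval_pull f (unpt b)
    rw [h0, map_zero] at this
    rw [this]
    congr 2
    funext c
    rw [hb]; rfl
  obtain ⟨a, ha⟩ := exists_eval_ne (mul_ne_zero hG hpf)
  rw [map_mul, mul_ne_zero_iff] at ha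
  have hp := hP a ha.1
  have hne : ∀ i, seg (pt a i) ≠ 0 := fun i => seg_ne_zero (hp.ne i)
  have h1 := hall (fun i => Projectivization.mk F (seg (pt a i)) (hne i))
    (fun i => mk_mem_SV _ _) (by
      intro hm
      apply ha.2
      rw [eval_pull]
      exact hm f hf (fun i => seg (pt a i)) (fun i => seg_mk_mem _ _))
  exact absurd h1 (not_lt.2 (zdim_contact (Set.finite_range _) (tangency_sub hp hne)))

end

end

section
theorem eq_mk_of_mem {F P : Type*} [Field F] {x : PP F P} {v : P → F} (hv : v ∈ x.submodule)
    (h : v ≠ 0) : Projectivization.mk F v h = x := by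
  obtain ⟨c, rfl⟩ := mem_sub.1 hv
  conv_rhs => rw [← x.mk_rep]
  rw [Projectivization.mk_eq_mk_iff']
  exact ⟨c, rfl⟩

theorem vspan_sum {F P : Type*} [Field F] {S : Finset (PP F P)} {v : P → F}
    (hv : v ∈ vspan (S : Set (PP F P))) :
    ∃ μ : PP F P → P → F, (∀ x, μ x ∈ x.submodule) ∧ ∑ x ∈ S, μ x = v := by
  have h1 : vspan (S : Set (PP F P)) ≤ ⨆ x ∈ S, x.submodule := by
    refine Submodule.span_le.2 ?_
    intro w hw
    simp only [coneOf, Set.mem_iUnion] at hw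
    obtain ⟨x, hx, hw⟩ := hw
    exact (le_iSup₂ (f := fun (x : PP F P) (_ : x ∈ S) => x.submodule) x hx) hw
  obtain ⟨μ, hμ⟩ := (Submodule.mem_iSup_finset_iff_exists_sum _ _).1 (h1 hv)
  exact ⟨fun x => μ x, fun x => (μ x).2, hμ⟩

theorem seg_zero {F : Type*} [Field F] {s q : ℕ} :
    seg (0 : Fin (s+1) → Fin q → F) = 0 := by
  funext p
  simp [seg]

theorem vspan_tuple {F : Type*} [Field F] {s m k : ℕ} {S : Finset (PP F (Fin (s+1) → Fin (m+1)))}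
    (hS : ↑S ⊆ SV F (s+1) m) (hc : S.card ≤ k) {v} (hv : v ∈ vspan (S : Set (PP F _))) :
    ∃ (y : Fin k → Fin (s+1) → Fin (m+1) → F) (e : S → Fin k), ∑ i, seg (y i) = v ∧
      (∀ x : S, seg (y (e x)) ∈ x.1.submodule) ∧ v = ∑ x : S, seg (y (e x)) := by
  classical
  obtain ⟨μ, h1, h2⟩ := vspan_sum hv
  choose b hb using fun x : S => SV_mem (hS x.2) (h1 x.1)
  obtain ⟨e⟩ : Nonempty (S ↪ Fin k) := by
    apply Function.Embedding.nonempty_of_card_le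
    simpa using hc
  have h3 : ∀ x, Function.extend e b 0 (e x) = b x := fun x => e.injective.extend_apply _ _ _
  have h4 : v = ∑ x : S, seg (Function.extend e b 0 (e x)) := by
    rw [← h2, ← Finset.sum_coe_sort]
    exact Finset.sum_congr rfl fun x _ => by rw [h3, hb]
  refine ⟨Function.extend e b 0, e, ?_, fun x => ?_, h4⟩
  · rw [h4]
    symm
    refine Fintype.sum_of_injective e e.injective _ _ (fun i hi => ?_) fun i => rfl
    rw [Function.extend_apply' _ _ _ (by simpa using hi)]
    exact seg_zero
  · rw [h3, ← hb]; exact h1 _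

section
variable {F : Type u} [Field F] {m s k : ℕ}

theorem sub_of {t : Fin k → Fin (s+1) → Fin (m+1) → F} (hp : Pkg t)
    (hne : ∀ i, seg (t i) ≠ 0) {S : Finset (PP F (Fin (s+1) → Fin (m+1)))}
    (hS : ↑S ⊆ SV F (s+1) m) (hc : S.card ≤ k)
    (hv : ∑ i, seg (t i) ∈ vspan (S : Set (PP F _))) (i0 : Fin k) :
    Projectivization.mk F (seg (t i0)) (hne i0) ∈ S := by
  classical
  obtain ⟨y, e, h1, h2, h3⟩ := vspan_tuple hS hc hv
  by_contra hcon
  have h4 : ∀ x : S, ∃ (i : Fin k) (c : F), c • seg (t i) = seg (y (e x)) ∧ (i = i0 → c = 0) := by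
    intro x
    obtain ⟨i, hi⟩ := hp.ident y h1 (e x)
    obtain ⟨c, hc⟩ := Par_span hi (hne i)
    refine ⟨i, c, hc, ?_⟩
    rintro rfl
    by_contra h0
    apply hcon
    have h5 := h2 x
    rw [← hc] at h5
    have h6 : seg (t i) ∈ x.1.submodule := (Submodule.smul_mem_iff _ h0).1 h5
    rw [eq_mk_of_mem h6 (hne i)]
    exact x.2
  choose I c hI h0 using h4
  have h5 := hp.li (fun i => seg (t i) - ∑ x : S, if I x = i then c x • seg (t i) else 0) (by
    intro i
    refine Submodule.sub_mem _ (seg_mem _) (Submodule.sum_mem _ fun x _ => ?_)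
    split_ifs
    · exact Submodule.smul_mem _ _ (seg_mem _)
    · exact Submodule.zero_mem _) (by
    rw [Finset.sum_sub_distrib, Finset.sum_comm, sub_eq_zero]
    rw [h3]
    refine Finset.sum_congr rfl fun x _ => ?_
    rw [Finset.sum_ite_eq, if_pos (Finset.mem_univ _), hI]) i0
  apply hne i0
  have h6 : (∑ x : S, if I x = i0 then c x • seg (t i0) else 0) = 0 := by
    refine Finset.sum_eq_zero fun x _ => ?_
    split_ifs with h
    · rw [h0 x h, zero_smul]
    · rfl
  beta_reduce at h5
  rwa [h6, sub_zero] at h5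

theorem seg_inj {t : Fin k → Fin (s+1) → Fin (m+1) → F} (hp : Pkg t)
    (hne : ∀ i, seg (t i) ≠ 0) :
    Function.Injective fun i => Projectivization.mk F (seg (t i)) (hne i) := by
  classical
  intro i j hij
  by_contra hn
  obtain ⟨c, hc⟩ := (Projectivization.mk_eq_mk_iff' F _ _ (hne i) (hne j)).1 hij
  have h5 := hp.li (fun l => (if l = i then seg (t i) else 0) - if l = j then c • seg (t j) else 0) (by
    intro l
    refine Submodule.sub_mem _ ?_ ?_
    · split_ifs with h
      · rw [h]; exact seg_mem _
      · exact Submodule.zero_mem _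
    · split_ifs with h
      · rw [h]; exact Submodule.smul_mem _ _ (seg_mem _)
      · exact Submodule.zero_mem _) (by
    rw [Finset.sum_sub_distrib, Finset.sum_ite_eq', Finset.sum_ite_eq', if_pos (Finset.mem_univ _),
      if_pos (Finset.mem_univ _), hc, sub_self]) i
  simp only [if_true, if_neg hn, sub_zero] at h5
  exact hne i h5

theorem sum_mem_vspan {t : Fin k → Fin (s+1) → Fin (m+1) → F}
    (hne : ∀ i, seg (t i) ≠ 0) {S : Set (PP F (Fin (s+1) → Fin (m+1)))}
    (h : ∀ i, Projectivization.mk F (seg (t i)) (hne i) ∈ S) :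
    ∑ i, seg (t i) ∈ vspan S := by
  refine Submodule.sum_mem _ fun i _ => Submodule.subset_span ?_
  simp only [coneOf, Set.mem_iUnion]
  exact ⟨_, h i, seg_mk_mem _ _⟩

theorem mem_projSpan {P : Type*} {q : PP F P} {v : P → F} (hv : v ∈ q.submodule) (h : v ≠ 0)
    {S : Set (PP F P)} : q ∈ projSpan S ↔ v ∈ vspan S := by
  have h1 := eq_mk_of_mem hv h
  constructor
  · intro h2; exact h2 hv
  · intro h2
    change q.submodule ≤ _
    rw [← h1, Projectivization.submodule_mk, Submodule.span_le]
    simpa using h2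

theorem uniq_dec {t : Fin k → Fin (s+1) → Fin (m+1) → F} (hp : Pkg t)
    {q : PP F (Fin (s+1) → Fin (m+1))} (hq : ∑ i, seg (t i) ∈ q.submodule)
    (h0 : ∑ i, seg (t i) ≠ 0) : (∃! S : Finset (PP F (Fin (s+1) → Fin (m+1))), S ∈ decompositions (SV F (s+1) m) q) ∧
      ∃ S : Finset (PP F (Fin (s+1) → Fin (m+1))), ↑S ⊆ SV F (s+1) m ∧ S.card = k ∧ q ∈ projSpan (S : Set (PP F _)) := by
  classical
  have hne : ∀ i, seg (t i) ≠ 0 := fun i => seg_ne_zero (hp.ne i)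
  let S0 : Finset (PP F (Fin (s+1) → Fin (m+1))) :=
    Finset.univ.image fun i => Projectivization.mk F (seg (t i)) (hne i)
  have hc : S0.card = k := by
    rw [Finset.card_image_of_injective _ (seg_inj hp hne)]; simp
  have hS0 : ↑S0 ⊆ SV F (s+1) m := by
    intro x hx
    simp only [S0, Finset.coe_image, Finset.coe_univ, Set.image_univ, Set.mem_range] at hx
    obtain ⟨i, rfl⟩ := hx
    exact mk_mem_SV _ _
  have hq0 : q ∈ projSpan (S0 : Set (PP F _)) := by
    rw [mem_projSpan hq h0]
    refine sum_mem_vspan hne fun i => ?_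
    simp [S0]
  have hsub : ∀ S : Finset (PP F (Fin (s+1) → Fin (m+1))), ↑S ⊆ SV F (s+1) m → S.card ≤ k →
      q ∈ projSpan (S : Set (PP F _)) → S0 ⊆ S := by
    intro S h1 h2 h3 x hx
    simp only [S0, Finset.mem_image, Finset.mem_univ, true_and] at hx
    obtain ⟨i, rfl⟩ := hx
    exact sub_of hp hne h1 h2 ((mem_projSpan hq h0).1 h3) i
  have hx : xrank (SV F (s+1) m) q = k := by
    have hmem : k ∈ {k | ∃ S : Finset (PP F (Fin (s+1) → Fin (m+1))), ↑S ⊆ SV F (s+1) m ∧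
      S.card = k ∧ q ∈ projSpan (S : Set (PP F _))} := ⟨S0, hS0, hc, hq0⟩
    refine le_antisymm (Nat.sInf_le hmem) ?_
    refine le_csInf ⟨k, hmem⟩ ?_
    rintro n ⟨S, h1, rfl, h3⟩
    by_contra! hlt
    have := Finset.card_le_card (hsub S h1 hlt.le h3)
    omega
  refine ⟨⟨S0, ⟨hS0, hc.trans hx.symm, hq0⟩, ?_⟩, S0, hS0, hc, hq0⟩
  rintro S ⟨h1, h2, h3⟩
  rw [hx] at h2
  exact (Finset.eq_of_subset_of_card_le (hsub S h1 h2.le h3) (by omega)).symm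

/-- the parametrisation of the secant variety -/
def ph (F : Type u) [Field F] (m s k : ℕ) : MvPolynomial (Fin (s+1) → Fin (m+1)) F →ₐ[F]
    MvPolynomial (Fin k × Fin (s+1) × Fin (m+1)) F :=
  aeval (fun p : Fin (s+1) → Fin (m+1) => ∑ i, ∏ j, X (i, j, p j))

theorem eval_ph (f : MvPolynomial (Fin (s+1) → Fin (m+1)) F) (a) :
    eval a (ph F m s k f) = eval (∑ i, seg (pt a i)) f := by
  induction f using MvPolynomial.induction_on with
  | C a => unfold ph; simp [algebraMap_eq]
  | add p q hp hq => rw [map_add, map_add, map_add, hp, hq]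
  | mul_X p n hp =>
    rw [map_mul, map_mul, map_mul, hp, eval_X]
    congr 1
    unfold ph
    rw [aeval_X, map_sum]
    simp [seg, pt]

theorem homog_all [Infinite F] {P : Type*} {f : MvPolynomial P F} {v : P → F} 
    (h : ∀ c : F, c ≠ 0 → eval (c • v) f = 0) (d : ℕ) : eval v (homogeneousComponent d f) = 0 := by
  let p : Polynomial F := ∑ d ∈ Finset.range (f.totalDegree + 1),
    Polynomial.C (eval v (homogeneousComponent d f)) * Polynomial.X ^ d
  have hp : ∀ c, p.eval c = eval (c • v) f := by
    intro c
    conv_rhs => rw [← sum_homogeneousComponent f]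
    rw [map_sum]
    simp only [p, Polynomial.eval_finset_sum, Polynomial.eval_mul, Polynomial.eval_C,
      Polynomial.eval_pow, Polynomial.eval_X]
    refine Finset.sum_congr rfl fun d _ => ?_
    rw [homog_smul (homogeneousComponent_isHomogeneous d f), mul_comm]
  have h0 : Polynomial.X * p = 0 := by
    apply Polynomial.funext
    intro c
    rw [Polynomial.eval_mul, Polynomial.eval_X, Polynomial.eval_zero, hp]
    by_cases hc : c = 0
    · rw [hc, zero_mul]
    · rw [h c hc, mul_zero]
  have h1 : p = 0 := (mul_eq_zero.1 h0).resolve_left Polynomial.X_ne_zero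
  by_cases hd : d < f.totalDegree + 1
  · have h2 : p.coeff d = 0 := by rw [h1]; simp
    simpa [p, Polynomial.finset_sum_coeff, Polynomial.coeff_C_mul, Polynomial.coeff_X_pow, hd]
      using h2
  · rw [homogeneousComponent_eq_zero _ _ (by omega), map_zero]

theorem ident_of [IsAlgClosed F] [Infinite F] (hk : 1 ≤ k)
    (h : ∃ G : MvPolynomial (Fin k × Fin (s+1) × Fin (m+1)) F, G ≠ 0 ∧
    ∀ a, eval a G ≠ 0 → Pkg (pt a)) : Identifiable (SV F (s+1) m) k := by
  classical
  obtain ⟨G, hG, hP⟩ := h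
  obtain ⟨g, hg, hch⟩ := chev (ph F m s k) G hG
  have hnz : ∀ t : Fin k → Fin (s+1) → Fin (m+1) → F, Pkg t → ∑ i, seg (t i) ≠ 0 := by
    intro t hp h0
    exact seg_ne_zero (hp.ne ⟨0, hk⟩) (hp.li (fun i => seg (t i)) (fun i => seg_mem _) h0 _)
  refine ⟨zeroLocus (Set.range fun d => homogeneousComponent d g), ⟨_, ?_, rfl⟩, ?_, ?_⟩
  · rintro _ ⟨d, rfl⟩
    exact ⟨d, homogeneousComponent_isHomogeneous d g⟩
  · intro hsub
    obtain ⟨a, ha⟩ := exists_eval_ne (mul_ne_zero hG hg)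
    rw [map_mul, mul_ne_zero_iff] at ha
    have hp := hP a ha.1
    have h0 := hnz _ hp
    have h1 := (uniq_dec hp (seg_mk_mem _ h0) h0).2
    have h2 := hsub (sub_zclosure _ h1)
    apply ha.2
    rw [eval_ph, ← sum_homogeneousComponent g, map_sum]
    exact Finset.sum_eq_zero fun d _ => h2 _ ⟨d, rfl⟩ _ (seg_mk_mem _ h0)
  · rintro q ⟨hq, hqY⟩
    have h1 : ∃ v ∈ q.submodule, v ≠ 0 ∧ eval v g ≠ 0 := by
      by_contra! hcon
      apply hqY
      rintro _ ⟨d, rfl⟩ v hv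
      have h2 := homog_all (f := g) (v := q.rep) (fun c hc => hcon _
        (Submodule.smul_mem _ c (rep_mem q)) (smul_ne_zero hc q.rep_nonzero)) d
      obtain ⟨c, rfl⟩ := mem_sub.1 hv
      beta_reduce
      rw [homog_smul (homogeneousComponent_isHomogeneous d g), h2, mul_zero]
    obtain ⟨v, hv, hv0, hvg⟩ := h1
    obtain ⟨a, ha, hav⟩ := hch v (by
      intro f hf
      have h3 : ∀ b : Fin k → Fin (s+1) → Fin (m+1) → F, ∀ d,
          eval (∑ i, seg (b i)) (homogeneousComponent d f) = 0 := by
        intro b d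
        refine homog_all (fun c _ => ?_) d
        choose b' hb' using fun i => smul_seg (b i) c
        have h4 := eval_ph (k := k) f (unpt b')
        rw [hf, map_zero] at h4
        rw [Finset.smul_sum]
        simp only [hb']
        exact h4.symm
      have h5 : secant k (SV F (s+1) m) ⊆
          zeroLocus (Set.range fun d => homogeneousComponent d f) := by
        refine zclosure_sub ⟨_, ?_, rfl⟩ ?_
        · rintro _ ⟨d, rfl⟩
          exact ⟨d, homogeneousComponent_isHomogeneous d f⟩
        · rintro x ⟨S, hS, hc, hx⟩ _ ⟨d, rfl⟩ w hw
          obtain ⟨y, e, h6, -⟩ := vspan_tuple hS hc.le (hx hw)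
          rw [← h6]
          exact h3 _ _
      rw [← sum_homogeneousComponent f, map_sum]
      exact Finset.sum_eq_zero fun d _ => h5 hq _ ⟨d, rfl⟩ _ hv) hvg
    have h7 : ∑ i, seg (pt a i) = v := by
      funext p
      rw [← hav p, eval_ph, eval_X]
    have hp := hP a ha
    exact (uniq_dec hp (by rw [h7]; exact hv) (hnz _ hp)).1

end

end

section
theorem numeric (s m k a ε a' : ℕ) (hk : 1 ≤ k)
    (ha : a = (m + 1) ^ s / (m * s + 1))
    (hε : ε = a % (m + 1))
    (ha' : ((0 < ε ∨ (k + m * s) * (s * m + 1) ≤ (m + 1) ^ s - 1) ∧ a' = a - ε) ∨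
      (ε = 0 ∧ (m * s + 1) * a = (m + 1) ^ s ∧ a' = a - 1))
    (hka : k + m * s - 1 ≤ a') : (k + m * s) * (m * s + 1) ≤ (m + 1) ^ s := by
  have h1 : a * (m * s + 1) ≤ (m + 1) ^ s := by rw [ha]; exact Nat.div_mul_le_self _ _
  have h2 : ε ≤ a := by rw [hε]; exact Nat.mod_le _ _
  have key : k + m * s ≤ a → (k + m * s) * (m * s + 1) ≤ (m + 1) ^ s :=
    fun h => (Nat.mul_le_mul_right _ h).trans h1
  rcases ha' with ⟨h3 | h3, h4⟩ | ⟨h3, h4, h5⟩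
  · apply key; omega
  · rw [mul_comm s m] at h3; omega
  · apply key
    have : 0 < a := by
      rcases Nat.eq_zero_or_pos a with h | h
      · rw [h, mul_zero] at h4
        have : 0 < (m + 1) ^ s := by positivity
        omega
      · exact h
    omega

instance pp_sub {F P : Type*} [Field F] [Unique P] : Subsingleton (PP F P) := by
  constructor
  intro x y
  rw [← x.mk_rep, ← y.mk_rep, Projectivization.mk_eq_mk_iff']
  have h : y.rep default ≠ 0 := by
    intro h
    apply y.rep_nonzero
    funext p
    rw [Unique.eq_default p]; exact h
  refine ⟨x.rep default / y.rep default, ?_⟩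
  funext p
  rw [Unique.eq_default p]
  simp [h]

theorem case_zero {F : Type*} [Field F] (m : ℕ) : ¬WeaklyDefective (SV F 0 m) 1 ∧
      Identifiable (SV F 0 m) 1 := by
  classical
  have hseg : seg (0 : Fin 0 → Fin (m+1) → F) ≠ 0 := by
    intro h
    have := congrFun h default
    simp [seg] at this
  let x0 : PP F (Fin 0 → Fin (m+1)) := Projectivization.mk F _ hseg
  have hx0 : x0 ∈ SV F 0 m := mk_mem_SV _ _
  have hsp : ∀ q : PP F (Fin 0 → Fin (m+1)), q ∈ projSpan (({x0} : Finset _) : Set (PP F _)) := by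
    intro q w hw
    refine Submodule.subset_span ?_
    simp only [coneOf, Set.mem_iUnion]
    exact ⟨q, by rw [Subsingleton.elim q x0]; simp, hw⟩
  have hS0 : (({x0} : Finset (PP F (Fin 0 → Fin (m+1)))) : Set (PP F _)) ⊆ SV F 0 m := by
    simpa using hx0
  constructor
  · rintro ⟨T, -, ⟨u, hu, hT⟩, h⟩
    exact absurd (h u hu hT) (not_lt.2 (zdim_finite (Set.toFinite Set.univ) (Set.subset_univ _)))
  · refine ⟨∅, closed_empty, ?_, ?_⟩
    · intro h
      exact h (sub_zclosure _ ⟨{x0}, hS0, by simp, hsp x0⟩)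
    · rintro q -
      have hne : ∀ S : Finset (PP F (Fin 0 → Fin (m+1))), q ∈ projSpan (S : Set (PP F _)) →
          S = {x0} := by
        intro S hS
        rcases S.eq_empty_or_nonempty with h | ⟨x, hx⟩
        · exfalso
          have := hS (rep_mem q)
          rw [h] at this
          simp [vspan, coneOf] at this
          exact q.rep_nonzero this
        · ext y
          rw [Subsingleton.elim y x]
          exact ⟨fun _ => Finset.mem_singleton.2 (Subsingleton.elim x x0), fun _ => hx⟩
      have hr : xrank (SV F 0 m) q = 1 := by
        have hset : {k | ∃ S : Finset (PP F (Fin 0 → Fin (m+1))), ↑S ⊆ SV F 0 m ∧ S.card = k ∧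
            q ∈ projSpan (S : Set (PP F _))} = {1} := by
          ext n
          constructor
          · rintro ⟨S, -, rfl, h⟩
            rw [hne S h]; simp
          · rintro rfl
            exact ⟨{x0}, hS0, by simp, hsp q⟩
        unfold xrank
        rw [hset]; simp
      exact ⟨{x0}, ⟨hS0, by rw [hr]; simp, hsp q⟩, fun S hS => hne S hS.2.2⟩

theorem main_thm {K : Type*} [Field K] [IsAlgClosed K] [CharZero K]
    (s m k a ε a' : ℕ) (hm : 1 < m) (hk : 1 ≤ k)
    (ha : a = (m + 1) ^ s / (m * s + 1))
    (hε : ε = a % (m + 1))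
    (ha' : ((0 < ε ∨ (k + m * s) * (s * m + 1) ≤ (m + 1) ^ s - 1) ∧ a' = a - ε) ∨
      (ε = 0 ∧ (m * s + 1) * a = (m + 1) ^ s ∧ a' = a - 1))
    (hka : k + m * s - 1 ≤ a') :
    ¬WeaklyDefective (segreVariety K s fun _ => m) k ∧
      Identifiable (segreVariety K s fun _ => m) k := by
  have H := numeric s m k a ε a' hk ha hε ha' hka
  rcases s with _ | s
  · have ha1 : a = 1 := by rw [ha]; simp
    have hk1 : k = 1 := by
      simp at H; omega
    subst hk1
    exact case_zero m
  · have hs : 2 ≤ s := by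
      by_contra! hlt
      interval_cases s
      · simp at H; nlinarith
      · simp at H; nlinarith
    have hG := Pkg_generic (CERT_all (F := K) hm hs hk H) hk (by omega)
    exact ⟨not_wd hG, ident_of hk hG⟩

end

end

/-- **Corollary (e1).**  Let `X ⊆ ℙ^r` be the Segre embedding of `(ℙ^m)^s`, `m > 1`,
`r + 1 = (m+1)^s` (char `0`).  Set `a = ⌊(m+1)^s/(ms+1)⌋` and let `ε` be the unique
integer with `0 ≤ ε ≤ m` and `a ≡ ε (mod m+1)`.  If either `ε > 0` or
`(k+ms)(sm+1) ≤ (m+1)^s - 1`, set `a' = a - ε`; if `ε = 0` and `(ms+1)a = (m+1)^s`,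
set `a' = a - 1`.  Then for any positive integer `k` with `k + ms - 1 ≤ a'`, `X` is
not weakly `k`-defective, hence it is `k`-identifiable. -/
theorem statement13 {K : Type*} [Field K] [IsAlgClosed K] [CharZero K]
    (s m k a ε a' : ℕ) (hm : 1 < m) (hk : 1 ≤ k)
    (ha : a = (m + 1) ^ s / (m * s + 1))
    (hε : ε = a % (m + 1))
    (ha' : ((0 < ε ∨ (k + m * s) * (s * m + 1) ≤ (m + 1) ^ s - 1) ∧ a' = a - ε) ∨
      (ε = 0 ∧ (m * s + 1) * a = (m + 1) ^ s ∧ a' = a - 1))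
    (hka : k + m * s - 1 ≤ a') :
    ¬WeaklyDefective (segreVariety K s fun _ => m) k ∧
      Identifiable (segreVariety K s fun _ => m) k := by
  exact main_thm s m k a ε a' hm hk ha hε ha' hka

end ContactLoci
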